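/- Let T > 0 and let q : ℝ → ℝ be a T-periodic locally integrable function satisfying the mean value condition (q#) and the sign condition (q*). Let g ∈ C²([0,∞)) satisfy (g*), (gs) and (g**). Then: (1) there exists a positive T-periodic solution u* of u'' + q(t) g(u) = 0; (2) there exists an integer k* ≥ 1 such that for every integer k ≥ k* there exists an integer m_k ≥ 1 such that, for every integer j relatively prime with k and with 1 ≤ j ≤ m_k, the equation u'' + q(t) g(u) = 0 has two positive subharmonic solutions u_{k,j}^{(1)} and u_{k,j}^{(2)} of order k which do not belong to the same periodicity class, and such that for i = 1,2 the function u_{k,j}^{(i)} − u* has exactly 2j zeros in the interval [0, kT). -/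

import Mathlib

open MeasureTheory Set Filter

/-- `u` is a solution of `u'' + F(t,u) = 0`: `u` is of class `C¹` and its derivative `u'`
is locally absolutely continuous (it is the integral of a locally integrable function),
with `u'' + F(t, u(t)) = 0` for a.e. `t`. -/
def IsSol (F : ℝ → ℝ → ℝ) (u : ℝ → ℝ) : Prop :=
  ∃ u' : ℝ → ℝ,
    (∀ t, HasDerivAt u (u' t) t) ∧
    MeasureTheory.LocallyIntegrable (fun s => F s (u s)) MeasureTheory.volume ∧
    ∀ t, u' t = u' 0 - ∫ s in (0:ℝ)..t, F s (u s)

/-- `q ≻ 0` on `I` : `q ≥ 0` a.e. on `I` and `q ≢ 0` on `I`. -/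
def PosOn (q : ℝ → ℝ) (I : Set ℝ) : Prop :=
  (∀ᵐ t ∂(MeasureTheory.volume.restrict I), 0 ≤ q t) ∧
  ¬ (∀ᵐ t ∂(MeasureTheory.volume.restrict I), q t = 0)

/-- Condition `(q*)`: `[0,T]` splits into `m` closed intervals where `q ≻ 0`
separated by `m` closed intervals where `q ≺ 0`. -/
def SignCond (q : ℝ → ℝ) (T : ℝ) (m : ℕ) : Prop :=
  ∃ σ : ℕ → ℝ, σ 0 = 0 ∧ σ (2*m) = T ∧ (∀ i < 2*m, σ i < σ (i+1)) ∧
    (∀ i < m, PosOn q (Set.Icc (σ (2*i)) (σ (2*i+1)))) ∧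
    (∀ i < m, PosOn (fun t => - q t) (Set.Icc (σ (2*i+1)) (σ (2*i+2))))

/-- A subharmonic solution of order `k`: `kT`-periodic but not `ℓT`-periodic
for `ℓ = 1, …, k-1`. -/
def IsSubharmonic (u : ℝ → ℝ) (T : ℝ) (k : ℕ) : Prop :=
  Function.Periodic u (k * T) ∧ ∀ ℓ : ℕ, 1 ≤ ℓ → ℓ < k → ¬ Function.Periodic u (ℓ * T)

/-- `u` and `v` belong to the same periodicity class. -/
def SameClass (u v : ℝ → ℝ) (T : ℝ) : Prop :=
  ∃ ℓ : ℤ, ∀ t, v t = u (t + ℓ * T)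


namespace SH
open Topology

structure Setup where
  q : ℝ → ℝ
  T : ℝ
  hT : 0 < T
  per : Function.Periodic q T
  loc : LocallyIntegrable q volume
  L : ℝ
  hL : 0 < L
  B : ℝ
  hB0 : 0 ≤ B
  hB : ∀ a b, a ≤ b → b ≤ a + T → ∫ t in a..b, |q t| ≤ B
  n : ℕ
  hn : 0 < n
  small : T / n * L * B ≤ 1/16

def C1 (u : ℝ → ℝ) : Prop := Differentiable ℝ u ∧ Continuous (deriv u)

namespace Setup
variable (S : Setup)

noncomputable def η : ℝ := S.T / S.n

lemma eta_pos : 0 < S.η := div_pos S.hT (by exact_mod_cast S.hn)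

lemma n_mul_eta : (S.n : ℝ) * S.η = S.T := by
  have : (S.n : ℝ) ≠ 0 := by exact_mod_cast S.hn.ne'
  unfold η; field_simp

lemma eta_le : S.η ≤ S.T := by
  have h1 : (1 : ℝ) ≤ S.n := by exact_mod_cast S.hn
  have := S.n_mul_eta
  nlinarith [S.eta_pos]

lemma small' : S.η * S.L * S.B ≤ 1/16 := S.small

lemma qint (a b : ℝ) : IntervalIntegrable S.q volume a b :=
  (S.loc.integrableOn_isCompact isCompact_uIcc).intervalIntegrable

lemma qmul {φ : ℝ → ℝ} (h : Continuous φ) (a b : ℝ) :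
    IntervalIntegrable (fun t => S.q t * φ t) volume a b :=
  (S.qint a b).mul_continuousOn h.continuousOn

lemma qbound {φ : ℝ → ℝ} (h : Continuous φ) {a b M : ℝ} (hab : a ≤ b) (hb : b ≤ a + S.T)
    (hM0 : 0 ≤ M) (hM : ∀ t ∈ Icc a b, |φ t| ≤ M) : |∫ t in a..b, S.q t * φ t| ≤ S.B * M := by
  calc |∫ t in a..b, S.q t * φ t| ≤ ∫ t in a..b, |S.q t * φ t| :=
        intervalIntegral.abs_integral_le_integral_abs hab
    _ ≤ ∫ t in a..b, |S.q t| * M := by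
        apply intervalIntegral.integral_mono_on hab (S.qmul h a b).abs
          ((S.qint a b).abs.mul_const M)
        intro t ht
        rw [abs_mul]
        exact mul_le_mul_of_nonneg_left (hM t ht) (abs_nonneg _)
    _ = (∫ t in a..b, |S.q t|) * M := by rw [intervalIntegral.integral_mul_const]
    _ ≤ S.B * M := mul_le_mul_of_nonneg_right (S.hB a b hab hb) hM0

/-- bound for arbitrary subintervals -/
lemma qbound' {φ : ℝ → ℝ} (h : Continuous φ) {a b M : ℝ} (hb : b ≤ a + S.T)
    (hM0 : 0 ≤ M) (hM : ∀ t ∈ Icc a b, |φ t| ≤ M) {s t : ℝ} (hs : s ∈ Icc a b) (ht : t ∈ Icc a b) :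
    |∫ τ in s..t, S.q τ * φ τ| ≤ S.B * M := by
  rcases le_total s t with hst | hst
  · exact S.qbound h hst (by linarith [hs.1, ht.2]) hM0
      (fun τ hτ => hM τ ⟨hs.1.trans hτ.1, hτ.2.trans ht.2⟩)
  · rw [intervalIntegral.integral_symm, abs_neg]
    exact S.qbound h hst (by linarith [hs.2, ht.1]) hM0
      (fun τ hτ => hM τ ⟨ht.1.trans hτ.1, hτ.2.trans hs.2⟩)

def Adm (f : ℝ → ℝ) : Prop := (∀ s t, |f s - f t| ≤ S.L * |s - t|) ∧ f 0 = 0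

variable {S}

lemma Adm.cont {f : ℝ → ℝ} (hf : S.Adm f) : Continuous f := by
  have : LipschitzWith (Real.toNNReal S.L) f := by
    apply LipschitzWith.of_dist_le_mul
    intro x y
    rw [Real.dist_eq, Real.dist_eq, Real.coe_toNNReal _ S.hL.le]
    exact hf.1 x y
  exact this.continuous

variable (S)

def SolOn (f : ℝ → ℝ) (a b : ℝ) (u : ℝ → ℝ) : Prop :=
  C1 u ∧ ∀ s ∈ Icc a b, ∀ t ∈ Icc a b, deriv u t - deriv u s = - ∫ τ in s..t, S.q τ * f (u τ)

variable {S}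

lemma SolOn.mono {f : ℝ → ℝ} {a b a' b' : ℝ} {u : ℝ → ℝ} (h : S.SolOn f a b u)
    (ha : a ≤ a') (hb : b' ≤ b) : S.SolOn f a' b' u :=
  ⟨h.1, fun s hs t ht => h.2 s ⟨ha.trans hs.1, hs.2.trans hb⟩ t ⟨ha.trans ht.1, ht.2.trans hb⟩⟩

end Setup

lemma C1.sub {u v : ℝ → ℝ} (hu : C1 u) (hv : C1 v) : C1 (fun t => u t - v t) := by
  refine ⟨hu.1.sub hv.1, ?_⟩
  have : deriv (fun t => u t - v t) = fun t => deriv u t - deriv v t := by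
    funext t; exact deriv_fun_sub (hu.1 t) (hv.1 t)
  rw [this]; exact hu.2.sub hv.2

lemma C1.cont {u : ℝ → ℝ} (hu : C1 u) : Continuous u := hu.1.continuous

lemma C1.of {u v : ℝ → ℝ} (h : ∀ t, HasDerivAt u (v t) t) (hv : Continuous v) : C1 u :=
  ⟨fun t => (h t).differentiableAt, by
    have : deriv u = v := by funext t; exact (h t).deriv
    rwa [this]⟩

lemma deriv_eq_of {u v : ℝ → ℝ} (h : ∀ t, HasDerivAt u (v t) t) : deriv u = v := by
  funext t; exact (h t).deriv

lemma C1.interp {e : ℝ → ℝ} (he : C1 e) {a b κ : ℝ} (hab : a < b)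
    (h : ∀ s ∈ Icc a b, ∀ t ∈ Icc a b, |deriv e t - deriv e s| ≤ κ) :
    ∀ t ∈ Icc a b, |e t - (e a + (t - a) / (b - a) * (e b - e a))| ≤ κ * (b - a) := by
  intro t ht
  have hκ : 0 ≤ κ := by
    have := h a ⟨le_rfl, hab.le⟩ a ⟨le_rfl, hab.le⟩
    simpa using this
  rcases eq_or_lt_of_le ht.1 with hta | hta
  · subst hta; simp; exact mul_nonneg hκ (by linarith)
  obtain ⟨ξ, hξ, h1⟩ := exists_deriv_eq_slope e hta he.cont.continuousOn he.1.differentiableOn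
  obtain ⟨ζ, hζ, h2⟩ := exists_deriv_eq_slope e hab he.cont.continuousOn he.1.differentiableOn
  have hta' : t - a ≠ 0 := by linarith
  have hba' : b - a ≠ 0 := by linarith
  have e1 : e t - e a = deriv e ξ * (t - a) := by rw [h1]; field_simp
  have e2 : (t - a) / (b - a) * (e b - e a) = deriv e ζ * (t - a) := by rw [h2]; field_simp
  have : e t - (e a + (t - a) / (b - a) * (e b - e a)) = (deriv e ξ - deriv e ζ) * (t - a) := by
    rw [e2]; linarith
  rw [this, abs_mul, abs_of_pos (by linarith : 0 < t - a)]
  have := h ζ ⟨hζ.1.le, hζ.2.le⟩ ξ ⟨hξ.1.le, hξ.2.le.trans ht.2⟩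
  exact mul_le_mul this (by linarith [ht.2]) (by linarith) hκ

lemma C1.deriv_bd {e : ℝ → ℝ} (he : C1 e) {a b κ : ℝ} (hab : a < b)
    (h : ∀ s ∈ Icc a b, ∀ t ∈ Icc a b, |deriv e t - deriv e s| ≤ κ) :
    ∀ t ∈ Icc a b, |deriv e t| ≤ |e b - e a| / (b - a) + κ := by
  intro t ht
  obtain ⟨ζ, hζ, h2⟩ := exists_deriv_eq_slope e hab he.cont.continuousOn he.1.differentiableOn
  have h3 := h ζ ⟨hζ.1.le, hζ.2.le⟩ t ht
  have h4 : |deriv e ζ| = |e b - e a| / (b - a) := by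
    rw [h2, abs_div, abs_of_pos (by linarith : 0 < b - a)]
  calc |deriv e t| = |deriv e ζ + (deriv e t - deriv e ζ)| := by ring_nf
    _ ≤ |deriv e ζ| + |deriv e t - deriv e ζ| := abs_add_le _ _
    _ ≤ _ := by rw [h4]; linarith

namespace Setup
variable {S : Setup}

/-- increments of the derivative of a difference of two solutions -/
lemma diff_deriv {f₁ f₂ u₁ u₂ : ℝ → ℝ} {a b ε M : ℝ} (hf₁ : S.Adm f₁) (hf₂ : S.Adm f₂)
    (hε : ∀ s, |f₁ s - f₂ s| ≤ ε) (h₁ : S.SolOn f₁ a b u₁) (h₂ : S.SolOn f₂ a b u₂)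
    (hb : b ≤ a + S.η) (hM0 : 0 ≤ M) (hM : ∀ t ∈ Icc a b, |u₁ t - u₂ t| ≤ M) :
    ∀ s ∈ Icc a b, ∀ t ∈ Icc a b,
      |deriv (fun t => u₁ t - u₂ t) t - deriv (fun t => u₁ t - u₂ t) s| ≤ S.B * (S.L * M + ε) := by
  intro s hs t ht
  have hε0 : 0 ≤ ε := (abs_nonneg _).trans (hε 0)
  have hd : ∀ t, deriv (fun t => u₁ t - u₂ t) t = deriv u₁ t - deriv u₂ t := fun t =>
    deriv_fun_sub (h₁.1.1 t) (h₂.1.1 t)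
  have e1 := h₁.2 s hs t ht
  have e2 := h₂.2 s hs t ht
  have c1 : Continuous fun τ => f₁ (u₁ τ) := hf₁.cont.comp h₁.1.cont
  have c2 : Continuous fun τ => f₂ (u₂ τ) := hf₂.cont.comp h₂.1.cont
  have : deriv (fun t => u₁ t - u₂ t) t - deriv (fun t => u₁ t - u₂ t) s
      = - ∫ τ in s..t, S.q τ * (f₁ (u₁ τ) - f₂ (u₂ τ)) := by
    rw [hd, hd]
    simp_rw [mul_sub]
    rw [intervalIntegral.integral_sub (S.qmul c1 s t) (S.qmul c2 s t)]
    linarith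
  rw [this, abs_neg]
  refine S.qbound' (c1.sub c2) (by linarith [S.eta_le]) (by have := S.hL; positivity) ?_ hs ht
  intro τ hτ
  calc |f₁ (u₁ τ) - f₂ (u₂ τ)| = |(f₁ (u₁ τ) - f₁ (u₂ τ)) + (f₁ (u₂ τ) - f₂ (u₂ τ))| := by ring_nf
    _ ≤ |f₁ (u₁ τ) - f₁ (u₂ τ)| + |f₁ (u₂ τ) - f₂ (u₂ τ)| := abs_add_le _ _
    _ ≤ S.L * M + ε := by
        refine add_le_add ((hf₁.1 _ _).trans ?_) (hε _)
        exact mul_le_mul_of_nonneg_left (hM τ hτ) S.hL.le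

lemma stab {f₁ f₂ u₁ u₂ : ℝ → ℝ} {a b ε δ : ℝ} (hf₁ : S.Adm f₁) (hf₂ : S.Adm f₂)
    (hε : ∀ s, |f₁ s - f₂ s| ≤ ε) (h₁ : S.SolOn f₁ a b u₁) (h₂ : S.SolOn f₂ a b u₂)
    (hab : a < b) (hb : b ≤ a + S.η) (ha' : |u₁ a - u₂ a| ≤ δ) (hb' : |u₁ b - u₂ b| ≤ δ) :
    ∀ t ∈ Icc a b, |u₁ t - u₂ t| ≤ 2 * (δ + S.η * S.B * ε) := by
  have hε0 : 0 ≤ ε := (abs_nonneg _).trans (hε 0)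
  have hη := S.eta_pos
  have hB := S.hB0
  have hc : Continuous fun t => |u₁ t - u₂ t| := (h₁.1.cont.sub h₂.1.cont).abs
  obtain ⟨x, hx, hmax⟩ := isCompact_Icc.exists_isMaxOn (nonempty_Icc.2 hab.le) hc.continuousOn
  set M := |u₁ x - u₂ x| with hMdef
  have hM : ∀ t ∈ Icc a b, |u₁ t - u₂ t| ≤ M := fun t ht => hmax ht
  have hM0 : 0 ≤ M := abs_nonneg _
  have hd := diff_deriv hf₁ hf₂ hε h₁ h₂ hb hM0 hM
  have hi := (h₁.1.sub h₂.1).interp hab hd x hx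
  have hκ : S.B * (S.L * M + ε) * (b - a) ≤ M / 16 + S.η * S.B * ε := by
    have h0 : 0 ≤ S.B * (S.L * M + ε) := by have := S.hL; positivity
    calc S.B * (S.L * M + ε) * (b - a) ≤ S.B * (S.L * M + ε) * S.η :=
          mul_le_mul_of_nonneg_left (by linarith) h0
      _ = (S.η * S.L * S.B) * M + S.η * S.B * ε := by ring
      _ ≤ _ := by nlinarith [S.small']
  set θ := (x - a) / (b - a)
  have hθ0 : 0 ≤ θ := div_nonneg (by linarith [hx.1]) (by linarith)
  have hθ1 : θ ≤ 1 := by rw [div_le_one (by linarith)]; linarith [hx.2]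
  have hconv : |(u₁ a - u₂ a) + θ * ((u₁ b - u₂ b) - (u₁ a - u₂ a))| ≤ δ := by
    rw [abs_le] at ha' hb' ⊢
    constructor <;> nlinarith
  have hfin : M ≤ δ + M / 16 + S.η * S.B * ε := by
    have := abs_sub_abs_le_abs_sub (u₁ x - u₂ x) ((u₁ a - u₂ a) + θ * ((u₁ b - u₂ b) - (u₁ a - u₂ a)))
    have hi' : |u₁ x - u₂ x - ((u₁ a - u₂ a) + θ * ((u₁ b - u₂ b) - (u₁ a - u₂ a)))| ≤ S.B * (S.L * M + ε) * (b - a) := hi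
    linarith
  intro t ht
  have : 0 ≤ S.η * S.B * ε := by positivity
  have := hM t ht
  linarith

lemma uniq {f u₁ u₂ : ℝ → ℝ} {a b : ℝ} (hf : S.Adm f) (h₁ : S.SolOn f a b u₁)
    (h₂ : S.SolOn f a b u₂) (hab : a ≤ b) (hb : b ≤ a + S.η) (ha' : u₁ a = u₂ a)
    (hb' : u₁ b = u₂ b) : ∀ t ∈ Icc a b, u₁ t = u₂ t := by
  rcases eq_or_lt_of_le hab with h | h
  · subst h; intro t ht; rw [Icc_self] at ht; rw [mem_singleton_iff.1 ht]; exact ha'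
  intro t ht
  have := stab (ε := 0) (δ := 0) hf hf (by simp) h₁ h₂ h hb (by simp [ha']) (by simp [hb']) t ht
  simp at this
  linarith

/-- comparison on short intervals -/
lemma comp {f u₁ u₂ : ℝ → ℝ} {a b : ℝ} (hf : S.Adm f) (h₁ : S.SolOn f a b u₁)
    (h₂ : S.SolOn f a b u₂) (hb : b ≤ a + S.η) (ha' : u₁ a ≤ u₂ a)
    (hb' : u₁ b ≤ u₂ b) : ∀ t ∈ Icc a b, u₁ t ≤ u₂ t := by
  intro t ht
  by_contra hcon
  push Not at hcon
  have hc : Continuous fun t => u₁ t - u₂ t := h₁.1.cont.sub h₂.1.cont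
  obtain ⟨a', haa, h1⟩ : ∃ x ∈ Icc a t, u₁ x - u₂ x = 0 :=
    intermediate_value_Icc ht.1 hc.continuousOn ⟨by linarith, by linarith⟩
  obtain ⟨b', hbb, h2⟩ : ∃ x ∈ Icc t b, u₁ x - u₂ x = 0 :=
    intermediate_value_Icc' ht.2 hc.continuousOn ⟨by linarith, by linarith⟩
  have := uniq hf (h₁.mono haa.1 hbb.2) (h₂.mono haa.1 hbb.2) (haa.2.trans hbb.1)
    (by linarith [haa.1, hbb.2]) (by linarith) (by linarith) t ⟨haa.2, hbb.1⟩
  linarith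

/-- uniqueness for the initial value problem -/
lemma ivp {f u₁ u₂ : ℝ → ℝ} {a b c : ℝ} (hf : S.Adm f) (h₁ : S.SolOn f a b u₁)
    (h₂ : S.SolOn f a b u₂) (hb : b ≤ a + S.η) (hc : c ∈ Icc a b) (h0 : u₁ c = u₂ c)
    (h1 : deriv u₁ c = deriv u₂ c) : ∀ t ∈ Icc a b, u₁ t = u₂ t := by
  have hcon : Continuous fun t => |u₁ t - u₂ t| := (h₁.1.cont.sub h₂.1.cont).abs
  obtain ⟨x, hx, hmax⟩ := isCompact_Icc.exists_isMaxOn ⟨c, hc⟩ hcon.continuousOn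
  set M := |u₁ x - u₂ x| with hMdef
  have hM : ∀ t ∈ Icc a b, |u₁ t - u₂ t| ≤ M := fun t ht => hmax ht
  have hM0 : 0 ≤ M := abs_nonneg _
  have hd := diff_deriv (ε := 0) hf hf (by simp) h₁ h₂ hb hM0 hM
  have hdc : deriv (fun t => u₁ t - u₂ t) c = 0 := by
    rw [deriv_fun_sub (h₁.1.1 c) (h₂.1.1 c), h1, sub_self]
  have hbd : ∀ t ∈ Icc a b, ‖deriv (fun t => u₁ t - u₂ t) t‖ ≤ S.B * (S.L * M + 0) := by
    intro t ht
    have := hd c hc t ht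
    rwa [hdc, sub_zero] at this
  have hmv := Convex.norm_image_sub_le_of_norm_deriv_le (f := fun t => u₁ t - u₂ t)
    (fun t _ => (h₁.1.sub h₂.1).1 t) hbd (convex_Icc a b) hc hx
  simp only [h0, sub_self, sub_zero, Real.norm_eq_abs] at hmv
  have hxc : |x - c| ≤ S.η := by rw [abs_le]; constructor <;> linarith [hx.1, hx.2, hc.1, hc.2]
  have : M ≤ M / 16 := by
    calc M ≤ S.B * (S.L * M + 0) * |x - c| := hmv
      _ ≤ S.B * (S.L * M + 0) * S.η := mul_le_mul_of_nonneg_left hxc (by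
          have := S.hL; have := S.hB0; positivity)
      _ = (S.η * S.L * S.B) * M := by ring
      _ ≤ _ := by nlinarith [S.small']
  have hM00 : M = 0 := by linarith
  intro t ht
  have := hM t ht
  rw [hM00] at this
  have := abs_nonpos_iff.1 this
  linarith

end Setup
end SH

namespace SH
open Topology

lemma nlem {r φ : ℝ → ℝ} (hr : ∀ a b, IntervalIntegrable r volume a b) (hφ : C1 φ) (a x : ℝ) :
    HasDerivAt (fun t => (∫ s in a..t, r s) * φ t - ∫ s in a..t, r s * φ s)
      ((∫ s in a..x, r s) * deriv φ x) x := by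
  have hrφ : ∀ a b, IntervalIntegrable (fun s => r s * φ s) volume a b := fun a b =>
    (hr a b).mul_continuousOn hφ.cont.continuousOn
  rw [hasDerivAt_iff_isLittleO]
  have h1 : (fun y => (∫ s in a..x, r s) * (φ y - φ x - (y - x) • deriv φ x))
      =o[𝓝 x] fun y => y - x :=
    (hasDerivAt_iff_isLittleO.1 (hφ.1 x).hasDerivAt).const_mul_left _
  obtain ⟨C, hC⟩ : ∃ C, ∀ t ∈ Icc (x-1) (x+1), ‖deriv φ t‖ ≤ C :=
    isCompact_Icc.exists_bound_of_continuousOn hφ.2.continuousOn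
  have hC0 : 0 ≤ C := (norm_nonneg _).trans (hC x ⟨by linarith, by linarith⟩)
  have h2 : (fun y => ∫ s in x..y, r s * (φ y - φ s)) =o[𝓝 x] fun y => y - x := by
    have ho : (fun y => (∫ s in x..y, |r s|) * C) =o[𝓝 x] fun _ => (1:ℝ) := by
      rw [Asymptotics.isLittleO_one_iff]
      have hc : Continuous fun y => (∫ s in x..y, |r s|) * C :=
        (intervalIntegral.continuous_primitive (fun a b => (hr a b).abs) x).mul continuous_const
      have := hc.tendsto x
      simpa using this
    have hO : (fun y => (∫ s in x..y, |r s|) * C * (y - x)) =o[𝓝 x] fun y => y - x := by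
      simpa using ho.mul_isBigO (Asymptotics.isBigO_refl (fun y => y - x) (𝓝 x))
    refine Asymptotics.IsBigO.trans_isLittleO ?_ hO
    apply Asymptotics.IsBigO.of_bound 1
    have : Icc (x-1) (x+1) ∈ 𝓝 x := Icc_mem_nhds (by linarith) (by linarith)
    filter_upwards [this] with y hy
    have key : ∀ s ∈ uIcc x y, |φ y - φ s| ≤ C * |y - x| := by
      intro s hs
      have hsub : uIcc x y ⊆ Icc (x-1) (x+1) := uIcc_subset_Icc ⟨by linarith, by linarith⟩ hy
      have := Convex.norm_image_sub_le_of_norm_deriv_le (f := φ) (fun t _ => hφ.1 t) hC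
        (convex_Icc _ _) (hsub hs) hy
      refine this.trans (mul_le_mul_of_nonneg_left ?_ hC0)
      rw [Real.norm_eq_abs]
      exact abs_sub_right_of_mem_uIcc hs
    have hint : ‖∫ s in x..y, r s * (φ y - φ s)‖ ≤ |∫ s in x..y, |r s| * (C * |y - x|)| := by
      apply intervalIntegral.norm_integral_le_abs_of_norm_le
      · rw [ae_restrict_iff' measurableSet_uIoc]
        refine ae_of_all _ fun s hs => ?_
        rw [norm_mul]
        exact mul_le_mul_of_nonneg_left (key s (uIoc_subset_uIcc hs)) (norm_nonneg _)
      · exact (hr x y).abs.mul_const _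
    rw [intervalIntegral.integral_mul_const] at hint
    rw [one_mul]
    refine hint.trans (le_of_eq ?_)
    rw [Real.norm_eq_abs, abs_mul, abs_mul, abs_mul, abs_mul, abs_abs]; ring
  refine (h1.add h2).congr_left fun y => ?_
  have e1 : ∫ s in a..y, r s = (∫ s in a..x, r s) + ∫ s in x..y, r s :=
    (intervalIntegral.integral_add_adjacent_intervals (hr _ _) (hr _ _)).symm
  have e2 : ∫ s in a..y, r s * φ s = (∫ s in a..x, r s * φ s) + ∫ s in x..y, r s * φ s :=
    (intervalIntegral.integral_add_adjacent_intervals (hrφ _ _) (hrφ _ _)).symm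
  have e3 : ∫ s in x..y, r s * (φ y - φ s) = (∫ s in x..y, r s) * φ y - ∫ s in x..y, r s * φ s := by
    simp_rw [mul_sub]
    rw [intervalIntegral.integral_sub ((hr _ _).mul_const _) (hrφ _ _),
      intervalIntegral.integral_mul_const]
  rw [e3, e1, e2]
  simp only [smul_eq_mul]
  ring

namespace Setup
variable {S : Setup}

lemma ibp {f u φ : ℝ → ℝ} {a b : ℝ} (hf : S.Adm f) (hu : S.SolOn f a b u) (hab : a ≤ b)
    (hφ : C1 φ) : ∫ t in a..b, deriv u t * deriv φ t =
      deriv u b * φ b - deriv u a * φ a + ∫ t in a..b, S.q t * f (u t) * φ t := by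
  set r := fun t => S.q t * f (u t)
  have hr : ∀ a b, IntervalIntegrable r volume a b := S.qmul (hf.cont.comp hu.1.cont)
  have hRc : Continuous fun t => ∫ s in a..t, r s := intervalIntegral.continuous_primitive hr a
  have h1 := intervalIntegral.integral_eq_sub_of_hasDerivAt
    (a := a) (b := b) (fun x _ => nlem hr hφ a x) ((hRc.mul hφ.2).intervalIntegrable _ _)
  have h2 : ∫ t in a..b, deriv φ t = φ b - φ a :=
    intervalIntegral.integral_eq_sub_of_hasDerivAt (fun x _ => (hφ.1 x).hasDerivAt)
      (hφ.2.intervalIntegrable _ _)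
  have h3 : ∫ t in a..b, deriv u t * deriv φ t
      = ∫ t in a..b, (deriv u a * deriv φ t - (∫ s in a..t, r s) * deriv φ t) := by
    apply intervalIntegral.integral_congr
    intro t ht
    rw [uIcc_of_le hab] at ht
    have := hu.2 a ⟨le_rfl, hab⟩ t ht
    simp only
    rw [show deriv u t = deriv u a - ∫ s in a..t, r s by linarith]
    ring
  have i1 : IntervalIntegrable (fun t => deriv u a * deriv φ t) volume a b :=
    (continuous_const.mul hφ.2).intervalIntegrable _ _
  have i2 : IntervalIntegrable (fun t => (∫ s in a..t, r s) * deriv φ t) volume a b :=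
    (hRc.mul hφ.2).intervalIntegrable _ _
  rw [h3, intervalIntegral.integral_sub i1 i2, h1, intervalIntegral.integral_const_mul, h2]
  have := hu.2 a ⟨le_rfl, hab⟩ b ⟨hab, le_rfl⟩
  rw [show deriv u b = deriv u a - ∫ s in a..b, r s by linarith]
  simp
  ring

lemma dir_exists {f : ℝ → ℝ} (hf : S.Adm f) {a b : ℝ} (hab : a < b) (hb : b ≤ a + S.η) (α β : ℝ) :
    ∃ u, S.SolOn f a b u ∧ u a = α ∧ u b = β := by
  have hη := S.eta_pos
  have hL := S.hL
  have hB := S.hB0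
  have : Nonempty (Icc a b) := ⟨⟨a, le_rfl, hab.le⟩⟩
  let ext : C(Icc a b, ℝ) → ℝ → ℝ := fun v => IccExtend hab.le v
  have hext : ∀ v, Continuous (ext v) := fun v => v.continuous.Icc_extend'
  let ρ : C(Icc a b, ℝ) → ℝ → ℝ := fun v s => ∫ τ in a..s, S.q τ * f (ext v τ)
  have hρ : ∀ v, Continuous (ρ v) := fun v =>
    intervalIntegral.continuous_primitive (S.qmul (hf.cont.comp (hext v))) a
  let V : C(Icc a b, ℝ) → ℝ → ℝ := fun v t => ∫ s in a..t, ρ v s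
  have hV : ∀ v t, HasDerivAt (V v) (ρ v t) t := fun v t => (hρ v).integral_hasStrictDerivAt a t |>.hasDerivAt
  let G : C(Icc a b, ℝ) → ℝ → ℝ := fun v t => α + (t - a) / (b - a) * (β - α + V v b) - V v t
  have hG : ∀ v t, HasDerivAt (G v) ((β - α + V v b) / (b - a) - ρ v t) t := by
    intro v t
    have h1 : HasDerivAt (fun t : ℝ => α + (t - a) / (b - a) * (β - α + V v b))
        (1 / (b - a) * (β - α + V v b)) t :=
      ((((hasDerivAt_id t).sub_const a).div_const (b - a)).mul_const _).const_add α
    have h2 := h1.sub (hV v t)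
    rwa [show 1 / (b - a) * (β - α + V v b) - ρ v t = (β - α + V v b) / (b - a) - ρ v t by ring] at h2
  have hGc : ∀ v, Continuous (G v) := fun v =>
    continuous_iff_continuousAt.2 fun t => (hG v t).continuousAt
  let K : C(Icc a b, ℝ) → C(Icc a b, ℝ) := fun v => ⟨fun t => G v t, (hGc v).comp continuous_subtype_val⟩
  have hcontr : ContractingWith (1/2) K := by
    refine ⟨by norm_num, LipschitzWith.of_dist_le_mul fun v w => ?_⟩
    have hd : 0 ≤ dist v w := dist_nonneg
    rw [ContinuousMap.dist_le (by positivity)]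
    have hρd : ∀ s ∈ Icc a b, |ρ v s - ρ w s| ≤ S.B * (S.L * dist v w) := by
      intro s hs
      have c1 : Continuous fun τ => f (ext v τ) := hf.cont.comp (hext v)
      have c2 : Continuous fun τ => f (ext w τ) := hf.cont.comp (hext w)
      have : ρ v s - ρ w s = ∫ τ in a..s, S.q τ * (f (ext v τ) - f (ext w τ)) := by
        simp_rw [mul_sub]
        rw [intervalIntegral.integral_sub (S.qmul c1 a s) (S.qmul c2 a s)]
      rw [this]
      refine S.qbound' (c1.sub c2) (a := a) (b := b) (by linarith [S.eta_le]) (by positivity) ?_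
        ⟨le_rfl, hab.le⟩ hs
      intro τ _
      refine (hf.1 _ _).trans (mul_le_mul_of_nonneg_left ?_ hL.le)
      exact ContinuousMap.dist_apply_le_dist (f := v) (g := w) _
    have hVd : ∀ t ∈ Icc a b, |V v t - V w t| ≤ dist v w / 16 := by
      intro t ht
      have : V v t - V w t = ∫ s in a..t, (ρ v s - ρ w s) := by
        rw [intervalIntegral.integral_sub ((hρ v).intervalIntegrable _ _)
          ((hρ w).intervalIntegrable _ _)]
      rw [this]
      have := intervalIntegral.norm_integral_le_of_norm_le_const (a := a) (b := t)
        (f := fun s => ρ v s - ρ w s) (C := S.B * (S.L * dist v w)) (by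
          intro s hs
          rw [uIoc_of_le ht.1] at hs
          exact hρd s ⟨hs.1.le, hs.2.trans ht.2⟩)
      refine this.trans ?_
      rw [abs_of_nonneg (by linarith [ht.1])]
      calc S.B * (S.L * dist v w) * (t - a) ≤ S.B * (S.L * dist v w) * S.η :=
            mul_le_mul_of_nonneg_left (by linarith [ht.2]) (by positivity)
        _ = (S.η * S.L * S.B) * dist v w := by ring
        _ ≤ _ := by nlinarith [S.small']
    intro t
    have hθ0 : 0 ≤ ((t:ℝ) - a) / (b - a) := div_nonneg (by linarith [t.2.1]) (by linarith)
    have hθ1 : ((t:ℝ) - a) / (b - a) ≤ 1 := by rw [div_le_one (by linarith)]; linarith [t.2.2]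
    have e : K v t - K w t = ((t:ℝ) - a) / (b - a) * (V v b - V w b) - (V v t - V w t) := by
      change G v t - G w t = _
      simp only [G]; ring
    rw [Real.dist_eq, e]
    have h1 := hVd b ⟨hab.le, le_rfl⟩
    have h2 := hVd t t.2
    have h3 : |((t:ℝ) - a) / (b - a) * (V v b - V w b)| ≤ dist v w / 16 := by
      rw [abs_mul, abs_of_nonneg hθ0]
      calc _ ≤ 1 * |V v b - V w b| := mul_le_mul_of_nonneg_right hθ1 (abs_nonneg _)
        _ ≤ _ := by linarith
    have h4 := abs_sub (((t:ℝ) - a) / (b - a) * (V v b - V w b)) (V v t - V w t)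
    have : ((1/2 : NNReal) : ℝ) = 1/2 := by norm_num
    rw [this]
    linarith
  set v := ContractingWith.fixedPoint K hcontr
  have hfix : K v = v := hcontr.fixedPoint_isFixedPt
  have hev : ∀ t ∈ Icc a b, ext v t = G v t := by
    intro t ht
    change IccExtend hab.le v t = _
    rw [IccExtend_of_mem _ _ ht]
    conv_lhs => rw [← hfix]
    rfl
  have hVa : V v a = 0 := intervalIntegral.integral_same
  have hba : b - a ≠ 0 := by linarith
  refine ⟨G v, ⟨C1.of (hG v) (continuous_const.sub (hρ v)), ?_⟩, ?_, ?_⟩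
  · intro s hs t ht
    rw [deriv_eq_of (hG v)]
    have e : ∫ τ in s..t, S.q τ * f (G v τ) = ∫ τ in s..t, S.q τ * f (ext v τ) := by
      apply intervalIntegral.integral_congr
      intro τ hτ
      have : τ ∈ Icc a b := (uIcc_subset_Icc hs ht) hτ
      simp only [hev τ this]
    rw [e]
    have c1 := hf.cont.comp (hext v)
    have := intervalIntegral.integral_add_adjacent_intervals (S.qmul c1 a s) (S.qmul c1 s t)
    simp only [ρ]
    simp only [Function.comp] at this
    linarith
  · simp [G, hVa]
  · simp only [G]; rw [div_self hba]; ring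

end Setup
end SH

namespace SH
open Topology

noncomputable def prim (f : ℝ → ℝ) (s : ℝ) : ℝ := ∫ τ in (0:ℝ)..s, f τ

lemma prim_deriv {f : ℝ → ℝ} (hf : Continuous f) (s : ℝ) : HasDerivAt (prim f) (f s) s :=
  (hf.integral_hasStrictDerivAt 0 s).hasDerivAt

lemma prim_cont {f : ℝ → ℝ} (hf : Continuous f) : Continuous (prim f) :=
  continuous_iff_continuousAt.2 fun s => (prim_deriv hf s).continuousAt

/-- mean value form with arbitrary slope comparison -/
lemma prim_est {f : ℝ → ℝ} (hf : Continuous f) {s t c ε : ℝ}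
    (h : ∀ x ∈ uIcc s t, |f x - c| ≤ ε) : |prim f t - prim f s - c * (t - s)| ≤ ε * |t - s| := by
  have := Convex.norm_image_sub_le_of_norm_deriv_le (f := fun x => prim f x - c * x) (s := uIcc s t)
    (x := s) (y := t) (C := ε)
    (fun x _ => ((prim_deriv hf x).sub ((hasDerivAt_id x).const_mul c)).differentiableAt) (by
      intro x hx
      have h2 : HasDerivAt (fun x => prim f x - c * x) (f x - c * 1) x :=
        (prim_deriv hf x).sub ((hasDerivAt_id x).const_mul c)
      rw [h2.deriv, mul_one]
      exact h x hx) (convex_uIcc s t) left_mem_uIcc right_mem_uIcc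
  rw [Real.norm_eq_abs, Real.norm_eq_abs] at this
  rwa [show prim f t - prim f s - c * (t - s) = prim f t - c * t - (prim f s - c * s) by ring]

lemma cs {φ : ℝ → ℝ} (hφ : C1 φ) {a b c t : ℝ} (hc : c ∈ Icc a b) (ht : t ∈ Icc a b) :
    (φ t - φ c)^2 ≤ (b - a) * ∫ s in a..b, (deriv φ s)^2 := by
  have hint : ∀ x y, IntervalIntegrable (fun s => (deriv φ s)^2) volume x y := fun x y =>
    (hφ.2.pow 2).intervalIntegrable _ _
  wlog hct : c ≤ t generalizing c t
  · have := this ht hc (by linarith)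
    nlinarith
  have hsub : ∫ s in c..t, (deriv φ s)^2 ≤ ∫ s in a..b, (deriv φ s)^2 :=
    intervalIntegral.integral_mono_interval hc.1 hct ht.2
      (ae_of_all _ fun s => sq_nonneg _) (hint _ _)
  have h0 : 0 ≤ ∫ s in c..t, (deriv φ s)^2 :=
    intervalIntegral.integral_nonneg hct fun s _ => sq_nonneg _
  rcases eq_or_lt_of_le hct with h | h
  · subst h
    simp
    exact mul_nonneg (by linarith [hc.1, hc.2]) (by linarith)
  set D := φ t - φ c
  have hD : ∫ s in c..t, deriv φ s = D :=
    intervalIntegral.integral_eq_sub_of_hasDerivAt (fun x _ => (hφ.1 x).hasDerivAt)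
      (hφ.2.intervalIntegrable _ _)
  have hl : 0 < t - c := by linarith
  have hsq : 0 ≤ ∫ s in c..t, (deriv φ s - D / (t - c))^2 :=
    intervalIntegral.integral_nonneg hct fun s _ => sq_nonneg _
  have e : ∫ s in c..t, (deriv φ s - D / (t - c))^2
      = (∫ s in c..t, (deriv φ s)^2) - D^2 / (t - c) := by
    have : ∀ s, (deriv φ s - D / (t - c))^2
        = (deriv φ s)^2 - (2 * (D / (t - c)) * deriv φ s - (D / (t - c))^2) := fun s => by ring
    simp_rw [this]
    have i1 : IntervalIntegrable (fun s => 2 * (D / (t - c)) * deriv φ s) volume c t :=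
      (continuous_const.mul hφ.2).intervalIntegrable _ _
    rw [intervalIntegral.integral_sub (hint _ _) (i1.sub intervalIntegrable_const),
      intervalIntegral.integral_sub i1 intervalIntegrable_const,
      intervalIntegral.integral_const_mul, hD, intervalIntegral.integral_const, smul_eq_mul]
    field_simp
    ring
  rw [e] at hsq
  have h1 : D^2 / (t - c) ≤ ∫ s in a..b, (deriv φ s)^2 := by linarith
  rw [div_le_iff₀ hl] at h1
  have : (∫ s in a..b, (deriv φ s)^2) * (t - c) ≤ (∫ s in a..b, (deriv φ s)^2) * (b - a) :=
    mul_le_mul_of_nonneg_left (by linarith [hc.1, ht.2]) (by linarith)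
  linarith

namespace Setup
variable (S : Setup)

noncomputable def J (f : ℝ → ℝ) (a b : ℝ) (u : ℝ → ℝ) : ℝ :=
  ∫ t in a..b, ((deriv u t)^2 / 2 - S.q t * prim f (u t))

variable {S}

lemma Jint {f u : ℝ → ℝ} (hf : Continuous f) (hu : C1 u) (a b : ℝ) :
    IntervalIntegrable (fun t => (deriv u t)^2 / 2 - S.q t * prim f (u t)) volume a b :=
  (((hu.2.pow 2).div_const 2).intervalIntegrable _ _).sub (S.qmul ((prim_cont hf).comp hu.cont) a b)

lemma J_add {f u : ℝ → ℝ} (hf : Continuous f) (hu : C1 u) (a b c : ℝ) :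
    S.J f a b u + S.J f b c u = S.J f a c u :=
  intervalIntegral.integral_add_adjacent_intervals (Jint hf hu a b) (Jint hf hu b c)

lemma J_congr {f u v : ℝ → ℝ} {a b : ℝ} (hab : a ≤ b) (h : ∀ t ∈ Icc a b, u t = v t) :
    S.J f a b u = S.J f a b v := by
  apply intervalIntegral.integral_congr_ae
  have : ∀ᵐ t : ℝ, t ≠ b := by simp [ae_iff, measure_singleton]
  filter_upwards [this] with t htb ht
  rw [uIoc_of_le hab] at ht
  have hmem : Icc a b ∈ 𝓝 t := Icc_mem_nhds ht.1 (lt_of_le_of_ne ht.2 htb)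
  have : u =ᶠ[𝓝 t] v := by filter_upwards [hmem] with x hx using h x hx
  rw [this.deriv_eq, this.eq_of_nhds]

/-- generic first order expansion of the energy around a solution -/
lemma J_expand {f u z : ℝ → ℝ} {a b : ℝ} (hf : S.Adm f) (hu : S.SolOn f a b u) (hab : a ≤ b)
    (hz : C1 z) : S.J f a b z - S.J f a b u =
      deriv u b * (z b - u b) - deriv u a * (z a - u a)
      + (∫ t in a..b, (deriv (fun t => z t - u t) t)^2) / 2
      - ∫ t in a..b, S.q t * (prim f (z t) - prim f (u t) - f (u t) * (z t - u t)) := by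
  have hφ : C1 (fun t => z t - u t) := hz.sub hu.1
  have hi := ibp hf hu hab hφ
  have hd : ∀ t, deriv (fun t => z t - u t) t = deriv z t - deriv u t := fun t =>
    deriv_fun_sub (hz.1 t) (hu.1.1 t)
  have cF := prim_cont hf.cont
  have i1 : IntervalIntegrable (fun t => deriv u t * deriv (fun t => z t - u t) t) volume a b :=
    (hu.1.2.mul hφ.2).intervalIntegrable _ _
  have i2 : IntervalIntegrable (fun t => (deriv (fun t => z t - u t) t)^2 / 2) volume a b :=
    ((hφ.2.pow 2).div_const 2).intervalIntegrable _ _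
  have i3 : IntervalIntegrable
      (fun t => S.q t * (prim f (z t) - prim f (u t) - f (u t) * (z t - u t))) volume a b :=
    S.qmul (((cF.comp hz.cont).sub (cF.comp hu.1.cont)).sub
      ((hf.cont.comp hu.1.cont).mul hφ.cont)) a b
  have i4 : IntervalIntegrable (fun t => S.q t * f (u t) * (z t - u t)) volume a b := by
    have := S.qmul ((hf.cont.comp hu.1.cont).mul hφ.cont) a b
    have e : (fun t => S.q t * f (u t) * (z t - u t)) = fun t => S.q t * (f (u t) * (z t - u t)) := by
      funext t; ring
    rw [e]; exact this
  have e : S.J f a b z - S.J f a b u = ∫ t in a..b, (deriv u t * deriv (fun t => z t - u t) t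
      + (deriv (fun t => z t - u t) t)^2 / 2 - S.q t * f (u t) * (z t - u t)
      - S.q t * (prim f (z t) - prim f (u t) - f (u t) * (z t - u t))) := by
    unfold J
    rw [← intervalIntegral.integral_sub (Jint hf.cont hz a b) (Jint hf.cont hu.1 a b)]
    congr 1
    funext t
    rw [hd]; ring
  rw [e, intervalIntegral.integral_sub ((i1.add i2).sub i4) i3,
    intervalIntegral.integral_sub (i1.add i2) i4, intervalIntegral.integral_add i1 i2, hi,
    intervalIntegral.integral_div]
  ring

lemma piece_energy {f u z : ℝ → ℝ} {a b : ℝ} (hf : S.Adm f) (hu : S.SolOn f a b u) (hab : a ≤ b)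
    (hb : b ≤ a + S.η) (hz : C1 z) (h : z a = u a ∨ z b = u b) :
    deriv u b * (z b - u b) - deriv u a * (z a - u a)
      + (∫ t in a..b, (deriv (fun t => z t - u t) t)^2) / 4 ≤ S.J f a b z - S.J f a b u := by
  have hφ : C1 (fun t => z t - u t) := hz.sub hu.1
  rw [J_expand hf hu hab hz]
  set E := ∫ t in a..b, (deriv (fun t => z t - u t) t)^2
  have hE : 0 ≤ E := intervalIntegral.integral_nonneg hab fun s _ => sq_nonneg _
  have hsup : ∀ t ∈ Icc a b, (z t - u t)^2 ≤ (b - a) * E := by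
    intro t ht
    rcases h with h | h
    · have := cs hφ (a := a) (b := b) ⟨le_rfl, hab⟩ ht
      simpa [h] using this
    · have := cs hφ (a := a) (b := b) ⟨hab, le_rfl⟩ ht
      simpa [h] using this
  have cF := prim_cont hf.cont
  have hL := S.hL
  have hbd := S.qbound (φ := fun t => prim f (z t) - prim f (u t) - f (u t) * (z t - u t))
    (((cF.comp hz.cont).sub (cF.comp hu.1.cont)).sub ((hf.cont.comp hu.1.cont).mul hφ.cont))
    (a := a) (b := b) (M := S.L * (S.η * E)) hab (by linarith [S.eta_le])
    (by have := S.eta_pos; positivity) (by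
      intro t ht
      have h1 := prim_est hf.cont (s := u t) (t := z t) (c := f (u t)) (ε := S.L * |z t - u t|) (by
        intro x hx
        refine (hf.1 _ _).trans (mul_le_mul_of_nonneg_left ?_ hL.le)
        exact abs_sub_left_of_mem_uIcc hx)
      refine h1.trans ?_
      have h2 : |z t - u t| * |z t - u t| = (z t - u t)^2 := by rw [abs_mul_abs_self]; ring
      have h3 := hsup t ht
      have h4 : (b - a) * E ≤ S.η * E := mul_le_mul_of_nonneg_right (by linarith) hE
      calc S.L * |z t - u t| * |z t - u t| = S.L * (z t - u t)^2 := by rw [mul_assoc, h2]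
        _ ≤ _ := mul_le_mul_of_nonneg_left (by linarith) hL.le)
  have h5 : S.B * (S.L * (S.η * E)) ≤ E / 16 := by
    have := S.small'
    calc _ = S.η * S.L * S.B * E := by ring
      _ ≤ 1/16 * E := mul_le_mul_of_nonneg_right this hE
      _ = _ := by ring
  have := (abs_le.1 hbd).2
  linarith

end Setup
end SH

namespace SH
open Topology
namespace Setup
variable (S : Setup)

noncomputable def h : ℝ := S.η / 2
lemma h_pos : 0 < S.h := half_pos S.eta_pos
lemma two_h : S.h + S.h = S.η := add_halves _
def M : ℤ := 2 * S.n
lemma M_h : (S.M : ℝ) * S.h = S.T := by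
  have := S.n_mul_eta
  unfold M h; push_cast; linarith

def GSol (f u : ℝ → ℝ) : Prop :=
  C1 u ∧ ∀ s t, deriv u t - deriv u s = - ∫ τ in s..t, S.q τ * f (u τ)

variable {S}
lemma GSol.on {f u : ℝ → ℝ} (hu : S.GSol f u) (a b : ℝ) : S.SolOn f a b u :=
  ⟨hu.1, fun s _ t _ => hu.2 s t⟩

lemma q_per (l : ℤ) (t : ℝ) : S.q (t + l * S.T) = S.q t := S.per.int_mul l t

lemma C1.shift {u : ℝ → ℝ} (hu : C1 u) (c : ℝ) : C1 (fun t => u (t + c)) ∧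
    ∀ t, deriv (fun t => u (t + c)) t = deriv u (t + c) := by
  have h : ∀ t, HasDerivAt (fun t => u (t + c)) (deriv u (t + c)) t := fun t =>
    (hu.1 (t + c)).hasDerivAt.comp_add_const t c
  exact ⟨C1.of h (hu.2.comp (continuous_id.add continuous_const)), fun t => (h t).deriv⟩

lemma SolOn.shift {f u : ℝ → ℝ} {a b : ℝ} (l : ℤ) (hu : S.SolOn f (a + l * S.T) (b + l * S.T) u) :
    S.SolOn f a b (fun t => u (t + l * S.T)) := by
  obtain ⟨h1, h2⟩ := C1.shift hu.1 (l * S.T)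
  refine ⟨h1, fun s hs t ht => ?_⟩
  rw [h2, h2, hu.2 (s + l * S.T) ⟨by linarith [hs.1], by linarith [hs.2]⟩ (t + l * S.T)
    ⟨by linarith [ht.1], by linarith [ht.2]⟩,
    ← intervalIntegral.integral_comp_add_right (fun τ => S.q τ * f (u τ)) (l * S.T)]
  simp only [q_per]

lemma GSol.shift {f u : ℝ → ℝ} (hu : S.GSol f u) (l : ℤ) : S.GSol f (fun t => u (t + l * S.T)) :=
  ⟨(C1.shift hu.1 _).1, fun s t =>
    ((hu.on (min s t + l * S.T) (max s t + l * S.T)).shift l).2 s ⟨min_le_left _ _, le_max_left _ _⟩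
      t ⟨min_le_right _ _, le_max_right _ _⟩⟩

lemma J_shift {f u : ℝ → ℝ} (hu : C1 u) (l : ℤ) (a b : ℝ) :
    S.J f a b (fun t => u (t + l * S.T)) = S.J f (a + l * S.T) (b + l * S.T) u := by
  unfold J
  rw [← intervalIntegral.integral_comp_add_right (fun t => (deriv u t)^2 / 2 - S.q t * prim f (u t))]
  simp only [q_per, (C1.shift hu _).2]

lemma zero_sol {f : ℝ → ℝ} (hf : S.Adm f) : S.GSol f (fun _ => 0) := by
  refine ⟨⟨differentiable_const 0, by simp [continuous_const]⟩, fun s t => ?_⟩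
  simp [hf.2]

variable (S)
open Classical in
noncomputable def Dir (f : ℝ → ℝ) (a b α β : ℝ) : ℝ → ℝ :=
  if H : ∃ u, S.SolOn f a b u ∧ u a = α ∧ u b = β then H.choose else fun _ => 0

variable {S}
lemma Dir_spec {f : ℝ → ℝ} (hf : S.Adm f) {a b : ℝ} (hab : a < b) (hb : b ≤ a + S.η) (α β : ℝ) :
    S.SolOn f a b (S.Dir f a b α β) ∧ S.Dir f a b α β a = α ∧ S.Dir f a b α β b = β := by
  have H := dir_exists hf hab hb α β
  unfold Dir
  rw [dif_pos H]
  exact H.choose_spec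

variable (S)
noncomputable def pc (f : ℝ → ℝ) (x : ℤ → ℝ) (i : ℤ) : ℝ → ℝ :=
  S.Dir f (i * S.h) ((i + 1) * S.h) (x i) (x (i+1))
noncomputable def dp (f : ℝ → ℝ) (x : ℤ → ℝ) (i : ℤ) : ℝ → ℝ :=
  S.Dir f ((i - 1) * S.h) ((i + 1) * S.h) (x (i-1)) (x (i+1))
noncomputable def U (f : ℝ → ℝ) (p : ℤ) (x : ℤ → ℝ) (i : ℤ) : ℝ :=
  if i % 2 = p then S.dp f x i (i * S.h) else x i
noncomputable def P (f : ℝ → ℝ) (x : ℤ → ℝ) : ℤ → ℝ := S.U f 0 (S.U f 1 x)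
noncomputable def W (f : ℝ → ℝ) (N : ℕ) (x : ℤ → ℝ) : ℝ :=
  ∑ i ∈ Finset.range N, S.J f ((i:ℤ) * S.h) (((i:ℤ) + 1) * S.h) (S.pc f x i)
variable {S}

lemma pc_spec {f : ℝ → ℝ} (hf : S.Adm f) (x : ℤ → ℝ) (i : ℤ) :
    S.SolOn f (i * S.h) ((i + 1) * S.h) (S.pc f x i) ∧ S.pc f x i (i * S.h) = x i ∧
      S.pc f x i ((i + 1) * S.h) = x (i+1) := by
  have := S.h_pos; have := S.two_h
  exact Dir_spec hf (by linarith) (by linarith) _ _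

lemma dp_spec {f : ℝ → ℝ} (hf : S.Adm f) (x : ℤ → ℝ) (i : ℤ) :
    S.SolOn f ((i - 1) * S.h) ((i + 1) * S.h) (S.dp f x i) ∧ S.dp f x i ((i - 1) * S.h) = x (i-1) ∧
      S.dp f x i ((i + 1) * S.h) = x (i+1) := by
  have := S.h_pos; have := S.two_h
  exact Dir_spec hf (by linarith) (by linarith) _ _

lemma U_mono {f : ℝ → ℝ} (hf : S.Adm f) (p : ℤ) {x y : ℤ → ℝ} (hxy : ∀ i, x i ≤ y i) (i : ℤ) :
    S.U f p x i ≤ S.U f p y i := by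
  unfold U
  split_ifs with hi
  · have hx := dp_spec hf x i
    have hy := dp_spec hf y i
    have := S.h_pos; have := S.two_h
    refine comp hf hx.1 hy.1 (by linarith) ?_ ?_ _ ⟨by linarith, by linarith⟩
    · rw [hx.2.1, hy.2.1]; exact hxy _
    · rw [hx.2.2, hy.2.2]; exact hxy _
  · exact hxy i

lemma U_stab {f₁ f₂ : ℝ → ℝ} (h₁ : S.Adm f₁) (h₂ : S.Adm f₂) {ε δ : ℝ}
    (hε : ∀ s, |f₁ s - f₂ s| ≤ ε) (p : ℤ) {x y : ℤ → ℝ} (i : ℤ) (hδ : |x (i-1) - y (i-1)| ≤ δ)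
    (hδ' : |x i - y i| ≤ δ) (hδ'' : |x (i+1) - y (i+1)| ≤ δ) :
    |S.U f₁ p x i - S.U f₂ p y i| ≤ 2 * (δ + S.η * S.B * ε) := by
  have hε0 : 0 ≤ ε := (abs_nonneg _).trans (hε 0)
  have := S.h_pos; have := S.two_h; have hη := S.eta_pos; have hB := S.hB0
  unfold U
  split_ifs with hi
  · have hx := dp_spec h₁ x i
    have hy := dp_spec h₂ y i
    refine stab h₁ h₂ hε hx.1 hy.1 (by linarith) (by linarith) ?_ ?_ _ ⟨by linarith, by linarith⟩
    · rw [hx.2.1, hy.2.1]; exact hδ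
    · rw [hx.2.2, hy.2.2]; exact hδ''
  · have : 0 ≤ S.η * S.B * ε := by positivity
    linarith [abs_nonneg (x i - y i)]

noncomputable def nd (S : Setup) (u : ℝ → ℝ) : ℤ → ℝ := fun i => u ((i:ℝ) * S.h)

/-- nodes of a global solution are invariant -/
lemma U_nodes {f u : ℝ → ℝ} (hf : S.Adm f) (hu : S.GSol f u) (p : ℤ) :
    S.U f p (nd S u) = nd S u := by
  funext i
  unfold U
  split_ifs with hi
  · have hx := dp_spec hf (nd S u) i
    have := S.h_pos; have := S.two_h
    refine uniq hf hx.1 (hu.on _ _) (by linarith) (by linarith) ?_ ?_ _ ⟨by linarith, by linarith⟩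
    · rw [hx.2.1]; unfold nd; push_cast; rfl
    · rw [hx.2.2]; unfold nd; push_cast; rfl
  · rfl

lemma U_zero {f : ℝ → ℝ} (hf : S.Adm f) (p : ℤ) : S.U f p (fun _ => 0) = fun _ => 0 :=
  U_nodes hf (zero_sol hf) p

lemma P_mono {f : ℝ → ℝ} (hf : S.Adm f) {x y : ℤ → ℝ} (hxy : ∀ i, x i ≤ y i) (i : ℤ) :
    S.P f x i ≤ S.P f y i := U_mono hf 0 (U_mono hf 1 hxy) i

lemma P_nodes {f u : ℝ → ℝ} (hf : S.Adm f) (hu : S.GSol f u) :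
    S.P f (nd S u) = nd S u := by
  unfold P; rw [U_nodes hf hu, U_nodes hf hu]

lemma P_nonneg {f : ℝ → ℝ} (hf : S.Adm f) {x : ℤ → ℝ} (hx : ∀ i, 0 ≤ x i) (i : ℤ) :
    0 ≤ S.P f x i := by
  have := P_mono hf hx i
  have e : S.P f (fun _ => 0) = fun _ => 0 := P_nodes hf (zero_sol hf)
  rwa [e] at this

def sh (m : ℤ) (x : ℤ → ℝ) : ℤ → ℝ := fun i => x (i + m)

lemma node_shift (i l : ℤ) : ((i + l * S.M : ℤ) : ℝ) * S.h = i * S.h + l * S.T := by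
  rw [← S.M_h]; push_cast; ring

lemma dp_shift {f : ℝ → ℝ} (hf : S.Adm f) (l : ℤ) (x : ℤ → ℝ) (i : ℤ) :
    ∀ t ∈ Icc (((i:ℝ) - 1) * S.h) (((i:ℝ) + 1) * S.h),
      S.dp f x (i + l * S.M) (t + l * S.T) = S.dp f (sh (l * S.M) x) i t := by
  have h1 := dp_spec hf x (i + l * S.M)
  have h2 := dp_spec hf (sh (l * S.M) x) i
  have := S.h_pos; have := S.two_h
  have e1 : (((i + l * S.M : ℤ) : ℝ) - 1) * S.h = ((i:ℝ) - 1) * S.h + l * S.T := by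
    rw [← S.M_h]; push_cast; ring
  have e2 : (((i + l * S.M : ℤ) : ℝ) + 1) * S.h = ((i:ℝ) + 1) * S.h + l * S.T := by
    rw [← S.M_h]; push_cast; ring
  rw [e1, e2] at h1
  refine uniq hf (h1.1.shift l) h2.1 (by linarith) (by linarith) ?_ ?_
  · rw [h1.2.1, h2.2.1]; unfold sh; congr 1; ring
  · rw [h1.2.2, h2.2.2]; unfold sh; congr 1; ring

lemma pc_shift {f : ℝ → ℝ} (hf : S.Adm f) (l : ℤ) (x : ℤ → ℝ) (i : ℤ) :
    ∀ t ∈ Icc ((i:ℝ) * S.h) (((i:ℝ) + 1) * S.h),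
      S.pc f x (i + l * S.M) (t + l * S.T) = S.pc f (sh (l * S.M) x) i t := by
  have h1 := pc_spec hf x (i + l * S.M)
  have h2 := pc_spec hf (sh (l * S.M) x) i
  have := S.h_pos; have := S.two_h
  have e2 : (((i + l * S.M : ℤ) : ℝ) + 1) * S.h = ((i:ℝ) + 1) * S.h + l * S.T := by
    rw [← S.M_h]; push_cast; ring
  rw [node_shift, e2] at h1
  refine uniq hf (h1.1.shift l) h2.1 (by linarith) (by linarith) ?_ ?_
  · rw [h1.2.1, h2.2.1]; rfl
  · rw [h1.2.2, h2.2.2]; unfold sh; congr 1; ring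

lemma J_pc_shift {f : ℝ → ℝ} (hf : S.Adm f) (l : ℤ) (x : ℤ → ℝ) (i : ℤ) :
    S.J f ((i + l * S.M : ℤ) * S.h) (((i + l * S.M : ℤ) + 1) * S.h) (S.pc f x (i + l * S.M))
      = S.J f (i * S.h) ((i + 1) * S.h) (S.pc f (sh (l * S.M) x) i) := by
  have := S.h_pos
  rw [← J_congr (by linarith) (pc_shift hf l x i), J_shift (pc_spec hf x (i + l * S.M)).1.1]
  congr 1 <;> (rw [← S.M_h]; push_cast; ring)

lemma U_sh {f : ℝ → ℝ} (hf : S.Adm f) (p l : ℤ) (x : ℤ → ℝ) :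
    S.U f p (sh (l * S.M) x) = sh (l * S.M) (S.U f p x) := by
  funext i
  have hpar : (i + l * S.M) % 2 = i % 2 := by
    unfold M; rw [show i + l * (2 * (S.n:ℤ)) = i + 2 * (l * S.n) by ring]; omega
  change S.U f p (sh (l * S.M) x) i = S.U f p x (i + l * S.M)
  unfold U
  rw [hpar]
  split_ifs with hi
  · have := S.h_pos
    rw [← dp_shift hf l x i _ ⟨by linarith, by linarith⟩, node_shift]
  · rfl

lemma P_sh {f : ℝ → ℝ} (hf : S.Adm f) (l : ℤ) (x : ℤ → ℝ) :
    S.P f (sh (l * S.M) x) = sh (l * S.M) (S.P f x) := by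
  unfold P; rw [U_sh hf, U_sh hf]

noncomputable def bt (S : Setup) (f : ℝ → ℝ) (p : ℤ) (x : ℤ → ℝ) (i : ℤ) : ℝ :=
  if i % 2 = p then deriv (S.dp f x i) (i * S.h) * (x i - S.U f p x i) else 0

lemma bt_shift {f : ℝ → ℝ} (hf : S.Adm f) (p l : ℤ) (x : ℤ → ℝ) (hx : sh (l * S.M) x = x) (i : ℤ) :
    bt S f p x (i + l * S.M) = bt S f p x i := by
  have hpar : (i + l * S.M) % 2 = i % 2 := by
    unfold M; rw [show i + l * (2 * (S.n:ℤ)) = i + 2 * (l * S.n) by ring]; omega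
  unfold bt
  rw [hpar]
  split_ifs with hi
  · have hp := S.h_pos
    have e1 : S.U f p x (i + l * S.M) = S.U f p x i := by
      have := congrFun (U_sh hf p l x) i
      rw [hx] at this; exact this.symm
    have e2 : x (i + l * S.M) = x i := congrFun hx i
    have e3 : deriv (S.dp f x (i + l * S.M)) (i * S.h + l * S.T) = deriv (S.dp f x i) (i * S.h) := by
      rw [← (C1.shift (dp_spec hf x (i + l * S.M)).1.1 (l * S.T)).2]
      apply Filter.EventuallyEq.deriv_eq
      have hm : Icc (((i:ℝ) - 1) * S.h) (((i:ℝ) + 1) * S.h) ∈ 𝓝 ((i:ℝ) * S.h) :=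
        Icc_mem_nhds (by linarith) (by linarith)
      filter_upwards [hm] with t ht
      have := dp_shift hf l x i t ht
      rwa [hx] at this
    rw [e1, e2, node_shift, e3]
  · rfl

lemma sq_int_zero {φ : ℝ → ℝ} (hφ : C1 φ) {a b : ℝ} (hab : a ≤ b)
    (h : φ a = 0 ∨ φ b = 0) (hE : ∫ t in a..b, (deriv φ t)^2 ≤ 0) : ∀ t ∈ Icc a b, φ t = 0 := by
  intro t ht
  have h1 : (b - a) * ∫ t in a..b, (deriv φ t)^2 ≤ 0 :=
    mul_nonpos_of_nonneg_of_nonpos (by linarith) hE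
  rcases h with h | h
  · have := cs hφ (a := a) (b := b) ⟨le_rfl, hab⟩ ht
    rw [h, sub_zero] at this
    exact pow_eq_zero_iff (two_ne_zero) |>.1 (le_antisymm (this.trans h1) (sq_nonneg _))
  · have := cs hφ (a := a) (b := b) ⟨hab, le_rfl⟩ ht
    rw [h, sub_zero] at this
    exact pow_eq_zero_iff (two_ne_zero) |>.1 (le_antisymm (this.trans h1) (sq_nonneg _))

/-- if a solution on the piece has the same end values as the state -/
lemma pc_eq {f u : ℝ → ℝ} (hf : S.Adm f) {y : ℤ → ℝ} {i : ℤ}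
    (hu : S.SolOn f (i * S.h) ((i+1) * S.h) u) (h1 : u (i * S.h) = y i)
    (h2 : u ((i+1) * S.h) = y (i+1)) :
    ∀ t ∈ Icc ((i:ℝ) * S.h) (((i:ℝ) + 1) * S.h), S.pc f y i t = u t := by
  have hy := pc_spec hf y i
  have := S.h_pos; have := S.two_h
  exact uniq hf hy.1 hu (by linarith) (by linarith) (by rw [hy.2.1, h1]) (by rw [hy.2.2, h2])

lemma step_piece {f : ℝ → ℝ} (hf : S.Adm f) {p : ℤ} (hp : p = 0 ∨ p = 1) (x : ℤ → ℝ) (i : ℤ) :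
    bt S f p x (i+1) - bt S f p x i ≤ S.J f (i * S.h) ((i+1) * S.h) (S.pc f x i)
      - S.J f (i * S.h) ((i+1) * S.h) (S.pc f (S.U f p x) i) ∧
    (S.J f (i * S.h) ((i+1) * S.h) (S.pc f x i)
      - S.J f (i * S.h) ((i+1) * S.h) (S.pc f (S.U f p x) i) ≤ bt S f p x (i+1) - bt S f p x i →
      x i = S.U f p x i) := by
  have hh := S.h_pos; have hh2 := S.two_h
  have hx := pc_spec hf x i
  set y := S.U f p x with hy
  by_cases hi : i % 2 = p
  · have hi1 : ¬ (i + 1) % 2 = p := by rcases hp with h | h <;> omega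
    have hd := dp_spec hf x i
    have hyi : S.dp f x i (i * S.h) = y i := by rw [hy]; unfold U; rw [if_pos hi]
    have hyi1 : x (i+1) = y (i+1) := by rw [hy]; unfold U; rw [if_neg hi1]
    have hsol : S.SolOn f (i * S.h) ((i+1) * S.h) (S.dp f x i) := hd.1.mono (by linarith) le_rfl
    have hJ := J_congr (S := S) (f := f) (by linarith) (pc_eq hf hsol hyi (by rw [hd.2.2, hyi1]))
    have he := piece_energy hf hsol (by linarith) (by linarith) hx.1.1 (Or.inr (by rw [hx.2.2, hd.2.2]))
    have hb1 : bt S f p x (i+1) = 0 := by unfold bt; rw [if_neg hi1]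
    have hb : bt S f p x i = deriv (S.dp f x i) (i * S.h) * (x i - y i) := by
      unfold bt; rw [if_pos hi]
    have hE : 0 ≤ ∫ t in (i * S.h)..((i+1) * S.h), (deriv (fun t => S.pc f x i t - S.dp f x i t) t)^2 :=
      intervalIntegral.integral_nonneg (by linarith) fun s _ => sq_nonneg _
    rw [hx.2.2, hd.2.2, hx.2.1, hyi, sub_self, mul_zero] at he
    rw [hJ, hb1, hb]
    refine ⟨by linarith, fun hle => ?_⟩
    have := sq_int_zero (hx.1.1.sub hd.1.1) (a := i * S.h) (b := (i+1) * S.h) (by linarith)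
      (Or.inr (by rw [hx.2.2, hd.2.2, sub_self])) (by linarith) (i * S.h) ⟨le_rfl, by linarith⟩
    rw [hx.2.1, hyi] at this
    linarith
  · have hi1 : (i + 1) % 2 = p := by rcases hp with h | h <;> omega
    have hd := dp_spec hf x (i+1)
    have c1 : (((i+1:ℤ):ℝ) - 1) * S.h = i * S.h := by push_cast; ring
    have c2 : x (i + 1 - 1) = x i := by congr 1; ring
    have c3 : (((i+1:ℤ):ℝ)) = (i:ℝ) + 1 := by push_cast; ring
    rw [c1, c2] at hd
    have hyi1 : S.dp f x (i+1) ((i+1) * S.h) = y (i+1) := by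
      rw [hy]; unfold U; rw [if_pos hi1, c3]
    have hyi : x i = y i := by rw [hy]; unfold U; rw [if_neg hi]
    have hsol : S.SolOn f (i * S.h) ((i+1) * S.h) (S.dp f x (i+1)) := hd.1.mono le_rfl (by
      push_cast; linarith)
    have hJ := J_congr (S := S) (f := f) (by linarith) (pc_eq hf hsol (by rw [hd.2.1, hyi]) hyi1)
    have he := piece_energy hf hsol (by linarith) (by linarith) hx.1.1 (Or.inl (by rw [hx.2.1, hd.2.1]))
    have hb1 : bt S f p x i = 0 := by unfold bt; rw [if_neg hi]
    have hb : bt S f p x (i+1) = deriv (S.dp f x (i+1)) ((i+1) * S.h) * (x (i+1) - y (i+1)) := by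
      unfold bt; rw [if_pos hi1, c3]
    have hE : 0 ≤ ∫ t in (i * S.h)..((i+1) * S.h), (deriv (fun t => S.pc f x i t - S.dp f x (i+1) t) t)^2 :=
      intervalIntegral.integral_nonneg (by linarith) fun s _ => sq_nonneg _
    rw [hx.2.2, hd.2.1, hx.2.1, hyi1, sub_self, mul_zero] at he
    rw [hJ, hb1, hb]
    exact ⟨by linarith, fun _ => hyi⟩

end Setup
end SH

namespace SH
open Topology
namespace Setup
variable {S : Setup}

def N (S : Setup) (k : ℕ) : ℕ := k * (2 * S.n)
lemma N_cast (k : ℕ) : ((S.N k : ℕ) : ℤ) = (k:ℤ) * S.M := by unfold N M; push_cast; ring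
lemma N_h (k : ℕ) : (S.N k : ℝ) * S.h = k * S.T := by
  rw [← S.M_h]; unfold N M; push_cast; ring

def Per (S : Setup) (k : ℕ) (x : ℤ → ℝ) : Prop := sh ((k:ℤ) * S.M) x = x

lemma Per.apply {k : ℕ} {x : ℤ → ℝ} (hx : S.Per k x) (i : ℤ) : x (i + (k:ℤ) * S.M) = x i :=
  congrFun hx i

lemma Per.U {f : ℝ → ℝ} (hf : S.Adm f) (p : ℤ) {k : ℕ} {x : ℤ → ℝ} (hx : S.Per k x) :
    S.Per k (S.U f p x) := by
  unfold Per at *; rw [← U_sh hf, hx]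

lemma Per.P {f : ℝ → ℝ} (hf : S.Adm f) {k : ℕ} {x : ℤ → ℝ} (hx : S.Per k x) :
    S.Per k (S.P f x) := (hx.U hf 1).U hf 0

/-- reduce an index to one period -/
lemma Per.red (hk : 0 < k) (i : ℤ) : ∃ j : ℕ, j < S.N k ∧ ∃ l : ℤ, i = j + l * ((k:ℤ) * S.M) := by
  have hN : 0 < (S.N k : ℤ) := by
    have := S.hn; unfold N; positivity
  refine ⟨(i % (S.N k)).toNat, ?_, i / (S.N k), ?_⟩
  · have := Int.emod_lt_of_pos i hN
    have := Int.emod_nonneg i hN.ne'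
    omega
  · have := Int.emod_nonneg i hN.ne'
    rw [Int.toNat_of_nonneg this, ← N_cast, mul_comm]
    exact (Int.emod_add_mul_ediv i _).symm

lemma Per.mul {k : ℕ} {x : ℤ → ℝ} (hx : S.Per k x) (l i : ℤ) :
    x (i + l * ((k:ℤ) * S.M)) = x i := by
  have : Function.Periodic x ((k:ℤ) * S.M) := fun i => hx.apply i
  exact this.int_mul l i

/-- it suffices to check on one period -/
lemma Per.all {k : ℕ} (hk : 0 < k) {x y : ℤ → ℝ} (hx : S.Per k x) (hy : S.Per k y)
    (r : ℝ → ℝ → Prop) (h : ∀ j : ℕ, j < S.N k → r (x j) (y j)) (i : ℤ) : r (x i) (y i) := by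
  obtain ⟨j, hj, l, rfl⟩ := Per.red (S := S) hk i
  rw [hx.mul, hy.mul]; exact h j hj

lemma W_U {f : ℝ → ℝ} (hf : S.Adm f) {p : ℤ} (hp : p = 0 ∨ p = 1) {k : ℕ} (hk : 0 < k)
    {x : ℤ → ℝ} (hx : S.Per k x) : S.W f (S.N k) (S.U f p x) ≤ S.W f (S.N k) x ∧
      (S.W f (S.N k) x ≤ S.W f (S.N k) (S.U f p x) → S.U f p x = x) := by
  have hs := fun i : ℤ => step_piece hf hp x i
  have htel : ∑ i ∈ Finset.range (S.N k), (bt S f p x ((i:ℤ)+1) - bt S f p x (i:ℤ)) = 0 := by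
    have := Finset.sum_range_sub (fun i : ℕ => bt S f p x (i:ℤ)) (S.N k)
    push_cast at this
    rw [this, N_cast]
    have h2 := bt_shift hf p k x hx 0
    rw [zero_add] at h2
    rw [h2, sub_self]
  have hW : S.W f (S.N k) x - S.W f (S.N k) (S.U f p x) = ∑ i ∈ Finset.range (S.N k),
      (S.J f ((i:ℤ) * S.h) (((i:ℤ)+1) * S.h) (S.pc f x i)
      - S.J f ((i:ℤ) * S.h) (((i:ℤ)+1) * S.h) (S.pc f (S.U f p x) i)) := by
    unfold W; rw [Finset.sum_sub_distrib]
  have hle : ∀ i ∈ Finset.range (S.N k), (bt S f p x ((i:ℤ)+1) - bt S f p x (i:ℤ)) ≤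
      (S.J f ((i:ℤ) * S.h) (((i:ℤ)+1) * S.h) (S.pc f x i)
      - S.J f ((i:ℤ) * S.h) (((i:ℤ)+1) * S.h) (S.pc f (S.U f p x) i)) := fun i _ => (hs i).1
  have h0 := Finset.sum_le_sum hle
  refine ⟨by linarith, fun h => ?_⟩
  have heq := (Finset.sum_eq_sum_iff_of_le hle).1 (by linarith)
  funext i
  refine Per.all hk (hx.U hf p) hx (fun a b => a = b) (fun j hj => ?_) i
  exact ((hs j).2 (heq j (Finset.mem_range.2 hj)).ge).symm

lemma W_P {f : ℝ → ℝ} (hf : S.Adm f) {k : ℕ} (hk : 0 < k)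
    {x : ℤ → ℝ} (hx : S.Per k x) : S.W f (S.N k) (S.P f x) ≤ S.W f (S.N k) x :=
  (W_U hf (Or.inl rfl) hk (hx.U hf 1)).1.trans (W_U hf (Or.inr rfl) hk hx).1

lemma P_fix {f : ℝ → ℝ} (hf : S.Adm f) {k : ℕ} (hk : 0 < k)
    {x : ℤ → ℝ} (hx : S.Per k x) (h : S.W f (S.N k) x ≤ S.W f (S.N k) (S.P f x)) :
    ∀ p : ℤ, p = 0 ∨ p = 1 → S.U f p x = x := by
  have h0 := W_U hf (Or.inl rfl) hk (hx.U hf 1)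
  have h1 := W_U hf (Or.inr rfl) hk hx
  have e1 : S.U f 1 x = x := h1.2 (h.trans h0.1)
  have e0 : S.U f 0 x = x := by
    have := (W_U hf (Or.inl rfl) hk hx).2
    apply this
    unfold P at h
    rwa [e1] at h
  rintro p (rfl | rfl)
  · exact e0
  · exact e1

lemma gsol_of_local {f u : ℝ → ℝ} (hf : S.Adm f)
    (h : ∀ t, ∃ v a b, a < t ∧ t < b ∧ S.SolOn f a b v ∧ ∀ s ∈ Ioo a b, u s = v s) :
    S.GSol f u := by
  have hev : ∀ t, ∃ v a b, a < t ∧ t < b ∧ S.SolOn f a b v ∧ (∀ s ∈ Ioo a b, u s = v s) ∧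
      ∀ s ∈ Ioo a b, HasDerivAt u (deriv v s) s := by
    intro t
    obtain ⟨v, a, b, h1, h2, h3, h4⟩ := h t
    refine ⟨v, a, b, h1, h2, h3, h4, fun s hs => ?_⟩
    have : u =ᶠ[𝓝 s] v := by filter_upwards [Ioo_mem_nhds hs.1 hs.2] with x hx using h4 x hx
    exact (h3.1.1 s).hasDerivAt.congr_of_eventuallyEq this
  have hC : C1 u := by
    refine ⟨fun t => ?_, continuous_iff_continuousAt.2 fun t => ?_⟩
    · obtain ⟨v, a, b, h1, h2, h3, h4, h5⟩ := hev t
      exact (h5 t ⟨h1, h2⟩).differentiableAt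
    · obtain ⟨v, a, b, h1, h2, h3, h4, h5⟩ := hev t
      refine h3.1.2.continuousAt.congr ?_
      filter_upwards [Ioo_mem_nhds h1 h2] with x hx using (h5 x hx).deriv.symm
  have hq := S.qmul (hf.cont.comp hC.cont)
  simp only [Function.comp] at hq
  let G : ℝ → ℝ := fun t => deriv u t + ∫ τ in (0:ℝ)..t, S.q τ * f (u τ)
  have hG : IsLocallyConstant G := by
    rw [IsLocallyConstant.iff_eventually_eq]
    intro t
    obtain ⟨v, a, b, h1, h2, h3, h4, h5⟩ := hev t
    filter_upwards [Ioo_mem_nhds h1 h2] with s hs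
    have e := h3.2 t ⟨h1.le, h2.le⟩ s ⟨hs.1.le, hs.2.le⟩
    have e2 : ∫ τ in t..s, S.q τ * f (u τ) = ∫ τ in t..s, S.q τ * f (v τ) := by
      apply intervalIntegral.integral_congr
      intro τ hτ
      have hm : τ ∈ Ioo a b := by
        have := (convex_Ioo a b).ordConnected.uIcc_subset (show t ∈ Ioo a b from ⟨h1, h2⟩) hs
        exact this hτ
      simp only [h4 τ hm]
    have e3 := intervalIntegral.integral_add_adjacent_intervals (hq 0 t) (hq t s)
    simp only [G]
    rw [(h5 s hs).deriv, (h5 t ⟨h1, h2⟩).deriv]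
    linarith
  refine ⟨hC, fun s t => ?_⟩
  have e : G t = G s := hG.apply_eq_of_isPreconnected isPreconnected_univ (mem_univ _) (mem_univ _)
  have e3 := intervalIntegral.integral_add_adjacent_intervals (hq 0 s) (hq s t)
  simp only [G] at e
  linarith

lemma glue {f : ℝ → ℝ} (hf : S.Adm f) {x : ℤ → ℝ} (hx : ∀ p : ℤ, p = 0 ∨ p = 1 → S.U f p x = x) :
    ∃ u, S.GSol f u ∧ S.nd u = x := by
  have hh := S.h_pos; have hh2 := S.two_h
  have hdp : ∀ i : ℤ, S.dp f x i (i * S.h) = x i := by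
    intro i
    have := congrFun (hx (i % 2) (by omega)) i
    unfold U at this
    rwa [if_pos rfl] at this
  let u : ℝ → ℝ := fun t => S.pc f x ⌊t / S.h⌋ t
  have hu : ∀ (i : ℤ) (t : ℝ), i * S.h ≤ t → t < (i+1) * S.h → u t = S.pc f x i t := by
    intro i t h1 h2
    have : ⌊t / S.h⌋ = i := by
      rw [Int.floor_eq_iff, le_div_iff₀ hh, div_lt_iff₀ hh]; exact ⟨h1, h2⟩
    simp only [u, this]
  have key : ∀ (i : ℤ), ∀ s ∈ Ioo (((i:ℝ)-1) * S.h) (((i:ℝ)+1) * S.h), u s = S.dp f x i s := by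
    intro i s hs
    have hd := dp_spec hf x i
    rcases lt_or_ge s (i * S.h) with h | h
    · rw [hu (i-1) s (by push_cast; exact hs.1.le) (by push_cast; linarith)]
      refine pc_eq hf (hd.1.mono (by push_cast; linarith) (by push_cast; linarith)) ?_ ?_ s
        ⟨by push_cast; exact hs.1.le, by push_cast; linarith⟩
      · have := hd.2.1
        push_cast; exact this
      · have := hdp i
        push_cast
        rw [show ((i:ℝ) - 1 + 1) = i by ring, show i - 1 + 1 = i by ring]; exact this
    · rw [hu i s h hs.2]
      exact pc_eq hf (hd.1.mono (by linarith) le_rfl) (hdp i) hd.2.2 s ⟨h, hs.2.le⟩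
  refine ⟨u, gsol_of_local hf fun t => ?_, ?_⟩
  · have h1 := Int.floor_le (t / S.h)
    have h2 := Int.lt_floor_add_one (t / S.h)
    rw [le_div_iff₀ hh] at h1
    rw [div_lt_iff₀ hh] at h2
    exact ⟨_, _, _, by nlinarith, h2, (dp_spec hf x ⌊t / S.h⌋).1, key _⟩
  · funext i
    unfold nd
    rw [hu i _ le_rfl (by linarith), (pc_spec hf x i).2.1]

lemma sum_J {f u : ℝ → ℝ} (hf : S.Adm f) (hu : C1 u) (N : ℕ) :
    ∑ i ∈ Finset.range N, S.J f ((i:ℤ) * S.h) (((i:ℤ) + 1) * S.h) u = S.J f 0 (N * S.h) u := by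
  induction N with
  | zero => simp [J]
  | succ n ih =>
    rw [Finset.sum_range_succ, ih]
    have := J_add (S := S) hf.cont hu 0 (n * S.h) ((n+1) * S.h)
    push_cast; exact this

lemma W_nodes_le {f z : ℝ → ℝ} (hf : S.Adm f) (hz : C1 z) (N : ℕ) :
    S.W f N (S.nd z) ≤ S.J f 0 (N * S.h) z := by
  rw [← sum_J hf hz]
  unfold W
  refine Finset.sum_le_sum fun i _ => ?_
  have hp := pc_spec hf (S.nd z) i
  have hh := S.h_pos; have hh2 := S.two_h
  have e2 : S.nd z (i+1) = z (((i:ℤ)+1) * S.h) := by unfold nd; push_cast; rfl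
  have := piece_energy hf hp.1 (by linarith) (by linarith) hz (Or.inl (by rw [hp.2.1]; rfl))
  rw [hp.2.1, hp.2.2, e2, show S.nd z i = z ((i:ℤ) * S.h) from rfl, sub_self, sub_self] at this
  have hE : 0 ≤ ∫ t in ((i:ℤ) * S.h)..(((i:ℤ)+1) * S.h), (deriv (fun t => z t - S.pc f (S.nd z) i t) t)^2 :=
      intervalIntegral.integral_nonneg (by linarith) fun s _ => sq_nonneg _
  linarith

lemma W_nodes {f u : ℝ → ℝ} (hf : S.Adm f) (hu : S.GSol f u) (N : ℕ) :
    S.W f N (S.nd u) = S.J f 0 (N * S.h) u := by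
  rw [← sum_J hf hu.1]
  unfold W
  refine Finset.sum_congr rfl fun i _ => ?_
  have hh := S.h_pos
  refine J_congr (by linarith) (pc_eq hf (hu.on _ _) rfl ?_)
  unfold nd; push_cast; rfl

lemma piece_of (S : Setup) (t : ℝ) : ∃ i : ℤ, t ∈ Icc ((i:ℝ) * S.h) (((i:ℝ)+1) * S.h) := by
  have hh := S.h_pos
  have h1 := Int.floor_le (t / S.h)
  have h2 := Int.lt_floor_add_one (t / S.h)
  rw [le_div_iff₀ hh] at h1
  rw [div_lt_iff₀ hh] at h2
  exact ⟨_, h1, h2.le⟩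

lemma nd_succ (u : ℝ → ℝ) (i : ℤ) : S.nd u (i+1) = u (((i:ℝ)+1) * S.h) := by
  unfold nd; push_cast; rfl

lemma GSol.le {f u v : ℝ → ℝ} (hf : S.Adm f) (hu : S.GSol f u) (hv : S.GSol f v)
    (h : ∀ i, S.nd u i ≤ S.nd v i) (t : ℝ) : u t ≤ v t := by
  obtain ⟨i, hi⟩ := S.piece_of t
  have hh := S.h_pos; have hh2 := S.two_h
  have h2 := h (i+1)
  rw [nd_succ, nd_succ] at h2
  exact comp hf (hu.on _ _) (hv.on _ _) (by linarith) (h i) h2 t hi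

lemma GSol.ext {f u v : ℝ → ℝ} (hf : S.Adm f) (hu : S.GSol f u) (hv : S.GSol f v)
    (h : S.nd u = S.nd v) : u = v := by
  funext t
  exact le_antisymm (hu.le hf hv (fun i => (congrFun h i).le) t) (hv.le hf hu (fun i => (congrFun h i).ge) t)

lemma nd_shift (u : ℝ → ℝ) (l : ℤ) : S.nd (fun t => u (t + l * S.T)) = sh (l * S.M) (S.nd u) := by
  funext i
  unfold sh nd
  rw [node_shift]

lemma GSol.periodic {f u : ℝ → ℝ} (hf : S.Adm f) (hu : S.GSol f u) {l : ℤ}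
    (h : sh (l * S.M) (S.nd u) = S.nd u) (t : ℝ) : u (t + l * S.T) = u t := by
  have := (hu.shift l).ext hf hu (by rw [nd_shift, h])
  exact congrFun this t

/-- global uniqueness -/
lemma GSol.ivp {f u v : ℝ → ℝ} (hf : S.Adm f) (hu : S.GSol f u) (hv : S.GSol f v) {c : ℝ}
    (h0 : u c = v c) (h1 : deriv u c = deriv v c) : u = v := by
  let A : Set ℝ := {t | u t = v t ∧ deriv u t = deriv v t}
  have hcl : IsClosed A := (isClosed_eq hu.1.cont hv.1.cont).inter (isClosed_eq hu.1.2 hv.1.2)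
  have hη := S.eta_pos
  have hop : IsOpen A := by
    rw [isOpen_iff_mem_nhds]
    rintro t ⟨ht0, ht1⟩
    have hI := Setup.ivp hf (hu.on (t - S.η/2) (t + S.η/2)) (hv.on _ _) (by linarith)
      ⟨by linarith, by linarith⟩ ht0 ht1
    filter_upwards [Ioo_mem_nhds (show t - S.η/2 < t by linarith) (show t < t + S.η/2 by linarith)]
      with s hs
    refine ⟨hI s ⟨hs.1.le, hs.2.le⟩, ?_⟩
    apply Filter.EventuallyEq.deriv_eq
    filter_upwards [Ioo_mem_nhds hs.1 hs.2] with r hr using hI r ⟨hr.1.le, hr.2.le⟩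
  have hu' : A = univ := IsClopen.eq_univ ⟨hcl, hop⟩ ⟨c, h0, h1⟩
  funext t
  have : t ∈ A := hu' ▸ mem_univ t
  exact this.1

/-- strong comparison -/
lemma GSol.lt {f u v : ℝ → ℝ} (hf : S.Adm f) (hu : S.GSol f u) (hv : S.GSol f v)
    (h : ∀ t, u t ≤ v t) (hne : u ≠ v) (t : ℝ) : u t < v t := by
  refine lt_of_le_of_ne (h t) fun he => hne ?_
  refine hu.ivp hf hv he ?_
  have hmin : IsLocalMin (fun s => v s - u s) t := Filter.Eventually.of_forall fun s => by
    simp only; linarith [h s]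
  have := hmin.deriv_eq_zero
  rw [deriv_fun_sub (hv.1.1 t) (hu.1.1 t)] at this
  linarith

lemma sum_shift {a : ℤ → ℝ} {N : ℕ} (ha : ∀ i, a (i + N) = a i) (m : ℤ) :
    ∑ i ∈ Finset.range N, a (i + m) = ∑ i ∈ Finset.range N, a i := by
  have step : ∀ m : ℤ, ∑ i ∈ Finset.range N, a (i + (m+1)) = ∑ i ∈ Finset.range N, a (i + m) := by
    intro m
    have := Finset.sum_range_sub (fun i : ℕ => a (i + m)) N
    rw [Finset.sum_sub_distrib] at this
    have e : a (N + m) = a ((0:ℕ) + m) := by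
      rw [add_comm, ha]; simp
    rw [e, sub_self] at this
    have e2 : ∀ i : ℕ, a (((i+1:ℕ):ℤ) + m) = a (i + (m + 1)) := fun i => by
      congr 1; push_cast; ring
    simp_rw [e2] at this
    linarith
  induction m using Int.induction_on with
  | zero => simp
  | succ m ih => rw [step, ih]
  | pred m ih => rw [← ih, ← step]; simp

lemma W_sh {f : ℝ → ℝ} (hf : S.Adm f) {k : ℕ} {x : ℤ → ℝ} (hx : S.Per k x) (l : ℤ) :
    S.W f (S.N k) (sh (l * S.M) x) = S.W f (S.N k) x := by
  let a : ℤ → ℝ := fun i => S.J f (i * S.h) ((i + 1) * S.h) (S.pc f x i)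
  have ha : ∀ i, a (i + (S.N k : ℕ)) = a i := by
    intro i
    have := J_pc_shift hf k x i
    rw [hx] at this
    simp only [a]
    rw [N_cast]
    exact this
  have := sum_shift ha (l * S.M)
  unfold W
  refine Eq.trans (Finset.sum_congr rfl fun i _ => ?_) this
  exact (J_pc_shift hf l x i).symm

end Setup
end SH

namespace SH
open Topology
namespace Setup
variable {S : Setup}

lemma prim_diff {f g : ℝ → ℝ} (hf : Continuous f) (hg : Continuous g) {ε : ℝ}
    (h : ∀ s, |f s - g s| ≤ ε) (s : ℝ) : |prim f s - prim g s| ≤ ε * |s| := by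
  unfold prim
  rw [← intervalIntegral.integral_sub (hf.intervalIntegrable _ _) (hg.intervalIntegrable _ _)]
  have := intervalIntegral.norm_integral_le_of_norm_le_const (a := 0) (b := s)
    (f := fun τ => f τ - g τ) (C := ε) (fun x _ => h x)
  simpa using this

lemma Adm.abs_le {f : ℝ → ℝ} (hf : S.Adm f) (s : ℝ) : |f s| ≤ S.L * |s| := by
  have := hf.1 s 0; rwa [hf.2, sub_zero, sub_zero] at this

lemma prim_lip {f : ℝ → ℝ} (hf : S.Adm f) {s t K : ℝ} (hs : |s| ≤ K) (ht : |t| ≤ K) :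
    |prim f s - prim f t| ≤ S.L * K * |s - t| := by
  have := prim_est hf.cont (s := t) (t := s) (c := 0) (ε := S.L * K) (by
    intro x hx
    rw [sub_zero]
    refine (hf.abs_le x).trans (mul_le_mul_of_nonneg_left ?_ S.hL.le)
    rw [abs_le] at *
    rcases mem_uIcc.1 hx with h | h <;> constructor <;> linarith [h.1, h.2])
  rwa [zero_mul, sub_zero] at this

lemma J_close {f₁ f₂ u₁ u₂ : ℝ → ℝ} {a b ε δ K : ℝ} (hf₁ : S.Adm f₁) (hf₂ : S.Adm f₂)
    (hε : ∀ s, |f₁ s - f₂ s| ≤ ε) (h₁ : S.SolOn f₁ a b u₁) (h₂ : S.SolOn f₂ a b u₂)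
    (hab : a < b) (hb : b ≤ a + S.η) (ha' : |u₁ a - u₂ a| ≤ δ) (hb' : |u₁ b - u₂ b| ≤ δ)
    (hK : ∀ t ∈ Icc a b, |u₂ t| ≤ K ∧ |deriv u₂ t| ≤ K) {e d : ℝ} (he : e = 2 * (δ + S.η * S.B * ε))
    (hd : d = 2 * δ / (b - a) + S.B * (S.L * e + ε)) :
    |S.J f₁ a b u₁ - S.J f₂ a b u₂| ≤ (b - a) * (d * (d + 2 * K)) + S.B * (S.L * (K + e) * e + ε * K) := by
  have hε0 : 0 ≤ ε := (abs_nonneg _).trans (hε 0)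
  have hδ0 : 0 ≤ δ := (abs_nonneg _).trans ha'
  have hη := S.eta_pos; have hB := S.hB0; have hL := S.hL
  have he0 : 0 ≤ e := by rw [he]; positivity
  have hba : 0 < b - a := by linarith
  have hd0 : 0 ≤ d := by rw [hd]; positivity
  have hK0 : 0 ≤ K := (abs_nonneg _).trans (hK a ⟨le_rfl, hab.le⟩).1
  have hs : ∀ t ∈ Icc a b, |u₁ t - u₂ t| ≤ e := fun t ht =>
    he ▸ stab hf₁ hf₂ hε h₁ h₂ hab hb ha' hb' t ht
  have hsd : ∀ t ∈ Icc a b, |deriv u₁ t - deriv u₂ t| ≤ d := by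
    intro t ht
    have h := (h₁.1.sub h₂.1).deriv_bd hab (diff_deriv hf₁ hf₂ hε h₁ h₂ hb he0 hs) t ht
    rw [deriv_fun_sub (h₁.1.1 t) (h₂.1.1 t)] at h
    refine h.trans ?_
    rw [hd]
    gcongr
    refine (abs_sub _ _).trans ?_
    linarith
  have e1 : S.J f₁ a b u₁ - S.J f₂ a b u₂ = (∫ t in a..b, ((deriv u₁ t)^2/2 - (deriv u₂ t)^2/2))
      - ∫ t in a..b, S.q t * (prim f₁ (u₁ t) - prim f₂ (u₂ t)) := by
    have c1 := h₁.1.2; have c2 := h₂.1.2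
    have p1 := (prim_cont hf₁.cont).comp h₁.1.cont
    have p2 := (prim_cont hf₂.cont).comp h₂.1.cont
    unfold J
    rw [← intervalIntegral.integral_sub (Jint hf₁.cont h₁.1 a b) (Jint hf₂.cont h₂.1 a b),
      ← intervalIntegral.integral_sub
      ((by fun_prop : Continuous fun t => (deriv u₁ t)^2/2 - (deriv u₂ t)^2/2).intervalIntegrable _ _)
      (S.qmul (φ := fun t => prim f₁ (u₁ t) - prim f₂ (u₂ t)) (p1.sub p2) a b)]
    congr 1; funext t; ring
  have i1 : |∫ t in a..b, ((deriv u₁ t)^2/2 - (deriv u₂ t)^2/2)| ≤ (d * (d + 2 * K)) * |b - a| := by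
    rw [← Real.norm_eq_abs]
    refine intervalIntegral.norm_integral_le_of_norm_le_const fun t ht => ?_
    rw [uIoc_of_le hab.le] at ht
    have ht' : t ∈ Icc a b := ⟨ht.1.le, ht.2⟩
    have x1 := abs_le.1 (hsd t ht'); have x2 := abs_le.1 (hK t ht').2
    rw [Real.norm_eq_abs, abs_le]
    constructor <;> nlinarith [mul_nonneg hd0 hK0]
  have i2 : |∫ t in a..b, S.q t * (prim f₁ (u₁ t) - prim f₂ (u₂ t))| ≤ S.B * (S.L * (K + e) * e + ε * K) := by
    refine S.qbound ((prim_cont hf₁.cont |>.comp h₁.1.cont).sub (prim_cont hf₂.cont |>.comp h₂.1.cont))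
      hab.le (by linarith [S.eta_le]) (by positivity) fun t ht => ?_
    have hk := (hK t ht).1
    have a1 := prim_lip hf₁ (s := u₁ t) (t := u₂ t) (K := K + e)
      (by have := hs t ht; rw [abs_le] at *; constructor <;> linarith) (by linarith)
    have a2 := prim_diff hf₁.cont hf₂.cont hε (u₂ t)
    calc |prim f₁ (u₁ t) - prim f₂ (u₂ t)| = |(prim f₁ (u₁ t) - prim f₁ (u₂ t)) + (prim f₁ (u₂ t) - prim f₂ (u₂ t))| := by ring_nf
      _ ≤ _ := abs_add_le _ _
      _ ≤ _ := add_le_add (a1.trans (mul_le_mul_of_nonneg_left (hs t ht) (by positivity)))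
        (a2.trans (mul_le_mul_of_nonneg_left hk hε0))
  rw [e1]
  rw [abs_of_pos hba] at i1
  refine (abs_sub _ _).trans ?_
  linarith

section lim
variable {ι : Type*} {l : Filter ι} {f : ℝ → ℝ} {F : ι → ℝ → ℝ} {ε : ι → ℝ}

lemma U_tendsto (hf : S.Adm f) (hF : ∀ j, S.Adm (F j)) (hε : ∀ j s, |F j s - f s| ≤ ε j)
    (hl : Tendsto ε l (𝓝 0)) {X : ι → ℤ → ℝ} {x : ℤ → ℝ} (hX : ∀ i, Tendsto (fun j => X j i) l (𝓝 (x i)))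
    (p i : ℤ) : Tendsto (fun j => S.U (F j) p (X j) i) l (𝓝 (S.U f p x i)) := by
  rw [tendsto_iff_norm_sub_tendsto_zero]
  have hz : ∀ i, Tendsto (fun j => |X j i - x i|) l (𝓝 0) := fun i => by
    simpa using tendsto_iff_norm_sub_tendsto_zero.1 (hX i)
  have hb : Tendsto (fun j => 2 * ((|X j (i-1) - x (i-1)| + |X j i - x i| + |X j (i+1) - x (i+1)|)
      + S.η * S.B * ε j)) l (𝓝 0) := by
    simpa using (((hz (i-1)).add (hz i)).add (hz (i+1)) |>.add (hl.const_mul (S.η * S.B))).const_mul 2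
  refine squeeze_zero (fun _ => norm_nonneg _) (fun j => ?_) hb
  have a := abs_nonneg (X j (i-1) - x (i-1)); have b := abs_nonneg (X j i - x i)
  have c := abs_nonneg (X j (i+1) - x (i+1))
  exact U_stab (hF j) hf (hε j) p i (by linarith) (by linarith) (by linarith)

lemma P_tendsto (hf : S.Adm f) (hF : ∀ j, S.Adm (F j)) (hε : ∀ j s, |F j s - f s| ≤ ε j)
    (hl : Tendsto ε l (𝓝 0)) {X : ι → ℤ → ℝ} {x : ℤ → ℝ} (hX : ∀ i, Tendsto (fun j => X j i) l (𝓝 (x i)))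
    (i : ℤ) : Tendsto (fun j => S.P (F j) (X j) i) l (𝓝 (S.P f x i)) :=
  U_tendsto hf hF hε hl (fun i => U_tendsto hf hF hε hl hX 1 i) 0 i

lemma W_tendsto (hf : S.Adm f) (hF : ∀ j, S.Adm (F j)) (hε : ∀ j s, |F j s - f s| ≤ ε j)
    (hl : Tendsto ε l (𝓝 0)) {X : ι → ℤ → ℝ} {x : ℤ → ℝ} (hX : ∀ i, Tendsto (fun j => X j i) l (𝓝 (x i)))
    (N : ℕ) : Tendsto (fun j => S.W (F j) N (X j)) l (𝓝 (S.W f N x)) := by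
  refine tendsto_finset_sum _ fun n _ => ?_
  generalize (n:ℤ) = i
  have hh := S.h_pos; have hh2 := S.two_h
  have h2 := pc_spec hf x i
  have hab : (i:ℝ) * S.h < (i+1) * S.h := by linarith
  obtain ⟨K, hK⟩ := isCompact_Icc.exists_bound_of_continuousOn
    (s := Icc ((i:ℝ) * S.h) ((i+1) * S.h)) (f := fun t => |S.pc f x i t| + |deriv (S.pc f x i) t|)
    (h2.1.1.cont.abs.add h2.1.1.2.abs).continuousOn
  have hK' : ∀ t ∈ Icc ((i:ℝ) * S.h) ((i+1) * S.h), |S.pc f x i t| ≤ K ∧ |deriv (S.pc f x i) t| ≤ K := by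
    intro t ht
    have a := abs_nonneg (S.pc f x i t); have b := abs_nonneg (deriv (S.pc f x i) t)
    have := (le_abs_self _).trans (hK t ht)
    constructor <;> linarith
  rw [tendsto_iff_norm_sub_tendsto_zero]
  have hz : ∀ i, Tendsto (fun j => |X j i - x i|) l (𝓝 0) := fun i => by
    simpa using tendsto_iff_norm_sub_tendsto_zero.1 (hX i)
  let δ : ι → ℝ := fun j => |X j i - x i| + |X j (i+1) - x (i+1)|
  have hδ : Tendsto δ l (𝓝 0) := by simpa using (hz i).add (hz (i+1))
  have hp := hδ.prodMk_nhds hl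
  let E : ℝ × ℝ → ℝ := fun z => 2 * (z.1 + S.η * S.B * z.2)
  let D : ℝ × ℝ → ℝ := fun z => 2 * z.1 / ((i+1) * S.h - i * S.h) + S.B * (S.L * E z + z.2)
  let G : ℝ × ℝ → ℝ := fun z => ((i+1) * S.h - i * S.h) * (D z * (D z + 2 * K))
    + S.B * (S.L * (K + E z) * E z + z.2 * K)
  have hG : Continuous G := by simp only [G, D, E]; fun_prop
  have hG0 : G (0, 0) = 0 := by simp [G, D, E]
  have hb : Tendsto (fun j => G (δ j, ε j)) l (𝓝 0) := hG0 ▸ (hG.tendsto _).comp hp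
  refine squeeze_zero (fun _ => norm_nonneg _) (fun j => ?_) hb
  have h1 := pc_spec (hF j) (X j) i
  have a := abs_nonneg (X j i - x i); have c := abs_nonneg (X j (i+1) - x (i+1))
  refine J_close (hF j) hf (hε j) h1.1 h2.1 hab (by linarith) ?_ ?_ hK' rfl rfl
  · rw [h1.2.1, h2.2.1]; simp only [δ]; linarith
  · rw [h1.2.2, h2.2.2]; simp only [δ]; linarith
end lim

lemma P_cont {f : ℝ → ℝ} (hf : S.Adm f) : Continuous (S.P f) := by
  refine continuous_pi fun i => continuous_iff_continuousAt.2 fun x => ?_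
  exact P_tendsto (F := fun _ => f) (ε := fun _ => 0) hf (fun _ => hf) (by simp) tendsto_const_nhds
    (fun i => (continuous_apply i).tendsto x) i

lemma W_cont {f : ℝ → ℝ} (hf : S.Adm f) (N : ℕ) : Continuous (S.W f N) := by
  refine continuous_iff_continuousAt.2 fun x => ?_
  exact W_tendsto (F := fun _ => f) (ε := fun _ => 0) hf (fun _ => hf) (by simp) tendsto_const_nhds
    (fun i => (continuous_apply i).tendsto x) N

/-- scaling -/
noncomputable def scl (r : ℝ) (f : ℝ → ℝ) : ℝ → ℝ := fun s => f (r * s) / r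

lemma scl_adm {f : ℝ → ℝ} (hf : S.Adm f) {r : ℝ} (hr : 0 < r) : S.Adm (scl r f) := by
  refine ⟨fun s t => ?_, by simp [scl, hf.2]⟩
  unfold scl
  rw [← sub_div, abs_div, abs_of_pos hr, div_le_iff₀ hr]
  have := hf.1 (r * s) (r * t)
  rw [← mul_sub, abs_mul, abs_of_pos hr] at this
  linarith

lemma SolOn.scl {f u : ℝ → ℝ} {a b r : ℝ} (hr : 0 < r) (hu : S.SolOn (scl r f) a b u) :
    S.SolOn f a b (fun t => r * u t) := by
  have hd : ∀ t, HasDerivAt (fun t => r * u t) (r * deriv u t) t := fun t =>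
    ((hu.1.1 t).hasDerivAt).const_mul r
  refine ⟨C1.of hd (hu.1.2.const_mul r), fun s hs t ht => ?_⟩
  rw [(hd t).deriv, (hd s).deriv, ← mul_sub, hu.2 s hs t ht, mul_neg,
    ← intervalIntegral.integral_const_mul]
  congr 2; funext τ; unfold Setup.scl; field_simp

lemma prim_scl {f : ℝ → ℝ} {r : ℝ} (hr : 0 < r) (s : ℝ) : prim f (r * s) = r^2 * prim (scl r f) s := by
  unfold prim scl
  have := intervalIntegral.mul_integral_comp_mul_left (a := 0) (b := s) (f := f) (c := r)
  rw [mul_zero] at this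
  rw [← this, intervalIntegral.integral_div]
  field_simp

lemma J_scl {f u : ℝ → ℝ} {a b r : ℝ} (hr : 0 < r) (hu : C1 u) :
    S.J f a b (fun t => r * u t) = r^2 * S.J (scl r f) a b u := by
  unfold J
  rw [← intervalIntegral.integral_const_mul]
  congr 1; funext t
  rw [prim_scl hr, (((hu.1 t).hasDerivAt).const_mul r).deriv]; ring

lemma W_scl {f : ℝ → ℝ} (hf : S.Adm f) {r : ℝ} (hr : 0 < r) (N : ℕ) (x : ℤ → ℝ) :
    S.W f N (fun i => r * x i) = r^2 * S.W (scl r f) N x := by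
  unfold W
  rw [Finset.mul_sum]
  refine Finset.sum_congr rfl fun i _ => ?_
  have h := pc_spec (scl_adm hf hr) x i
  have hh := S.h_pos
  rw [← J_scl hr h.1.1]
  exact J_congr (by linarith) (pc_eq hf (h.1.scl hr) (by rw [h.2.1]) (by rw [h.2.2]))

lemma U_scl {f : ℝ → ℝ} (hf : S.Adm f) {r : ℝ} (hr : 0 < r) (p : ℤ) (x : ℤ → ℝ) :
    S.U f p (fun i => r * x i) = fun i => r * S.U (scl r f) p x i := by
  funext i
  unfold U
  split_ifs
  · have h := dp_spec (scl_adm hf hr) x i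
    have h' := dp_spec hf (fun i => r * x i) i
    have := S.h_pos; have := S.two_h
    refine uniq hf h'.1 (h.1.scl hr) (by linarith) (by linarith) ?_ ?_ _ ⟨by linarith, by linarith⟩
    · rw [h'.2.1, h.2.1]
    · rw [h'.2.2, h.2.2]
  · rfl

lemma P_scl {f : ℝ → ℝ} (hf : S.Adm f) {r : ℝ} (hr : 0 < r) (x : ℤ → ℝ) :
    S.P f (fun i => r * x i) = fun i => r * S.P (scl r f) x i := by
  unfold P; rw [U_scl hf hr, U_scl hf hr]

end Setup
end SH

namespace SH
open Topology

lemma pos_int {q : ℝ → ℝ} (hq : LocallyIntegrable q volume) {a b : ℝ} (hab : a < b)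
    (h : PosOn q (Icc a b)) : 0 < ∫ t in a..b, q t := by
  have hi : IntegrableOn q (Icc a b) := hq.integrableOn_isCompact isCompact_Icc
  rw [intervalIntegral.integral_of_le hab.le, ← integral_Icc_eq_integral_Ioc]
  refine lt_of_le_of_ne (integral_nonneg_of_ae h.1) fun he => h.2 ?_
  exact (integral_eq_zero_iff_of_nonneg_ae h.1 hi).1 he.symm

lemma inner_int {q : ℝ → ℝ} (hq : LocallyIntegrable q volume) {a b : ℝ} (hab : a < b)
    (h : PosOn q (Icc a b)) : ∃ δ, 0 < δ ∧ a + δ < b - δ ∧ 0 < ∫ t in (a+δ)..(b-δ), q t := by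
  have hqi : ∀ a b, IntervalIntegrable q volume a b := fun a b =>
    (hq.integrableOn_isCompact isCompact_uIcc).intervalIntegrable
  have hc := intervalIntegral.continuous_primitive hqi a
  have e : ∀ δ, ∫ t in (a+δ)..(b-δ), q t = (∫ t in a..(b-δ), q t) - ∫ t in a..(a+δ), q t := fun δ =>
    (intervalIntegral.integral_interval_sub_left (hqi _ _) (hqi _ _)).symm
  have hc2 : Continuous fun δ => ∫ t in (a+δ)..(b-δ), q t := by
    simp_rw [e]
    exact (hc.comp (continuous_const.sub continuous_id)).sub (hc.comp (continuous_const.add continuous_id))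
  have h0 : ∀ᶠ δ in 𝓝 (0:ℝ), 0 < ∫ t in (a+δ)..(b-δ), q t :=
    (hc2.tendsto 0).eventually (lt_mem_nhds (by simpa using pos_int hq hab h))
  have h1 : ∀ᶠ δ in 𝓝 (0:ℝ), δ < (b - a)/2 := gt_mem_nhds (by linarith)
  obtain ⟨δ, hδ, hδ0⟩ := (((h0.and h1).filter_mono nhdsWithin_le_nhds).and
    (self_mem_nhdsWithin : ∀ᶠ δ in 𝓝[>] (0:ℝ), δ ∈ Ioi 0)).exists
  exact ⟨δ, hδ0, by linarith [hδ.2], hδ.1⟩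

namespace Setup
variable {S : Setup}

lemma GSol.anti {f u : ℝ → ℝ} {a b : ℝ} (hu : S.GSol f u)
    (hq : ∀ᵐ t ∂(volume.restrict (Icc a b)), 0 ≤ S.q t) (hp : ∀ t, 0 ≤ f (u t)) :
    AntitoneOn (deriv u) (Icc a b) := by
  intro s hs t ht hst
  have := hu.2 s t
  have h : 0 ≤ ∫ τ in s..t, S.q τ * f (u τ) := by
    refine intervalIntegral.integral_nonneg_of_ae_restrict hst ?_
    filter_upwards [ae_restrict_of_ae_restrict_of_subset (Icc_subset_Icc hs.1 ht.2) hq] with τ h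
      using mul_nonneg h (hp τ)
  linarith

lemma GSol.mono {f u : ℝ → ℝ} {a b : ℝ} (hu : S.GSol f u)
    (hq : ∀ᵐ t ∂(volume.restrict (Icc a b)), 0 ≤ -S.q t) (hp : ∀ t, 0 ≤ f (u t)) :
    MonotoneOn (deriv u) (Icc a b) := by
  intro s hs t ht hst
  have := hu.2 s t
  have h : 0 ≤ ∫ τ in s..t, -(S.q τ * f (u τ)) := by
    refine intervalIntegral.integral_nonneg_of_ae_restrict hst ?_
    filter_upwards [ae_restrict_of_ae_restrict_of_subset (Icc_subset_Icc hs.1 ht.2) hq] with τ h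
    have := mul_nonneg h (hp τ)
    simp only [Pi.zero_apply]; linarith
  rw [intervalIntegral.integral_neg] at h
  linarith

/-- estimate on a positivity interval -/
lemma bump {f u : ℝ → ℝ} {a b c δ Λ s0 : ℝ} (hf : S.Adm f) (hu : S.GSol f u)
    (hq : ∀ᵐ t ∂(volume.restrict (Icc a b)), 0 ≤ S.q t) (hfp : ∀ s, 0 ≤ s → 0 ≤ f s) (hu0 : ∀ t, 0 ≤ u t)
    (hmax : ∀ t, u t ≤ u c) (hc : c ∈ Icc a b) (hδ : 0 < δ) (hδ2 : a + δ < b - δ)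
    (hκ : 0 < ∫ t in (a+δ)..(b-δ), S.q t) (hs0 : 0 < s0) (hΛ0 : 0 < Λ) (hΛ : ∀ s, Λ⁻¹ * s0 ≤ s → Λ * s ≤ f s)
    (h1 : 2 / δ < Λ * (δ / (b - a) * ∫ t in (a+δ)..(b-δ), S.q t)) (h2 : Λ⁻¹ ≤ δ / (b - a)) : u c < s0 := by
  by_contra hcon
  push Not at hcon
  have hba : 0 < b - a := by linarith
  have hanti := hu.anti hq (fun t => hfp _ (hu0 t))
  have hconc : ConcaveOn ℝ (Icc a b) u := AntitoneOn.concaveOn_of_deriv (convex_Icc a b)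
    hu.1.cont.continuousOn hu.1.1.differentiableOn (hanti.mono interior_subset)
  have hlow : ∀ t ∈ Icc (a+δ) (b-δ), δ / (b - a) * u c ≤ u t := by
    intro t ht
    have key : ∀ p y, p ∈ Icc a b → t = (1 - y) * p + y * c → 0 ≤ y → y ≤ 1 → y * u c ≤ u t := by
      intro p y hp ht hy0 hy1
      have := hconc.2 hp hc (by linarith : 0 ≤ 1 - y) hy0 (by ring)
      simp only [smul_eq_mul] at this
      rw [← ht] at this
      nlinarith [mul_nonneg (by linarith : 0 ≤ 1 - y) (hu0 p)]
    have fin : ∀ y, δ / (b - a) ≤ y → y * u c ≤ u t → δ / (b - a) * u c ≤ u t := fun y hy h =>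
      (mul_le_mul_of_nonneg_right hy (hu0 c)).trans h
    rcases le_total c t with hct | hct
    · have hbc : 0 < b - c := by linarith [ht.2]
      refine fin ((b - t)/(b - c)) ?_ (key b _ ⟨by linarith, le_rfl⟩ ?_ ?_ ?_)
      · rw [div_le_div_iff₀ hba hbc]; nlinarith [ht.2, hc.1]
      · field_simp; ring
      · exact div_nonneg (by linarith [ht.2]) hbc.le
      · rw [div_le_one hbc]; linarith
    · have hbc : 0 < c - a := by linarith [ht.1]
      refine fin ((t - a)/(c - a)) ?_ (key a _ ⟨le_rfl, by linarith⟩ ?_ ?_ ?_)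
      · rw [div_le_div_iff₀ hba hbc]; nlinarith [ht.1, hc.2]
      · field_simp; ring
      · exact div_nonneg (by linarith [ht.1]) hbc.le
      · rw [div_le_one hbc]; linarith
  have hM : 0 < u c := by linarith
  have d1 : deriv u (a+δ) ≤ u c / δ := by
    obtain ⟨ξ, hξ, e⟩ := exists_deriv_eq_slope u (show a < a + δ by linarith) hu.1.cont.continuousOn
      hu.1.1.differentiableOn
    have := hanti ⟨hξ.1.le, by linarith [hξ.2]⟩ (⟨by linarith, by linarith⟩ : a + δ ∈ Icc a b) hξ.2.le
    rw [e] at this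
    refine this.trans ?_
    rw [show a + δ - a = δ by ring]
    gcongr
    linarith [hmax (a+δ), hu0 a]
  have d2 : -(u c / δ) ≤ deriv u (b-δ) := by
    obtain ⟨ξ, hξ, e⟩ := exists_deriv_eq_slope u (show b - δ < b by linarith) hu.1.cont.continuousOn
      hu.1.1.differentiableOn
    have := hanti (⟨by linarith, by linarith⟩ : b - δ ∈ Icc a b) ⟨by linarith [hξ.1], hξ.2.le⟩ hξ.1.le
    rw [e] at this
    refine le_trans ?_ this
    rw [show b - (b - δ) = δ by ring, ← neg_div]
    gcongr
    linarith [hmax (b-δ), hu0 b]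
  have hI := hu.2 (a+δ) (b-δ)
  have hge : (∫ t in (a+δ)..(b-δ), S.q t * (Λ * (δ / (b - a) * u c))) ≤ ∫ t in (a+δ)..(b-δ), S.q t * f (u t) := by
    refine intervalIntegral.integral_mono_ae_restrict hδ2.le ((S.qint _ _).mul_const _)
      (S.qmul (hf.cont.comp hu.1.cont) _ _) ?_
    filter_upwards [ae_restrict_of_ae_restrict_of_subset
      (Icc_subset_Icc (by linarith : a ≤ a + δ) (by linarith : b - δ ≤ b)) hq,
      ae_restrict_mem measurableSet_Icc] with t hqt ht
    refine mul_le_mul_of_nonneg_left ?_ hqt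
    have h3 := hlow t ht
    refine le_trans (mul_le_mul_of_nonneg_left h3 hΛ0.le) (hΛ _ ?_)
    refine le_trans ?_ h3
    have : 0 ≤ δ / (b - a) := by positivity
    exact mul_le_mul h2 hcon hs0.le this
  rw [intervalIntegral.integral_mul_const] at hge
  have : 2 / δ * u c < Λ * (δ / (b - a) * ∫ t in (a+δ)..(b-δ), S.q t) * u c := by gcongr
  have e1 : 2 / δ * u c = u c / δ + u c / δ := by ring
  nlinarith

end Setup

lemma apriori {q : ℝ → ℝ} {T : ℝ} (hq : LocallyIntegrable q volume) {m : ℕ} (hs : SignCond q T m) :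
    ∃ Λ : ℝ, 0 < Λ ∧ ∀ S : Setup, S.q = q → S.T = T → ∀ f u, S.Adm f → S.GSol f u →
      (∀ s, 0 ≤ s → 0 ≤ f s) → (∀ t, 0 ≤ u t) → (∃ c, ∀ t, u t ≤ u c) → ∀ s0, 0 < s0 →
      (∀ s, Λ⁻¹ * s0 ≤ s → Λ * s ≤ f s) → ∀ t, u t < s0 := by
  obtain ⟨σ, hσ0, hσT, hσ, hp, hn⟩ := hs
  have hδ : ∀ i : ℕ, ∃ δ, i < m → 0 < δ ∧ σ (2*i) + δ < σ (2*i+1) - δ ∧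
      0 < ∫ t in (σ (2*i) +δ)..(σ (2*i+1)-δ), q t := by
    intro i
    by_cases hi : i < m
    · obtain ⟨δ, h⟩ := inner_int hq (hσ (2*i) (by omega)) (hp i hi)
      exact ⟨δ, fun _ => h⟩
    · exact ⟨0, fun h => absurd h hi⟩
  choose δ hδ using hδ
  have hev : ∀ᶠ Λ in atTop, ∀ i ∈ Finset.range m, 2 / δ i < Λ * (δ i / (σ (2*i+1) - σ (2*i)) *
      ∫ t in (σ (2*i) +δ i)..(σ (2*i+1)-δ i), q t) ∧ Λ⁻¹ ≤ δ i / (σ (2*i+1) - σ (2*i)) := by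
    rw [Filter.eventually_all_finset]
    intro i hi
    obtain ⟨h1, h2, h3⟩ := hδ i (Finset.mem_range.1 hi)
    have hba : 0 < σ (2*i+1) - σ (2*i) := by linarith
    have h4 : 0 < δ i / (σ (2*i+1) - σ (2*i)) := by positivity
    exact ((tendsto_id.atTop_mul_const (mul_pos h4 h3)).eventually_gt_atTop _).and
      ((tendsto_inv_atTop_zero.eventually (gt_mem_nhds h4)).mono fun _ h => h.le)
  obtain ⟨Λ, hΛ, hΛ0⟩ := (hev.and (eventually_gt_atTop 0)).exists
  refine ⟨Λ, hΛ0, ?_⟩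
  rintro S rfl rfl f u hf hu hfp hu0 ⟨c, hc⟩ s0 hs0 hfs
  suffices H : ∀ c ∈ Icc 0 S.T, ∀ u, S.GSol f u → (∀ t, 0 ≤ u t) → (∀ t, u t ≤ u c) → u c < s0 by
    obtain ⟨c', hc', l, e⟩ : ∃ c' ∈ Icc 0 S.T, ∃ l : ℤ, c = c' + l * S.T := by
      refine ⟨toIcoMod S.hT 0 c, ?_, toIcoDiv S.hT 0 c, ?_⟩
      · have := toIcoMod_mem_Ico S.hT 0 c
        exact ⟨this.1, by linarith [this.2]⟩
      · have := toIcoMod_add_toIcoDiv_zsmul S.hT 0 c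
        rw [zsmul_eq_mul] at this; exact this.symm
    have := H c' hc' _ (hu.shift l) (fun t => hu0 _) (fun t => by rw [← e]; exact hc _)
    intro t
    rw [← e] at this
    exact (hc t).trans_lt this
  clear! u c
  intro c hcT u hu hu0 hc
  have hloc : ∀ n, ∀ c, σ 0 ≤ c → c ≤ σ n → ∃ j, j < n ∧ c ∈ Icc (σ j) (σ (j+1)) ∨ n = 0 := by
    intro n
    induction n with
    | zero => intro c _ _; exact ⟨0, Or.inr rfl⟩
    | succ n ih =>
      intro c h0 h1
      rcases le_total c (σ n) with h | h
      · obtain ⟨j, h2 | h2⟩ := ih c h0 h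
        · exact ⟨j, Or.inl ⟨by omega, h2.2⟩⟩
        · subst h2; exact ⟨0, Or.inl ⟨by omega, h0, h1⟩⟩
      · exact ⟨n, Or.inl ⟨by omega, h, h1⟩⟩
  have main : ∀ i < m, ∀ c ∈ Icc (σ (2*i)) (σ (2*i+1)), (∀ t, u t ≤ u c) → u c < s0 := by
    intro i hi c hc hcm
    obtain ⟨h1, h2, h3⟩ := hδ i hi
    obtain ⟨h4, h5⟩ := hΛ i (Finset.mem_range.2 hi)
    exact Setup.bump hf hu (hp i hi).1 hfp hu0 hcm hc h1 h2 h3 hs0 hΛ0 hfs h4 h5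
  obtain ⟨j, ⟨hj, hcj⟩ | hj⟩ := hloc (2*m) c (by rw [hσ0]; exact hcT.1) (by rw [hσT]; exact hcT.2)
  swap
  · obtain rfl : m = 0 := by omega
    have := S.hT
    simp only [mul_zero] at hσT; linarith
  obtain ⟨i, rfl | rfl⟩ := Nat.even_or_odd' j
  · exact main i (by omega) c hcj hc
  · have hmono := hu.mono (hn i (by omega)).1 (fun t => hfp _ (hu0 t))
    have hd0 : deriv u c = 0 := (show IsLocalMax u c from Eventually.of_forall hc).deriv_eq_zero
    have hub : u c ≤ u (σ (2*i+1)) := by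
      have ha : AntitoneOn u (Icc (σ (2*i+1)) c) := antitoneOn_of_deriv_nonpos (convex_Icc _ _)
        hu.1.cont.continuousOn hu.1.1.differentiableOn (fun t ht => by
          have ht' := interior_subset ht
          rw [← hd0]
          exact hmono ⟨ht'.1, ht'.2.trans hcj.2⟩ hcj ht'.2)
      exact ha ⟨le_rfl, hcj.1⟩ ⟨hcj.1, le_rfl⟩ hcj.1
    have := main i (by omega) (σ (2*i+1)) ⟨(hσ (2*i) (by omega)).le, le_rfl⟩ (fun t => (hc t).trans hub)
    linarith
end SH

namespace SH
open Topology
namespace Setup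

noncomputable def finf (S : Setup) (s : ℝ) : ℝ := S.L * max s 0

lemma finf_adm (S : Setup) : S.Adm S.finf := by
  refine ⟨fun s t => ?_, by simp [finf]⟩
  unfold finf
  rw [← mul_sub, abs_mul, abs_of_pos S.hL]
  refine mul_le_mul_of_nonneg_left ?_ S.hL.le
  simpa using abs_max_sub_max_le_max s 0 t 0

structure Ctx (S : Setup) (f f' : ℝ → ℝ) (R : ℝ) : Prop where
  adm : S.Adm f
  hd : ∀ s, HasDerivAt f (f' s) s
  cd : Continuous f'
  mono : Monotone f'
  npos : ∀ s ≤ 0, f s = 0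
  pos : ∀ s > 0, 0 < f s
  inf : ∃ C, ∀ s, |f s - S.finf s| ≤ C
  ap : ∀ u, S.GSol f u → (∀ t, 0 ≤ u t) → (∃ c, ∀ t, u t ≤ u c) → ∀ t, u t < R
  ap' : ∀ u, S.GSol S.finf u → (∀ t, 0 ≤ u t) → (∃ c, ∀ t, u t ≤ u c) → ∀ t, u t = 0
  mean : ∫ t in (0:ℝ)..S.T, S.q t < 0
  bump : ∃ φ, C1 φ ∧ Function.Periodic φ S.T ∧ (∀ t, 0 ≤ φ t) ∧ S.J S.finf 0 S.T φ < 0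
  snd : ∃ f'' : ℝ → ℝ, (∀ s ∈ Ioo 0 R, HasDerivAt f' (f'' s) s ∧ 0 < f'' s) ∧ ContinuousOn f'' (Ioo 0 R)

variable {S : Setup} {f f' : ℝ → ℝ} {R : ℝ}

lemma per_max {u : ℝ → ℝ} (hu : Continuous u) {p : ℝ} (hp : 0 < p) (h : Function.Periodic u p) :
    ∃ c, ∀ t, u t ≤ u c := by
  obtain ⟨c, hc, hm⟩ := isCompact_Icc.exists_isMaxOn (nonempty_Icc.2 hp.le) hu.continuousOn
  refine ⟨c, fun t => ?_⟩
  obtain ⟨y, hy, e⟩ := h.exists_mem_Ico₀ hp t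
  rw [e]; exact hm ⟨hy.1, hy.2.le⟩

lemma GSol.facts {f : ℝ → ℝ} (hf : S.Adm f) {u : ℝ → ℝ} (hu : S.GSol f u) {k : ℕ} (hk : 0 < k)
    (hp : S.Per k (S.nd u)) (h0 : ∀ i, 0 ≤ S.nd u i) :
    Function.Periodic u (k * S.T) ∧ (∀ t, 0 ≤ u t) ∧ ∃ c, ∀ t, u t ≤ u c := by
  have h1 : Function.Periodic u (k * S.T) := fun t => by
    have := hu.periodic hf (l := k) hp t
    simpa using this
  have := S.hT
  refine ⟨h1, fun t => (zero_sol hf).le hf hu h0 t, per_max hu.1.cont (p := k * S.T) (by positivity) h1⟩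

def CC (S : Setup) (f : ℝ → ℝ) (k : ℕ) (A c : ℝ) : Set (ℤ → ℝ) :=
  {x | S.Per k x ∧ (∀ i, 0 ≤ x i) ∧ S.W f (S.N k) x ≤ c ∧ ∀ n, -A ≤ S.W f (S.N k) ((S.P f)^[n] x)}

lemma Per_closed (S : Setup) (k : ℕ) : IsClosed {x | S.Per k x} := by
  unfold Per sh
  exact isClosed_eq (continuous_pi fun i => continuous_apply _) continuous_id

lemma nn_closed : IsClosed {x : ℤ → ℝ | ∀ i, 0 ≤ x i} := by
  rw [setOf_forall]
  exact isClosed_iInter fun i => isClosed_le continuous_const (continuous_apply i)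

lemma CC_closed (hf : S.Adm f) (k : ℕ) (A c : ℝ) : IsClosed (S.CC f k A c) := by
  have h3 : IsClosed {x | ∀ n, -A ≤ S.W f (S.N k) ((S.P f)^[n] x)} := by
    rw [setOf_forall]
    exact isClosed_iInter fun n => isClosed_le continuous_const ((W_cont hf _).comp ((P_cont hf).iterate n))
  exact (S.Per_closed k).inter (nn_closed.inter ((isClosed_le (W_cont hf _) continuous_const).inter h3))

lemma CC_P (hf : S.Adm f) {k : ℕ} (hk : 0 < k) {A c : ℝ} {x : ℤ → ℝ} (hx : x ∈ S.CC f k A c) :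
    S.P f x ∈ S.CC f k A c :=
  ⟨hx.1.P hf, P_nonneg hf hx.2.1, (W_P hf hk hx.1).trans hx.2.2.1, fun n => by
    have := hx.2.2.2 (n+1); rwa [Function.iterate_succ_apply] at this⟩

lemma le_sum {k : ℕ} (hk : 0 < k) {x : ℤ → ℝ} (hp : S.Per k x) (h0 : ∀ i, 0 ≤ x i) (i : ℤ) :
    x i ≤ ∑ j ∈ Finset.range (S.N k), x j := by
  refine Per.all hk hp hp (fun a _ => a ≤ ∑ j ∈ Finset.range (S.N k), x j) (fun j hj => ?_) i
  exact Finset.single_le_sum (f := fun j : ℕ => x j) (fun j _ => h0 j) (Finset.mem_range.2 hj)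

lemma Ctx.lim_zero (H : S.Ctx f f' R) {r : ℕ → ℝ} (hr : Tendsto r atTop atTop) (hr0 : ∀ j, 0 < r j)
    {ξ : ℕ → ℤ → ℝ} {x : ℤ → ℝ} (hx : ∀ i, Tendsto (fun j => ξ j i) atTop (𝓝 (x i))) (N : ℕ) :
    Tendsto (fun j => S.W (scl (r j) f) N (ξ j)) atTop (𝓝 (S.W S.finf N x)) ∧
    ∀ i, Tendsto (fun j => S.P (scl (r j) f) (ξ j) i) atTop (𝓝 (S.P S.finf x i)) := by
  obtain ⟨C, hC⟩ := H.inf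
  have hε : ∀ j s, |scl (r j) f s - S.finf s| ≤ C / r j := by
    intro j s
    have : scl (r j) f s - S.finf s = (f (r j * s) - S.finf (r j * s)) / r j := by
      unfold scl finf
      have e : max (r j * s) 0 = r j * max s 0 := by
        rw [mul_max_of_nonneg _ _ (hr0 j).le, mul_zero]
      have := (hr0 j).ne'
      rw [e]; field_simp
    rw [this, abs_div, abs_of_pos (hr0 j)]
    exact div_le_div_of_nonneg_right (hC _) (hr0 j).le
  have hl : Tendsto (fun j => C / r j) atTop (𝓝 0) := tendsto_const_nhds.div_atTop hr
  exact ⟨W_tendsto S.finf_adm (fun j => scl_adm H.adm (hr0 j)) hε hl hx N,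
    fun i => P_tendsto S.finf_adm (fun j => scl_adm H.adm (hr0 j)) hε hl hx i⟩

lemma Ctx.CC_bdd (H : S.Ctx f f' R) {k : ℕ} (hk : 0 < k) (A c : ℝ) :
    ∃ ρ, ∀ x ∈ S.CC f k A c, ∀ i, x i ≤ ρ := by
  suffices h : ∃ ρ, ∀ x ∈ S.CC f k A c, ∑ j ∈ Finset.range (S.N k), x j ≤ ρ by
    obtain ⟨ρ, h⟩ := h
    exact ⟨ρ, fun x hx i => (le_sum hk hx.1 hx.2.1 i).trans (h x hx)⟩
  by_contra hcon
  push Not at hcon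
  choose X hX hXr using fun j : ℕ => hcon ((j:ℝ)+1)
  let r : ℕ → ℝ := fun j => ∑ i ∈ Finset.range (S.N k), X j i
  have hr1 : ∀ j : ℕ, (j:ℝ) + 1 ≤ r j := fun j => (hXr j).le
  have hr0 : ∀ j, 0 < r j := fun j => lt_of_lt_of_le (by positivity) (hr1 j)
  have hrt : Tendsto r atTop atTop := tendsto_atTop_mono hr1
    (tendsto_atTop_add_const_right _ _ tendsto_natCast_atTop_atTop)
  let ξ : ℕ → ℤ → ℝ := fun j i => X j i / r j
  have hξX : ∀ j, X j = fun i => r j * ξ j i := fun j => by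
    funext i; simp only [ξ]; have := (hr0 j).ne'; field_simp
  have hξ : ∀ j, ξ j ∈ Set.pi univ (fun _ : ℤ => Icc (0:ℝ) 1) := fun j i _ =>
    ⟨div_nonneg ((hX j).2.1 i) (hr0 j).le, (div_le_one (hr0 j)).2 (le_sum hk (hX j).1 (hX j).2.1 i)⟩
  obtain ⟨x, hx, φ, hφ, hlim⟩ := (isCompact_univ_pi fun _ : ℤ => isCompact_Icc (a := (0:ℝ)) (b := 1)).tendsto_subseq hξ
  have hlim' := tendsto_pi_nhds.1 hlim
  have hrφ : Tendsto (r ∘ φ) atTop atTop := hrt.comp hφ.tendsto_atTop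
  have hper : S.Per k x := (S.Per_closed k).mem_of_tendsto hlim (Eventually.of_forall fun j => by
    have := (hX (φ j)).1
    unfold Per sh at this ⊢
    funext i; have := congrFun this i
    show X (φ j) _ / _ = X (φ j) i / _
    rw [this])
  have hlz := H.lim_zero hrφ (fun j => hr0 _) hlim' (S.N k)
  have hlz2 := H.lim_zero hrφ (fun j => hr0 _) hlz.2 (S.N k)
  have hz : ∀ {a : ℕ → ℝ}, (∀ j, -A ≤ (r (φ j))^2 * a j ∧ (r (φ j))^2 * a j ≤ c) → Tendsto a atTop (𝓝 0) := by
    intro a ha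
    have h2 : Tendsto (fun j => (r (φ j))^2) atTop atTop :=
      (tendsto_pow_atTop two_ne_zero).comp hrφ
    refine tendsto_of_tendsto_of_tendsto_of_le_of_le (tendsto_const_nhds.div_atTop h2 : Tendsto (fun j => (-A) / (r (φ j))^2) atTop (𝓝 0))
      (tendsto_const_nhds.div_atTop h2 : Tendsto (fun j => c / (r (φ j))^2) atTop (𝓝 0)) (fun j => ?_) (fun j => ?_)
    · have := hr0 (φ j)
      show -A / _ ≤ _
      rw [div_le_iff₀ (by positivity)]; linarith [(ha j).1]
    · have := hr0 (φ j)
      show _ ≤ c / _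
      rw [le_div_iff₀ (by positivity)]; linarith [(ha j).2]
  have w0 : S.W S.finf (S.N k) x = 0 := tendsto_nhds_unique hlz.1 (hz fun j => by
    have h := hX (φ j)
    have e := W_scl H.adm (hr0 (φ j)) (S.N k) (ξ (φ j))
    rw [← hξX] at e
    show _ ≤ r (φ j)^2 * S.W (scl (r (φ j)) f) _ _ ∧ r (φ j)^2 * S.W (scl (r (φ j)) f) _ _ ≤ _
    exact ⟨(h.2.2.2 0).trans e.le, e.ge.trans h.2.2.1⟩)
  have w1 : S.W S.finf (S.N k) (S.P S.finf x) = 0 := tendsto_nhds_unique hlz2.1 (hz fun j => by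
    have h := CC_P H.adm hk (hX (φ j))
    have e := W_scl H.adm (hr0 (φ j)) (S.N k) (S.P (scl (r (φ j)) f) (ξ (φ j)))
    rw [← P_scl H.adm (hr0 (φ j)), ← hξX] at e
    show _ ≤ r (φ j)^2 * S.W (scl (r (φ j)) f) _ _ ∧ r (φ j)^2 * S.W (scl (r (φ j)) f) _ _ ≤ _
    refine ⟨(h.2.2.2 0).trans e.le, e.ge.trans h.2.2.1⟩)
  obtain ⟨u, hu, rfl⟩ := glue S.finf_adm (P_fix S.finf_adm hk hper (by rw [w0, w1]))
  obtain ⟨-, hu0, hum⟩ := hu.facts S.finf_adm hk hper (fun i => (hx i trivial).1)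
  have hu00 := H.ap' u hu hu0 hum
  have hsum : Tendsto (fun j => ∑ i ∈ Finset.range (S.N k), ξ (φ j) i) atTop
      (𝓝 (∑ i ∈ Finset.range (S.N k), S.nd u i)) := tendsto_finset_sum _ fun i _ => hlim' i
  have h1 : ∀ j, ∑ i ∈ Finset.range (S.N k), ξ j i = 1 := fun j => by
    simp only [ξ]; rw [← Finset.sum_div]; exact div_self (hr0 j).ne'
  simp only [h1] at hsum
  have := tendsto_nhds_unique hsum tendsto_const_nhds
  simp [nd, hu00] at this

lemma Ctx.CC_compact (H : S.Ctx f f' R) {k : ℕ} (hk : 0 < k) (A c : ℝ) : IsCompact (S.CC f k A c) := by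
  obtain ⟨ρ, hρ⟩ := H.CC_bdd hk A c
  exact (isCompact_univ_pi fun _ : ℤ => isCompact_Icc (a := (0:ℝ)) (b := ρ)).of_isClosed_subset
    (CC_closed H.adm k A c) fun x hx i _ => ⟨hx.2.1 i, hρ x hx i⟩

/-- a minimizer on an invariant closed subset is a solution -/
lemma Ctx.exists_fix (H : S.Ctx f f' R) {k : ℕ} (hk : 0 < k) {A c : ℝ} {K : Set (ℤ → ℝ)} (hK : IsClosed K)
    (hKC : K ⊆ S.CC f k A c) (hne : K.Nonempty) (hP : ∀ x ∈ K, S.P f x ∈ K) :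
    ∃ u, S.GSol f u ∧ S.nd u ∈ K ∧ ∀ y ∈ K, S.W f (S.N k) (S.nd u) ≤ S.W f (S.N k) y := by
  obtain ⟨x, hx, hm⟩ := ((H.CC_compact hk A c).of_isClosed_subset hK hKC).exists_isMinOn hne
    (W_cont H.adm (S.N k)).continuousOn
  obtain ⟨u, hu, rfl⟩ := glue H.adm (P_fix H.adm hk (hKC hx).1 (hm (hP x hx)))
  exact ⟨u, hu, hx, fun y hy => hm hy⟩

end Setup
end SH

namespace SH
open Topology
namespace Setup
variable {S : Setup} {f f' : ℝ → ℝ} {R : ℝ}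

lemma Ctx.nn (H : S.Ctx f f' R) (s : ℝ) : 0 ≤ f s := by
  rcases le_or_gt s 0 with h | h
  · exact (H.npos s h).ge
  · exact (H.pos s h).le

lemma Ctx.d0 (H : S.Ctx f f' R) : f' 0 = 0 := by
  have h1 := (H.hd 0).hasDerivWithinAt (s := Iic 0)
  have h2 : HasDerivWithinAt f 0 (Iic 0) 0 := (hasDerivWithinAt_const (0:ℝ) (Iic 0) (0:ℝ)).congr
    (fun y hy => H.npos y hy) (H.npos 0 le_rfl)
  exact (uniqueDiffOn_Iic (0:ℝ) 0 self_mem_Iic).eq_deriv _ h1 h2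

lemma Ctx.dnn (H : S.Ctx f f' R) {s : ℝ} (hs : 0 ≤ s) : 0 ≤ f' s := H.d0 ▸ H.mono hs

lemma Ctx.fmono (H : S.Ctx f f' R) : Monotone f := by
  have h1 : MonotoneOn f (Ici 0) := monotoneOn_of_deriv_nonneg (convex_Ici 0)
    (fun s _ => (H.hd s).continuousAt.continuousWithinAt) (fun s _ => (H.hd s).differentiableAt.differentiableWithinAt)
    (fun s hs => by rw [(H.hd s).deriv]; exact H.dnn (interior_subset hs))
  intro s t hst
  rcases le_or_gt s 0 with h | h
  · rw [H.npos s h]; exact H.nn t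
  · exact h1 h.le (h.le.trans hst) hst

lemma Ctx.Fmono (H : S.Ctx f f' R) : Monotone (prim f) :=
  monotone_of_hasDerivAt_nonneg (f' := f) (fun s => prim_deriv H.adm.cont s) (fun s => H.nn s)

lemma prim_zero (f : ℝ → ℝ) : prim f 0 = 0 := intervalIntegral.integral_same

lemma Ctx.Fpos (H : S.Ctx f f' R) {s : ℝ} (hs : 0 < s) : 0 < prim f s :=
  intervalIntegral.intervalIntegral_pos_of_pos_on (H.adm.cont.intervalIntegrable _ _)
    (fun x hx => H.pos x hx.1) hs

lemma Ctx.Fle (H : S.Ctx f f' R) {s t : ℝ} (h : t ≤ s) : prim f s - prim f t ≤ f s * (s - t) := by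
  have h1 : MonotoneOn (fun x => f s * x - prim f x) (Iic s) := by
    have hd : ∀ x, HasDerivAt (fun x => f s * x - prim f x) (f s - f x) x := fun x => by
      simpa using ((hasDerivAt_id x).const_mul (f s)).fun_sub (prim_deriv H.adm.cont x)
    refine monotoneOn_of_deriv_nonneg (convex_Iic _) (fun x _ => (hd x).continuousAt.continuousWithinAt)
      (fun x _ => (hd x).differentiableAt.differentiableWithinAt) fun x hx => ?_
    rw [(hd x).deriv]
    linarith [H.fmono (interior_subset hx : x ∈ Iic s)]
  have := h1 (show t ∈ Iic s from h) self_mem_Iic h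
  simp only at this; linarith

lemma Ctx.fsq (H : S.Ctx f f' R) {s : ℝ} (hs : 0 ≤ s) : f s ^ 2 ≤ 2 * f' s * prim f s := by
  have h : AntitoneOn (fun x => f x ^2 - 2 * f' s * prim f x) (Icc 0 s) := by
    have hd : ∀ x, HasDerivAt (fun x => f x ^2 - 2 * f' s * prim f x) (2 * f x * f' x - 2 * f' s * f x) x := fun x => by
      have := ((H.hd x).fun_pow 2).fun_sub ((prim_deriv H.adm.cont x).const_mul (2 * f' s))
      simpa using this
    refine antitoneOn_of_deriv_nonpos (convex_Icc _ _) (fun x _ => (hd x).continuousAt.continuousWithinAt)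
      (fun x _ => (hd x).differentiableAt.differentiableWithinAt) fun x hx => ?_
    rw [(hd x).deriv]
    have hx' := interior_subset hx
    nlinarith [mul_le_mul_of_nonneg_left (H.mono hx'.2) (H.nn x)]
  have := h ⟨le_rfl, hs⟩ ⟨hs, le_rfl⟩ hs
  simp only [prim_zero, H.adm.2] at this
  linarith

/-- mountain pass estimate -/
lemma Ctx.mp (H : S.Ctx f f' R) {s1 : ℝ} (hs1 : 4 * S.T * S.B^2 * f' (2 * s1) ≤ -(∫ t in (0:ℝ)..S.T, S.q t) / 2)
    {x : ℤ → ℝ} (hx0 : ∀ i, 0 ≤ x i) (hxs : ∀ i, x i ≤ s1) (hp : S.Per 1 x) (i : ℤ) :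
    -(∫ t in (0:ℝ)..S.T, S.q t) / 2 * prim f (x i) ≤ S.W f (S.N 1) x := by
  have hh := S.h_pos; have hh2 := S.two_h; have hT := S.hT; have hB := S.hB0
  have hN : 0 < S.N 1 := by unfold N; have := S.hn; positivity
  have hNT : (S.N 1 : ℝ) * S.h = S.T := by rw [N_h]; simp
  let u : ℕ → ℝ → ℝ := fun l => S.pc f x l
  have hu : ∀ l : ℕ, S.SolOn f (l * S.h) ((l+1) * S.h) (u l) ∧ u l (l * S.h) = x l ∧ u l ((l+1) * S.h) = x (l+1) :=
    fun l => by simpa using pc_spec H.adm x l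
  let I : ℕ → Set ℝ := fun l => Icc ((l:ℝ) * S.h) ((l+1) * S.h)
  have hIl : ∀ l : ℕ, (l:ℝ) * S.h ∈ I l := fun l => ⟨le_rfl, by linarith⟩
  have hIr : ∀ l : ℕ, ((l:ℝ)+1) * S.h ∈ I l := fun l => ⟨by linarith, le_rfl⟩
  have hs10 : 0 ≤ s1 := (hx0 0).trans (hxs 0)
  have hub : ∀ l, ∀ t ∈ I l, u l t ≤ 2 * s1 := by
    intro l t ht
    have := stab (ε := 0) (δ := s1) H.adm H.adm (by simp) (hu l).1 ((zero_sol H.adm).on _ _) (by linarith)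
      (by linarith) (by rw [(hu l).2.1, sub_zero, abs_of_nonneg (hx0 _)]; exact hxs _)
      (by rw [(hu l).2.2, sub_zero, abs_of_nonneg (hx0 _)]; exact hxs _) t ht
    have := (le_abs_self _).trans this
    linarith
  choose c hc hcm using fun l => isCompact_Icc.exists_isMaxOn ⟨_, hIl l⟩ (hu l).1.1.cont.continuousOn
  obtain ⟨l0, hl0, hm⟩ := Finset.exists_max_image (Finset.range (S.N 1)) (fun l => u l (c l)) ⟨0, Finset.mem_range.2 hN⟩
  set σ := u l0 (c l0) with hσ
  have hσm : ∀ l < S.N 1, ∀ t ∈ I l, u l t ≤ σ := fun l hl t ht =>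
    (hcm l ht).trans (hm l (Finset.mem_range.2 hl))
  have hσ1 : σ ≤ 2 * s1 := hub _ _ (hc l0)
  have hxσ : x i ≤ σ := Per.all Nat.one_pos hp hp (fun a _ => a ≤ σ) (fun j hj => by
    have := hσm j hj _ (hIl j); rwa [(hu j).2.1] at this) i
  have hσ0 : 0 ≤ σ := (hx0 i).trans hxσ
  let E : ℕ → ℝ := fun l => ∫ t in ((l:ℝ) * S.h)..((l+1) * S.h), (deriv (u l) t)^2
  have hE0 : ∀ l, 0 ≤ E l := fun l => intervalIntegral.integral_nonneg (by linarith) fun s _ => sq_nonneg _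
  let a : ℕ → ℝ := fun l => Real.sqrt (S.h * E l)
  have ha0 : ∀ l, 0 ≤ a l := fun l => Real.sqrt_nonneg _
  have ha : ∀ l, ∀ t ∈ I l, |u l t - x l| ≤ a l := by
    intro l t ht
    have := cs (hu l).1.1 (hIl l) ht
    rw [(hu l).2.1] at this
    apply Real.abs_le_sqrt
    convert this using 2; ring
  set O := ∑ l ∈ Finset.range (S.N 1), a l with hO
  have hO0 : 0 ≤ O := Finset.sum_nonneg fun l _ => ha0 l
  have hx0' : ∀ l : ℕ, |x l - x 0| ≤ ∑ j ∈ Finset.range l, a j := by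
    intro l
    induction l with
    | zero => simp
    | succ l ih =>
      rw [Finset.sum_range_succ]
      have h1 := ha l _ (hIr l)
      rw [(hu l).2.2] at h1
      push_cast
      have : |x (l+1) - x 0| ≤ |x (l+1) - x l| + |x l - x 0| := abs_sub_le _ _ _
      linarith
  have hosc0 : ∀ l < S.N 1, ∀ t ∈ I l, |u l t - x 0| ≤ O := by
    intro l hl t ht
    have h1 := ha l t ht
    have h2 := hx0' l
    have h3 : ∑ j ∈ Finset.range (l+1), a j ≤ O :=
      Finset.sum_le_sum_of_subset_of_nonneg (Finset.range_subset_range.2 hl) fun j _ _ => ha0 j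
    rw [Finset.sum_range_succ] at h3
    have : |u l t - x 0| ≤ |u l t - x l| + |x l - x 0| := abs_sub_le _ _ _
    linarith
  have hosc : ∀ l < S.N 1, ∀ t ∈ I l, σ - u l t ≤ 2 * O := by
    intro l hl t ht
    have h1 := abs_le.1 (hosc0 l hl t ht)
    have h2 := abs_le.1 (hosc0 l0 (Finset.mem_range.1 hl0) _ (hc l0))
    linarith [h1.1, h2.2]
  have hO2 : O^2 ≤ S.T * ∑ l ∈ Finset.range (S.N 1), E l := by
    have := sq_sum_le_card_mul_sum_sq (s := Finset.range (S.N 1)) (f := a)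
    rw [Finset.card_range] at this
    refine this.trans ?_
    have h2 : ∑ l ∈ Finset.range (S.N 1), a l ^2 = S.h * ∑ l ∈ Finset.range (S.N 1), E l := by
      rw [Finset.mul_sum]
      exact Finset.sum_congr rfl fun l _ => Real.sq_sqrt (mul_nonneg hh.le (hE0 l))
    rw [h2, ← mul_assoc, hNT]
  have hfσ := H.nn σ
  have hJ : ∀ l ∈ Finset.range (S.N 1), E l / 2 - prim f σ * (∫ t in ((l:ℝ) * S.h)..((l+1) * S.h), S.q t)
      - f σ * (2 * O) * (∫ t in ((l:ℝ) * S.h)..((l+1) * S.h), |S.q t|) ≤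
      S.J f (((l:ℤ):ℝ) * S.h) ((((l:ℤ):ℝ)+1) * S.h) (S.pc f x l) := by
    intro l hl
    have hl := Finset.mem_range.1 hl
    rw [Int.cast_natCast]
    have hcF := (prim_cont H.adm.cont).comp (hu l).1.1.cont
    have hd2 : Continuous fun t => (deriv (u l) t)^2 := (hu l).1.1.2.pow 2
    have hab : (l:ℝ) * S.h ≤ (l+1) * S.h := by linarith
    have e : E l / 2 - prim f σ * (∫ t in ((l:ℝ) * S.h)..((l+1) * S.h), S.q t)
      - f σ * (2 * O) * (∫ t in ((l:ℝ) * S.h)..((l+1) * S.h), |S.q t|) =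
      ∫ t in ((l:ℝ) * S.h)..((l+1) * S.h), ((deriv (u l) t)^2 / 2 - prim f σ * S.q t - f σ * (2 * O) * |S.q t|) := by
      rw [intervalIntegral.integral_sub (((hd2.div_const 2).intervalIntegrable _ _).sub ((S.qint _ _).const_mul _))
        ((S.qint _ _).abs.const_mul _), intervalIntegral.integral_sub ((hd2.div_const 2).intervalIntegrable _ _)
        ((S.qint _ _).const_mul _)]
      simp only [intervalIntegral.integral_div, intervalIntegral.integral_const_mul, Pi.pow_apply, E]
    rw [e]
    refine intervalIntegral.integral_mono_on hab ((((hd2.div_const 2).intervalIntegrable _ _).sub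
      ((S.qint _ _).const_mul _)).sub ((S.qint _ _).abs.const_mul _)) (Jint H.adm.cont (hu l).1.1 _ _) fun t ht => ?_
    have h1 : prim f σ - prim f (u l t) ≤ f σ * (2 * O) := (H.Fle (hσm l hl t ht)).trans
      (mul_le_mul_of_nonneg_left (hosc l hl t ht) hfσ)
    have h2 : 0 ≤ prim f σ - prim f (u l t) := by linarith [H.Fmono (hσm l hl t ht)]
    have h3 : |S.q t * (prim f σ - prim f (u l t))| ≤ |S.q t| * (f σ * (2 * O)) := by
      rw [abs_mul, abs_of_nonneg h2]; exact mul_le_mul_of_nonneg_left h1 (abs_nonneg _)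
    have := (abs_le.1 h3).1
    show _ ≤ (deriv (u l) t)^2 / 2 - S.q t * prim f (u l t)
    linarith
  have hsum : ∀ r : ℝ → ℝ, (∀ a b, IntervalIntegrable r volume a b) →
      ∑ l ∈ Finset.range (S.N 1), ∫ t in ((l:ℝ) * S.h)..((l+1) * S.h), r t = ∫ t in (0:ℝ)..S.T, r t := by
    intro r hr
    have := intervalIntegral.sum_integral_adjacent_intervals (f := r) (μ := volume)
      (a := fun l : ℕ => (l:ℝ) * S.h) (n := S.N 1) (fun l _ => hr _ _)
    simp only [hNT] at this
    simpa using this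
  have hW := Finset.sum_le_sum hJ
  rw [Finset.sum_sub_distrib, Finset.sum_sub_distrib, ← Finset.mul_sum, ← Finset.mul_sum, ← Finset.sum_div,
    hsum _ S.qint, hsum _ (fun a b => (S.qint a b).abs)] at hW
  change _ ≤ S.W f (S.N 1) x at hW
  set EE := ∑ l ∈ Finset.range (S.N 1), E l
  have hBb := S.hB 0 S.T hT.le (by linarith)
  have hB2 : f σ * (2 * O) * (∫ t in (0:ℝ)..S.T, |S.q t|) ≤ f σ * (2 * O) * S.B := by gcongr
  have h1 : 0 ≤ EE / 2 - 2 * O * f σ * S.B + 2 * S.T * S.B^2 * f σ ^2 := by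
    have : 0 ≤ (O - 2 * S.T * S.B * f σ)^2 := sq_nonneg _
    have h3 : 0 ≤ S.T * (EE / 2 - 2 * O * f σ * S.B + 2 * S.T * S.B^2 * f σ ^2) := by nlinarith
    exact nonneg_of_mul_nonneg_right h3 hT
  have h2 := H.fsq hσ0
  have hF0 : 0 ≤ prim f σ := by have := H.Fmono hσ0; rwa [prim_zero] at this
  have h3 : 2 * S.T * S.B^2 * f σ^2 ≤ 2 * S.T * S.B^2 * (2 * f' σ * prim f σ) := by gcongr
  have h4 : 4 * S.T * S.B^2 * f' σ * prim f σ ≤ -(∫ t in (0:ℝ)..S.T, S.q t) / 2 * prim f σ := by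
    refine mul_le_mul_of_nonneg_right (le_trans ?_ hs1) hF0
    exact mul_le_mul_of_nonneg_left (H.mono hσ1) (by positivity)
  have h5 : -(∫ t in (0:ℝ)..S.T, S.q t) / 2 * prim f (x i) ≤ -(∫ t in (0:ℝ)..S.T, S.q t) / 2 * prim f σ :=
    mul_le_mul_of_nonneg_left (H.Fmono hxσ) (by linarith [H.mean])
  nlinarith

lemma exists_mid {X : Type*} [TopologicalSpace X] {γ : ℝ → X} (hγ : Continuous γ) {a b : ℝ} (hab : a ≤ b)
    {A B : Set X} (hA : IsOpen A) (hB : IsOpen B) (hd : ∀ τ ∈ Icc a b, γ τ ∈ A → γ τ ∉ B)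
    (ha : γ a ∈ A) (hb : γ b ∈ B) : ∃ τ ∈ Icc a b, γ τ ∉ A ∧ γ τ ∉ B := by
  by_contra hcon
  push Not at hcon
  obtain ⟨τ, h1, h2, h3⟩ := isPreconnected_Icc (a := a) (b := b) _ _ (hA.preimage hγ) (hB.preimage hγ)
    (fun τ hτ => by
      by_cases h : γ τ ∈ A
      · exact Or.inl h
      · exact Or.inr (hcon τ hτ h)) ⟨a, ⟨le_rfl, hab⟩, ha⟩ ⟨b, ⟨hab, le_rfl⟩, hb⟩
  exact hd τ h1 h2 h3

lemma W_iter (hf : S.Adm f) {k : ℕ} (hk : 0 < k) {x : ℤ → ℝ} (hx : S.Per k x) :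
    (∀ n, S.Per k ((S.P f)^[n] x)) ∧ Antitone fun n => S.W f (S.N k) ((S.P f)^[n] x) := by
  have h : ∀ n, S.Per k ((S.P f)^[n] x) := fun n => by
    induction n with
    | zero => exact hx
    | succ n ih => rw [Function.iterate_succ_apply']; exact ih.P hf
  refine ⟨h, antitone_nat_of_succ_le fun n => ?_⟩
  rw [Function.iterate_succ_apply']; exact W_P hf hk (h n)

lemma iter_nonneg (hf : S.Adm f) {x : ℤ → ℝ} (hx : ∀ i, 0 ≤ x i) (n : ℕ) : ∀ i, 0 ≤ (S.P f)^[n] x i := by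
  induction n with
  | zero => exact hx
  | succ n ih => rw [Function.iterate_succ_apply']; exact P_nonneg hf ih

lemma inv_iter {D : Set (ℤ → ℝ)} (hD : ∀ x ∈ D, S.P f x ∈ D) {x : ℤ → ℝ} {n m : ℕ} (hnm : n ≤ m)
    (h : (S.P f)^[n] x ∈ D) : (S.P f)^[m] x ∈ D := by
  induction m, hnm using Nat.le_induction with
  | base => exact h
  | succ m _ ih => rw [Function.iterate_succ_apply']; exact hD _ ih

/-- sufficiently negative energy by scaling -/
lemma Ctx.neg_top (H : S.Ctx f f' R) : ∃ x, S.Per 1 x ∧ (∀ i, 0 ≤ x i) ∧ S.W f (S.N 1) x < -1 := by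
  obtain ⟨φ, hφ, hφp, hφ0, hφJ⟩ := H.bump
  have hNT : (S.N 1 : ℝ) * S.h = S.T := by rw [N_h]; simp
  have hw : S.W S.finf (S.N 1) (S.nd φ) < 0 := by
    have := W_nodes_le S.finf_adm hφ (S.N 1)
    rw [hNT] at this; linarith
  have hr : Tendsto (fun j : ℕ => (j:ℝ) + 1) atTop atTop :=
    tendsto_atTop_add_const_right _ _ tendsto_natCast_atTop_atTop
  have h1 := (H.lim_zero hr (fun j => by positivity) (ξ := fun _ => S.nd φ) (fun i => tendsto_const_nhds) (S.N 1)).1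
  have h2 := ((tendsto_pow_atTop two_ne_zero).comp hr).atTop_mul_neg hw h1
  obtain ⟨j, hj⟩ := (h2.eventually_lt_atBot (-1)).exists
  have hj0 : (0:ℝ) < j + 1 := by positivity
  refine ⟨fun i => (j+1) * S.nd φ i, ?_, fun i => mul_nonneg hj0.le (hφ0 _), ?_⟩
  · unfold Per sh
    funext i
    show _ * φ _ = _ * φ _
    rw [node_shift]
    simp only [Nat.cast_one, Int.cast_one, one_mul]
    rw [hφp]
  · rw [W_scl H.adm hj0]; exact hj

theorem Ctx.exists_star (H : S.Ctx f f' R) :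
    ∃ u, S.GSol f u ∧ (∀ t, 0 < u t) ∧ (∀ t, u t < R) ∧ Function.Periodic u S.T := by
  set m := -(∫ t in (0:ℝ)..S.T, S.q t) with hm
  have hm0 : 0 < m := by have := H.mean; linarith
  obtain ⟨s1, hs1, hs10⟩ : ∃ s1, 4 * S.T * S.B^2 * f' (2 * s1) ≤ m / 2 ∧ 0 < s1 := by
    have hc : Continuous fun s => 4 * S.T * S.B^2 * f' (2 * s) := by have := H.cd; fun_prop
    have : ∀ᶠ s in 𝓝 (0:ℝ), 4 * S.T * S.B^2 * f' (2 * s) < m / 2 := (hc.tendsto 0).eventually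
      (gt_mem_nhds (by simp [H.d0, hm0]))
    obtain ⟨s, h, h'⟩ := ((this.filter_mono nhdsWithin_le_nhds).and
      (self_mem_nhdsWithin : ∀ᶠ δ in 𝓝[>] (0:ℝ), δ ∈ Ioi 0)).exists
    exact ⟨s, h.le, h'⟩
  set s := s1 / 4 with hs
  have hs0 : 0 < s := by positivity
  let D : Set (ℤ → ℝ) := {x | (∀ j ∈ Finset.range (S.N 1), x (j:ℤ) < s) ∧ S.W f (S.N 1) x < m / 2 * prim f s}
  have hDo : IsOpen D := by
    have : {x : ℤ → ℝ | ∀ j ∈ Finset.range (S.N 1), x (j:ℤ) < s} = ⋂ j ∈ Finset.range (S.N 1), {x | x (j:ℤ) < s} := by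
      ext; simp
    have h1 : IsOpen {x : ℤ → ℝ | ∀ j ∈ Finset.range (S.N 1), x (j:ℤ) < s} := by
      rw [this]; exact isOpen_biInter_finset fun j _ => isOpen_lt (continuous_apply _) continuous_const
    exact h1.inter (isOpen_lt (W_cont H.adm _) continuous_const)
  let G : Set (ℤ → ℝ) := {x | S.Per 1 x ∧ ∀ i, 0 ≤ x i}
  have hG : ∀ x ∈ G, S.P f x ∈ G := fun x hx => ⟨hx.1.P H.adm, P_nonneg H.adm hx.2⟩
  have hDall : ∀ x ∈ D ∩ G, ∀ i, x i < s := fun x hx i =>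
    Per.all Nat.one_pos hx.2.1 hx.2.1 (fun a _ => a < s) (fun j hj => hx.1.1 j (Finset.mem_range.2 hj)) i
  have hDW : ∀ x ∈ D ∩ G, 0 ≤ S.W f (S.N 1) x := fun x hx => by
    refine le_trans ?_ (H.mp hs1 hx.2.2 (fun i => (hDall x hx i).le.trans (by linarith)) hx.2.1 0)
    refine mul_nonneg (by linarith) ?_
    have := H.Fmono (hx.2.2 0); rwa [prim_zero] at this
  have hDinv : ∀ x ∈ D ∩ G, S.P f x ∈ D ∩ G := by
    intro x hx
    refine ⟨⟨fun j _ => ?_, (W_P H.adm Nat.one_pos hx.2.1).trans_lt hx.1.2⟩, hG x hx.2⟩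
    have hU : ∀ (p : ℤ) (y : ℤ → ℝ) (δ : ℝ), (∀ i, |y i| ≤ δ) → ∀ i, |S.U f p y i| ≤ 2 * δ := by
      intro p y δ hy i
      have := U_stab (ε := 0) (δ := δ) H.adm H.adm (by simp) p (x := y) (y := fun _ => 0) i (by simpa using hy _)
        (by simpa using hy _) (by simpa using hy _)
      rw [U_zero H.adm] at this
      simpa using this
    have hP := hU 0 _ _ (hU 1 x s fun i => by rw [abs_of_nonneg (hx.2.2 i)]; exact (hDall x hx i).le)
    have hle : ∀ i, S.P f x i ≤ s1 := fun i => (le_abs_self _).trans ((hP i).trans (by rw [hs]; linarith))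
    have h1 := H.mp hs1 (P_nonneg H.adm hx.2.2) hle (hx.2.1.P H.adm) j
    have h2 := (W_P H.adm Nat.one_pos hx.2.1).trans_lt hx.1.2
    by_contra hc
    push Not at hc
    have := mul_le_mul_of_nonneg_left (H.Fmono hc) (by linarith : 0 ≤ m / 2)
    linarith
  have hitG : ∀ x ∈ G, ∀ n, (S.P f)^[n] x ∈ G := fun x hx n => inv_iter hG (Nat.zero_le n) hx
  let Low : Set (ℤ → ℝ) := {x | ∃ n, (S.P f)^[n] x ∈ D}
  let High : Set (ℤ → ℝ) := {x | ∃ n, S.W f (S.N 1) ((S.P f)^[n] x) < -1}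
  have hLow : IsOpen Low := by
    simp only [Low, setOf_exists]; exact isOpen_iUnion fun n => hDo.preimage ((P_cont H.adm).iterate n)
  have hHigh : IsOpen High := by
    simp only [High, setOf_exists]
    exact isOpen_iUnion fun n => isOpen_lt ((W_cont H.adm _).comp ((P_cont H.adm).iterate n)) continuous_const
  have hdis : ∀ x ∈ G, x ∈ Low → x ∉ High := by
    rintro x hx ⟨n, hn⟩ ⟨l, hl⟩
    have h1 := inv_iter hDinv (le_max_left n l) ⟨hn, hitG x hx n⟩
    have h2 := (W_iter H.adm Nat.one_pos hx.1).2 (le_max_right n l)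
    have := hDW _ h1
    simp only at h2; linarith
  obtain ⟨x, hxp, hx0, hxW⟩ := H.neg_top
  have hz : S.W f (S.N 1) (fun _ => 0) = 0 := by
    have := W_nodes H.adm (zero_sol H.adm) (S.N 1)
    unfold nd at this
    rw [this]; unfold J; simp [prim_zero]
  have hzD : (fun _ => 0) ∈ D := ⟨fun _ _ => hs0, by rw [hz]; have := H.Fpos hs0; positivity⟩
  have hγG : ∀ τ ∈ Icc (0:ℝ) 1, (fun i => τ * x i) ∈ G := fun τ hτ => by
    refine ⟨?_, fun i => mul_nonneg hτ.1 (hx0 i)⟩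
    unfold Per sh; funext i; simp only; rw [hxp.apply]
  obtain ⟨τ, hτ, h1, h2⟩ := exists_mid (γ := fun τ : ℝ => fun i => τ * x i) (by fun_prop) zero_le_one hLow hHigh
    (fun τ hτ => hdis _ (hγG τ hτ)) ⟨0, by simpa using hzD⟩ ⟨0, by simpa using hxW⟩
  set y : ℤ → ℝ := fun i => τ * x i
  let K : Set (ℤ → ℝ) := S.CC f 1 1 (S.W f (S.N 1) y) ∩ Lowᶜ
  have hyK : y ∈ K := ⟨⟨(hγG τ hτ).1, (hγG τ hτ).2, le_rfl, fun n => by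
    by_contra hc; push Not at hc; exact h2 ⟨n, hc⟩⟩, h1⟩
  obtain ⟨u, hu, huK, -⟩ := H.exists_fix Nat.one_pos (K := K) ((CC_closed H.adm _ _ _).inter hLow.isClosed_compl)
    inter_subset_left ⟨y, hyK⟩ (fun x hx => ⟨CC_P H.adm Nat.one_pos hx.1, fun ⟨n, hn⟩ => hx.2 ⟨n+1, by
      rwa [Function.iterate_succ_apply]⟩⟩)
  obtain ⟨g1, g2, g3⟩ := hu.facts H.adm Nat.one_pos huK.1.1 huK.1.2.1
  refine ⟨u, hu, ?_, H.ap u hu g2 g3, by simpa using g1⟩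
  refine (zero_sol H.adm).lt H.adm hu g2 fun he => huK.2 ⟨0, ?_⟩
  rw [← he]; exact hzD

end Setup
end SH

namespace SH
open Topology
namespace Setup
variable {S : Setup} {f f' : ℝ → ℝ} {R : ℝ}

lemma hcg {f g : ℝ → ℝ} {a b t : ℝ} (h : HasDerivAt f a t) (e : g = f) (e' : b = a) : HasDerivAt g b t := by
  rw [e, e']; exact h

lemma Ctx.smono (H : S.Ctx f f' R) : StrictMonoOn f' (Ioo 0 R) := by
  obtain ⟨f'', h, -⟩ := H.snd
  refine strictMonoOn_of_deriv_pos (convex_Ioo _ _) H.cd.continuousOn fun s hs => ?_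
  rw [interior_Ioo] at hs
  rw [(h s hs).1.deriv]; exact (h s hs).2

lemma Ctx.y_deriv (H : S.Ctx f f' R) {u : ℝ → ℝ} (hu : S.GSol f u) (hp : ∀ t, 0 < u t) (t : ℝ) :
    HasDerivAt (fun t => deriv u t / f (u t) + ∫ s in (0:ℝ)..t, S.q s) (-f' (u t) * (deriv u t / f (u t))^2) t := by
  have hfp : ∀ t, f (u t) ≠ 0 := fun t => (H.pos _ (hp t)).ne'
  have hfu : ∀ t, HasDerivAt (fun t => f (u t)) (f' (u t) * deriv u t) t := fun t =>
    (H.hd (u t)).comp t (hu.1.1 t).hasDerivAt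
  have hφ : ∀ t, HasDerivAt (fun t => (f (u t))⁻¹) (-(f' (u t) * deriv u t) / (f (u t))^2) t := fun t =>
    (hfu t).fun_inv (hfp t)
  have hfc : Continuous fun t => f (u t) := H.adm.cont.comp hu.1.cont
  have hφ1 : C1 fun t => (f (u t))⁻¹ := C1.of hφ
    (((H.cd.comp hu.1.cont).mul hu.1.2).neg.div₀ (hfc.pow 2) fun t => pow_ne_zero 2 (hfp t))
  have h1 := nlem (S.qmul hfc) hφ1 0 t
  have h2 := ((hφ t).const_mul (deriv u 0)).fun_sub h1
  rw [(hφ t).deriv] at h2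
  refine hcg h2 ?_ ?_
  · funext s
    have e1 := hu.2 0 s
    have e2 : ∫ τ in (0:ℝ)..s, S.q τ * f (u τ) * (f (u τ))⁻¹ = ∫ τ in (0:ℝ)..s, S.q τ := by
      congr 1; funext τ; field_simp [hfp τ]
    rw [e2]
    have e3 : ∫ τ in (0:ℝ)..s, S.q τ * f (u τ) = deriv u 0 - deriv u s := by linarith
    rw [e3]; field_simp; ring
  · have e1 := hu.2 0 t
    have e3 : ∫ τ in (0:ℝ)..t, S.q τ * f (u τ) = deriv u 0 - deriv u t := by linarith
    rw [e3]; have := hfp t; field_simp; ring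

lemma Ctx.nonconst (H : S.Ctx f f' R) {u : ℝ → ℝ} (hu : S.GSol f u) (hp : ∀ t, 0 < u t) : ∃ t, deriv u t ≠ 0 := by
  by_contra hc
  push Not at hc
  have h : ∀ t, HasDerivAt (fun t => deriv u t / f (u t) + ∫ s in (0:ℝ)..t, S.q s) 0 t := fun t => by
    have := H.y_deriv hu hp t
    simpa [hc] using this
  have := is_const_of_deriv_eq_zero (fun t => (h t).differentiableAt) (fun t => (h t).deriv) 0 S.T
  simp only [hc, zero_div, zero_add, intervalIntegral.integral_same] at this
  linarith [H.mean]

lemma Ctx.G_deriv (H : S.Ctx f f' R) {s : ℝ} (hs : 0 < s) :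
    HasDerivAt (fun s => ∫ x in (1:ℝ)..s, (f x)⁻¹) (f s)⁻¹ s := by
  have hc : ContinuousOn (fun x => (f x)⁻¹) (Ioi 0) := H.adm.cont.continuousOn.inv₀ fun x hx => (H.pos x hx).ne'
  refine intervalIntegral.integral_hasDerivAt_right (ContinuousOn.intervalIntegrable (hc.mono ?_)) ?_
    (hc.continuousAt (Ioi_mem_nhds hs))
  · intro x hx
    exact lt_of_lt_of_le (lt_min one_pos hs) hx.1
  · exact hc.stronglyMeasurableAtFilter isOpen_Ioi s hs

/-- no two ordered positive periodic solutions -/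
lemma Ctx.noorder (H : S.Ctx f f' R) {u v : ℝ → ℝ} (hu : S.GSol f u) (hv : S.GSol f v) (hu0 : ∀ t, 0 < u t)
    (hvR : ∀ t, v t < R) {p : ℝ} (hp : 0 < p) (pu : Function.Periodic u p) (pv : Function.Periodic v p)
    (h : ∀ t, u t ≤ v t) : u = v := by
  by_contra hne
  have hlt := hu.lt H.adm hv h hne
  have hv0 : ∀ t, 0 < v t := fun t => (hu0 t).trans (hlt t)
  set y1 := fun t => deriv u t / f (u t) with hy1
  set y2 := fun t => deriv v t / f (v t) with hy2
  set D := fun t => y2 t - y1 t with hD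
  have hDd : ∀ t, HasDerivAt D (f' (u t) * (y1 t)^2 - f' (v t) * (y2 t)^2) t := fun t => by
    have := (H.y_deriv hv hv0 t).fun_sub (H.y_deriv hu hu0 t)
    refine hcg this ?_ ?_
    · funext s; simp only [hD, hy1, hy2]; ring
    · simp only [hy1, hy2]; ring
  let G : ℝ → ℝ := fun s => ∫ x in (1:ℝ)..s, (f x)⁻¹
  let w : ℝ → ℝ := fun t => G (v t) - G (u t)
  have hw : ∀ t, HasDerivAt w (D t) t := fun t => by
    have h1 := HasDerivAt.comp t (H.G_deriv (hv0 t)) (hv.1.1 t).hasDerivAt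
    have h2 := HasDerivAt.comp t (H.G_deriv (hu0 t)) (hu.1.1 t).hasDerivAt
    refine hcg (h1.fun_sub h2) rfl ?_
    simp only [hD, hy1, hy2]; ring
  have hwc : Continuous w := continuous_iff_continuousAt.2 fun t => (hw t).continuousAt
  have hwp : Function.Periodic w p := fun t => by simp only [w, pu t, pv t]
  obtain ⟨c, hc⟩ := per_max hwc hp hwp
  have hz : ∀ n : ℤ, D (c + n * p) = 0 := fun n => by
    refine IsLocalMax.hasDerivAt_eq_zero (f := w) (Eventually.of_forall fun t => ?_) (hw _)
    rw [hwp.int_mul n c]; exact hc t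
  have cy1 : Continuous y1 := hu.1.2.div₀ (H.adm.cont.comp hu.1.cont) fun t => (H.pos _ (hu0 t)).ne'
  have cy2 : Continuous y2 := hv.1.2.div₀ (H.adm.cont.comp hv.1.cont) fun t => (H.pos _ (hv0 t)).ne'
  let a : ℝ → ℝ := fun t => f' (v t) * (y1 t + y2 t)
  have ca : Continuous a := (H.cd.comp hv.1.cont).mul (cy1.add cy2)
  let A : ℝ → ℝ := fun t => ∫ s in (0:ℝ)..t, a s
  have hA : ∀ t, HasDerivAt A (a t) t := fun t => intervalIntegral.integral_hasDerivAt_right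
    (ca.intervalIntegrable _ _) ca.stronglyMeasurable.stronglyMeasurableAtFilter ca.continuousAt
  have hE : ∀ t, HasDerivAt (fun t => Real.exp (A t) * D t) (Real.exp (A t) * ((f' (u t) - f' (v t)) * (y1 t)^2)) t := fun t => by
    refine hcg ((hA t).exp.fun_mul (hDd t)) rfl ?_
    simp only [a, hD]; ring
  have hanti : Antitone fun t => Real.exp (A t) * D t := by
    refine antitone_of_hasDerivAt_nonpos hE fun t => ?_
    have h1 := H.mono (h t)
    exact mul_nonpos_of_nonneg_of_nonpos (Real.exp_pos _).le (mul_nonpos_of_nonpos_of_nonneg (by linarith) (sq_nonneg _))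
  have hDn : ∀ t, D t ≤ 0 := fun t => by
    obtain ⟨n, hn⟩ := exists_int_lt ((t - c) / p)
    rw [lt_div_iff₀ hp] at hn
    have := hanti (show c + n * p ≤ t by linarith)
    simp only [hz, mul_zero] at this
    by_contra hc
    push Not at hc
    have := mul_pos (Real.exp_pos (A t)) hc
    linarith
  have hwa : Antitone w := antitone_of_hasDerivAt_nonpos hw hDn
  have hwconst : ∀ t, w t = w c := fun t => by
    refine le_antisymm (hc t) ?_
    obtain ⟨n, hn⟩ := exists_int_gt ((t - c) / p)
    rw [div_lt_iff₀ hp] at hn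
    rw [← hwp.int_mul n c]
    exact hwa (by linarith)
  have hD0 : ∀ t, D t = 0 := fun t => (hw t).unique (by
    have : w = fun _ => w c := funext hwconst
    rw [this]; exact hasDerivAt_const _ _)
  obtain ⟨t, ht⟩ := H.nonconst hu hu0
  have h1 : f' (u t) * (y1 t)^2 - f' (v t) * (y2 t)^2 = 0 := (hDd t).unique (by
    have : D = fun _ => 0 := funext hD0
    rw [this]; exact hasDerivAt_const _ _)
  have h2 : y2 t = y1 t := by have := hD0 t; simp only [hD] at this; linarith
  have h3 : 0 < (y1 t)^2 := by
    have : y1 t ≠ 0 := div_ne_zero ht (H.pos _ (hu0 t)).ne'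
    positivity
  have h4 := H.smono ⟨hu0 t, (hlt t).trans (hvR t)⟩ ⟨hv0 t, hvR t⟩ (hlt t)
  rw [h2] at h1
  nlinarith

end Setup
end SH

namespace SH
open Topology
namespace Setup
variable {S : Setup} {f f' : ℝ → ℝ} {R : ℝ}

lemma Ctx.taylor2 (H : S.Ctx f f' R) {a b ρ : ℝ} (h : ∀ x ∈ uIcc a b, |f' x - f' a| ≤ ρ) :
    |prim f b - prim f a - f a * (b - a) - f' a * (b - a)^2 / 2| ≤ ρ * (b - a)^2 := by
  have hd1 : ∀ x, HasDerivAt (fun x => f x - f a - f' a * (x - a)) (f' x - f' a) x := fun x => by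
    refine hcg (((H.hd x).sub_const (f a)).fun_sub (((hasDerivAt_id x).sub_const a).const_mul (f' a))) rfl (by ring)
  have hd2 : ∀ x, HasDerivAt (fun x => prim f x - prim f a - f a * (x - a) - f' a * (x - a)^2 / 2)
      (f x - f a - f' a * (x - a)) x := fun x => by
    have h1 := ((prim_deriv H.adm.cont x).sub_const (prim f a)).fun_sub (((hasDerivAt_id x).sub_const a).const_mul (f a))
    have h2 := (((((hasDerivAt_id x).sub_const a).fun_pow 2).const_mul (f' a)).div_const 2)
    refine hcg (h1.fun_sub h2) rfl ?_
    simp; ring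
  have hρ : 0 ≤ ρ := (abs_nonneg _).trans (h a left_mem_uIcc)
  have b1 : ∀ x ∈ uIcc a b, |f x - f a - f' a * (x - a)| ≤ ρ * |b - a| := fun x hx => by
    have := (convex_uIcc a b).norm_image_sub_le_of_norm_hasDerivWithin_le (fun y _ => (hd1 y).hasDerivWithinAt) h
      left_mem_uIcc hx
    simp only [sub_self, mul_zero, sub_zero, Real.norm_eq_abs] at this
    exact this.trans (mul_le_mul_of_nonneg_left (abs_sub_left_of_mem_uIcc hx) hρ)
  have := (convex_uIcc a b).norm_image_sub_le_of_norm_hasDerivWithin_le (fun y _ => (hd2 y).hasDerivWithinAt) b1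
      left_mem_uIcc right_mem_uIcc
  simp only [sub_self, mul_zero, sub_zero, Real.norm_eq_abs] at this
  norm_num at this
  refine this.trans (le_of_eq ?_)
  rw [mul_assoc, abs_mul_abs_self]; ring

lemma Ctx.quad (H : S.Ctx f f' R) {f'' : ℝ → ℝ} (h2 : ∀ s ∈ Ioo 0 R, HasDerivAt f' (f'' s) s)
    (hc : ContinuousOn f'' (Ioo 0 R)) {u : ℝ → ℝ} (hu : S.GSol f u) (hu0 : ∀ t, u t ∈ Ioo 0 R) {χ χ' : ℝ → ℝ}
    (hχ : ∀ t, HasDerivAt χ (χ' t) t) (cχ' : Continuous χ') {p : ℝ} (hp : 0 ≤ p) (e1 : u p = u 0)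
    (e2 : deriv u p = deriv u 0) (e3 : χ p = χ 0) :
    (∫ t in (0:ℝ)..p, (χ' t * f (u t) + χ t * (f' (u t) * deriv u t))^2) -
      (∫ t in (0:ℝ)..p, S.q t * (f' (u t) * (χ t * f (u t))^2)) =
    (∫ t in (0:ℝ)..p, (χ' t * f (u t))^2) - ∫ t in (0:ℝ)..p, (χ t)^2 * (f'' (u t) * f (u t) * (deriv u t)^2) := by
  have cu := hu.1.cont; have cu' := hu.1.2
  have cχ : Continuous χ := continuous_iff_continuousAt.2 fun t => (hχ t).continuousAt
  have cf := H.adm.cont; have cf' := H.cd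
  obtain ⟨F2, hF2, cF2⟩ : ∃ F2 : ℝ → ℝ, (∀ t, f'' (u t) = F2 t) ∧ Continuous F2 :=
    ⟨_, fun _ => rfl, hc.comp_continuous cu hu0⟩
  simp only [hF2]
  let Θ' : ℝ → ℝ := fun t => 2 * χ t * χ' t * (f' (u t) * f (u t)) +
    (χ t)^2 * (F2 t * deriv u t * f (u t) + f' (u t) * (f' (u t) * deriv u t))
  have hΘ : ∀ t, HasDerivAt (fun t => (χ t)^2 * (f' (u t) * f (u t))) (Θ' t) t := fun t => by
    have h1 := (h2 (u t) (hu0 t)).comp t (hu.1.1 t).hasDerivAt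
    have h3 := (H.hd (u t)).comp t (hu.1.1 t).hasDerivAt
    refine hcg (((hχ t).fun_pow 2).fun_mul (h1.fun_mul h3)) rfl ?_
    simp [Θ', hF2]
  have cΘ : Continuous Θ' := by simp only [Θ']; fun_prop
  have h3 := ibp H.adm (hu.on 0 p) hp (C1.of hΘ cΘ)
  rw [deriv_eq_of hΘ] at h3
  have e4 : (∫ t in (0:ℝ)..p, S.q t * (f' (u t) * (χ t * f (u t))^2)) = ∫ t in (0:ℝ)..p, deriv u t * Θ' t := by
    rw [h3, e1, e2, e3, sub_self, zero_add]
    congr 1; funext t; ring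
  rw [e4, ← intervalIntegral.integral_sub, ← intervalIntegral.integral_sub]
  · congr 1; funext t; simp only [Θ']; ring
  all_goals apply Continuous.intervalIntegrable; fun_prop

noncomputable def fam (S : Setup) (f u : ℝ → ℝ) (k : ℕ) (ε θ s : ℝ) : ℝ → ℝ := fun t =>
  u t + ε * ((Real.cos (2 * Real.pi / (k * S.T) * t - θ) + s) * f (u t))

lemma cos_ge {x : ℝ} (h : |x| ≤ 1) : 1/2 ≤ Real.cos x := by
  have := Real.one_sub_sq_div_two_le_cos (x := x)
  have := (sq_le_one_iff_abs_le_one x).2 h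
  linarith

lemma sqq {x : ℝ} (h : 1/2 ≤ |x|) : 1/4 ≤ x^2 := by
  rw [← sq_abs]; nlinarith

lemma per_deriv {u : ℝ → ℝ} (hu : C1 u) {p : ℝ} (h : Function.Periodic u p) (t : ℝ) : deriv u (t + p) = deriv u t := by
  rw [← (C1.shift hu p).2 t]; congr 1; funext s; exact h s

set_option maxHeartbeats 1000000 in
theorem Ctx.fam_energy (H : S.Ctx f f' R) {u : ℝ → ℝ} (hu : S.GSol f u) (hu0 : ∀ t, 0 < u t) (huR : ∀ t, u t < R)
    (pu : Function.Periodic u S.T) : ∃ k0 : ℕ, 10 ≤ k0 ∧ ∀ k ≥ k0, ∃ ε > 0, ∃ c1 < S.W f (S.N k) (S.nd u),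
      ∀ θ ∈ Icc 0 (2 * Real.pi / k), ∀ s ∈ Icc (-1:ℝ) 1, C1 (S.fam f u k ε θ s) ∧ (∀ t, 0 ≤ S.fam f u k ε θ s t) ∧
        S.W f (S.N k) (S.nd (S.fam f u k ε θ s)) ≤ c1 := by
  obtain ⟨f'', h2, cf''⟩ := H.snd
  have hT := S.hT; have hL := S.hL; have hπ := Real.pi_pos
  have hI : ∀ t, u t ∈ Ioo 0 R := fun t => ⟨hu0 t, huR t⟩
  have hR : 0 < R := (hu0 0).trans (huR 0)
  set κ : ℝ → ℝ := fun t => f'' (u t) * f (u t) * (deriv u t)^2 with hκ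
  have cf : Continuous fun t => f (u t) := H.adm.cont.comp hu.1.cont
  have cfu' : Continuous fun t => f' (u t) := H.cd.comp hu.1.cont
  have cu' := hu.1.2
  have cκ : Continuous κ := ((cf''.comp_continuous hu.1.cont hI).mul cf).mul (hu.1.2.pow 2)
  have κ0 : ∀ t, 0 ≤ κ t := fun t => mul_nonneg (mul_nonneg (h2 _ (hI t)).2.le (H.nn _)) (sq_nonneg _)
  have pκ : Function.Periodic κ S.T := fun t => by simp only [hκ, pu t, per_deriv hu.1 pu t]
  set K := ∫ t in (0:ℝ)..S.T, κ t with hK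
  have hK0 : 0 < K := by
    obtain ⟨t, ht⟩ := H.nonconst hu hu0
    have := pκ.intervalIntegral_add_eq t 0
    rw [zero_add] at this
    rw [hK, ← this]
    refine intervalIntegral.integral_pos (by linarith) cκ.continuousOn (fun s _ => κ0 s) ⟨t, ⟨le_rfl, by linarith⟩, ?_⟩
    have := (h2 _ (hI t)).2; have := H.pos _ (hu0 t)
    simp only [hκ]; positivity
  set Ψ := S.L * R with hΨ
  have hΨ0 : 0 < Ψ := mul_pos hL hR
  have fΨ : ∀ t, f (u t) ≤ Ψ := fun t => by
    refine (le_abs_self _).trans ((H.adm.abs_le _).trans ?_)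
    rw [abs_of_pos (hu0 t)]; exact mul_le_mul_of_nonneg_left (huR t).le hL.le
  obtain ⟨k1, hk1⟩ := exists_nat_ge (32 * Real.pi^2 * Ψ^2 / (S.T * K))
  refine ⟨max 10 k1, le_max_left _ _, fun k hk => ?_⟩
  have hk10 : (10:ℝ) ≤ k := by exact_mod_cast (le_max_left _ _).trans hk
  have hkk : 32 * Real.pi^2 * Ψ^2 / (S.T * K) ≤ k := hk1.trans (by exact_mod_cast (le_max_right _ _).trans hk)
  have hk0 : (0:ℝ) < k := by linarith
  set p : ℝ := k * S.T with hp
  have hp0 : 0 < p := mul_pos hk0 hT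
  set ω := 2 * Real.pi / p with hω
  have hωp : ω * p = 2 * Real.pi := by rw [hω]; field_simp
  have hωT : ω * S.T = 2 * Real.pi / k := by rw [hω, hp]; field_simp
  set Q := ∫ t in (0:ℝ)..p, |S.q t| with hQ
  have hQ0 : 0 ≤ Q := intervalIntegral.integral_nonneg hp0.le fun _ _ => abs_nonneg _
  set ρ := K / (128 * (Ψ^2 * (Q+1))) with hρ
  have hρ0 : 0 < ρ := by positivity
  obtain ⟨δ, hδ, hδ1, hmod⟩ : ∃ δ > 0, δ ≤ 1 ∧ ∀ a ∈ Icc 0 R, ∀ b, |b - a| ≤ δ → |f' b - f' a| ≤ ρ := by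
    have := (isCompact_Icc (a := (-1:ℝ)) (b := R+1)).uniformContinuousOn_of_continuous H.cd.continuousOn
    obtain ⟨δ, h1, h3⟩ := Metric.uniformContinuousOn_iff_le.1 this ρ hρ0
    refine ⟨min δ 1, by positivity, min_le_right _ _, fun a ha b hb => ?_⟩
    have hb1 := abs_le.1 (hb.trans (min_le_right _ _))
    exact h3 b ⟨by linarith [ha.1], by linarith [ha.2]⟩ a ⟨by linarith [ha.1], by linarith [ha.2]⟩ (hb.trans (min_le_left _ _))
  set ε := min (1 / (2 * S.L)) (δ / (2 * Ψ)) with hε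
  have hε0 : 0 < ε := by positivity
  have hε1 : ε * (2 * S.L) ≤ 1 := by
    have : ε ≤ 1 / (2 * S.L) := min_le_left _ _
    rwa [le_div_iff₀ (by positivity)] at this
  have hε2 : ε * (2 * Ψ) ≤ δ := by
    have : ε ≤ δ / (2 * Ψ) := min_le_right _ _
    rwa [le_div_iff₀ (by positivity)] at this
  refine ⟨ε, hε0, S.W f (S.N k) (S.nd u) - ε^2 * K / 32, by have : 0 < ε^2 * K := by positivity
                                                            linarith, fun θ hθ s hs => ?_⟩
  set χ : ℝ → ℝ := fun t => Real.cos (ω * t - θ) + s with hχd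
  set χ' : ℝ → ℝ := fun t => -Real.sin (ω * t - θ) * ω with hχ'd
  have hχ : ∀ t, HasDerivAt χ (χ' t) t := fun t => by
    refine hcg (((((hasDerivAt_id t).const_mul ω).sub_const θ).cos).add_const s) rfl (by simp [hχ'd])
  have cχ : Continuous χ := by fun_prop
  have cχ' : Continuous χ' := by fun_prop
  have χb : ∀ t, |χ t| ≤ 2 := fun t => by
    have h1 := Real.cos_le_one (ω * t - θ); have h3 := Real.neg_one_le_cos (ω * t - θ)
    rw [abs_le]; simp only [hχd]; constructor <;> linarith [hs.1, hs.2]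
  set v := S.fam f u k ε θ s with hv
  have ev : ∀ t, v t = u t + ε * (χ t * f (u t)) := fun t => rfl
  let w' : ℝ → ℝ := fun t => χ' t * f (u t) + χ t * (f' (u t) * deriv u t)
  have hw : ∀ t, HasDerivAt (fun t => χ t * f (u t)) (w' t) t := fun t =>
    (hχ t).fun_mul ((H.hd (u t)).comp t (hu.1.1 t).hasDerivAt)
  have cf0 := H.adm.cont; have cd0 := H.cd; have cu0 := hu.1.cont
  have cw : Continuous w' := by simp only [w']; fun_prop
  have hvC : C1 v := C1.of (fun t => (hu.1.1 t).hasDerivAt.fun_add ((hw t).const_mul ε)) (by fun_prop)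
  have pu' : Function.Periodic u p := pu.nat_mul k
  have eu : u p = u 0 := by have := pu' 0; rwa [zero_add] at this
  have eu' : deriv u p = deriv u 0 := by have := per_deriv hu.1 pu' 0; rwa [zero_add] at this
  have eχ : χ p = χ 0 := by
    simp only [hχd]; rw [hωp, mul_zero, show 2 * Real.pi - θ = 0 - θ + 2 * Real.pi by ring, Real.cos_add_two_pi]
  refine ⟨hvC, fun t => ?_, ?_⟩
  · have h1 : |χ t * f (u t)| ≤ 2 * (S.L * u t) := by
      rw [abs_mul]
      have := H.adm.abs_le (u t)
      rw [abs_of_pos (hu0 t)] at this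
      exact mul_le_mul (χb t) this (abs_nonneg _) (by norm_num)
    have h3 := mul_le_mul_of_nonneg_left (abs_le.1 h1).1 hε0.le
    rw [ev]; nlinarith [hu0 t]
  have hWv := W_nodes_le H.adm hvC (S.N k)
  have hWu := W_nodes H.adm hu (S.N k)
  rw [N_h] at hWv hWu
  have hJ := J_expand H.adm (hu.on 0 p) hp0.le hvC
  have ed : (fun t => v t - u t) = fun t => ε * (χ t * f (u t)) := by funext t; rw [ev]; ring
  have edd : deriv (fun t => ε * (χ t * f (u t))) = fun t => ε * w' t := deriv_eq_of fun t => (hw t).const_mul ε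
  have ed0 : v p - u p = v 0 - u 0 := by rw [ev, ev, eu, eχ]
  rw [ed, edd, eu', ed0, sub_self, zero_add] at hJ
  have e1 : ∫ t in (0:ℝ)..p, (ε * w' t)^2 = ε^2 * ∫ t in (0:ℝ)..p, (w' t)^2 := by
    rw [← intervalIntegral.integral_const_mul]; congr 1; funext t; ring
  rw [e1] at hJ
  have cψ2 : Continuous fun t => f' (u t) * (χ t * f (u t))^2 := by fun_prop
  have cv := hvC.cont
  have crem : Continuous fun t => prim f (v t) - prim f (u t) - f (u t) * (v t - u t) :=
    (((prim_cont H.adm.cont).comp cv).sub ((prim_cont H.adm.cont).comp hu.1.cont)).sub (cf.mul (cv.sub hu.1.cont))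
  have hrem : -(∫ t in (0:ℝ)..p, S.q t * (prim f (v t) - prim f (u t) - f (u t) * (v t - u t))) ≤
      -(ε^2 / 2 * ∫ t in (0:ℝ)..p, S.q t * (f' (u t) * (χ t * f (u t))^2)) + Q * (ρ * (ε^2 * (4 * Ψ^2))) := by
    have hi1 : IntervalIntegrable (fun t => -(ε^2 / 2 * (S.q t * (f' (u t) * (χ t * f (u t))^2)))) volume 0 p :=
      ((S.qmul cψ2 _ _).const_mul _).neg
    rw [← intervalIntegral.integral_const_mul, hQ, ← intervalIntegral.integral_mul_const,
      ← intervalIntegral.integral_neg, ← intervalIntegral.integral_neg, ← intervalIntegral.integral_add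
      hi1 ((S.qint _ _).abs.mul_const _)]
    refine intervalIntegral.integral_mono_on hp0.le (S.qmul crem _ _).neg
      (hi1.add ((S.qint _ _).abs.mul_const _)) fun t _ => ?_
    have hχf : |χ t * f (u t)| ≤ 2 * Ψ := by
      rw [abs_mul, abs_of_nonneg (H.nn (u t))]; exact mul_le_mul (χb t) (fΨ t) (H.nn _) (by norm_num)
    have hd : |v t - u t| ≤ δ := by
      rw [ev, add_sub_cancel_left, abs_mul, abs_of_pos hε0]
      exact (mul_le_mul_of_nonneg_left hχf hε0.le).trans hε2
    have h1 := H.taylor2 (a := u t) (b := v t) (ρ := ρ) fun x hx =>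
      hmod _ ⟨(hu0 t).le, (huR t).le⟩ _ ((abs_sub_left_of_mem_uIcc hx).trans hd)
    have h3 : (v t - u t)^2 = ε^2 * (χ t * f (u t))^2 := by rw [ev]; ring
    have h4 : (χ t * f (u t))^2 ≤ 4 * Ψ^2 := by
      have := sq_le_sq' (abs_le.1 hχf).1 (abs_le.1 hχf).2; linarith
    rw [h3] at h1
    set rm := prim f (v t) - prim f (u t) - f (u t) * (v t - u t)
    have h5 : |S.q t * (rm - f' (u t) * (ε^2 * (χ t * f (u t))^2) / 2)| ≤ |S.q t| * (ρ * (ε^2 * (4 * Ψ^2))) := by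
      rw [abs_mul]
      refine mul_le_mul_of_nonneg_left (h1.trans ?_) (abs_nonneg _)
      gcongr
    have h6 := (abs_le.1 h5).1
    show -(S.q t * rm) ≤ _
    linarith
  have hquad := H.quad (fun s hs => (h2 s hs).1) cf'' hu hI hχ cχ' hp0.le eu eu' eχ
  change (∫ t in (0:ℝ)..p, (w' t)^2) - _ = _ - ∫ t in (0:ℝ)..p, (χ t)^2 * κ t at hquad
  have hb1 : ∫ t in (0:ℝ)..p, (χ' t * f (u t))^2 ≤ K / 8 := by
    have : ∫ t in (0:ℝ)..p, (χ' t * f (u t))^2 ≤ ∫ t in (0:ℝ)..p, ω^2 * Ψ^2 := by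
      refine intervalIntegral.integral_mono_on hp0.le (by apply Continuous.intervalIntegrable; fun_prop)
        (by simp) fun t _ => ?_
      rw [mul_pow]
      have h1 : (χ' t)^2 ≤ ω^2 := by
        simp only [hχ'd]; rw [mul_pow, neg_sq]
        exact mul_le_of_le_one_left (sq_nonneg _) (Real.sin_sq_le_one _)
      have h3 : (f (u t))^2 ≤ Ψ^2 := pow_le_pow_left₀ (H.nn _) (fΨ t) 2
      gcongr
    refine this.trans ?_
    rw [intervalIntegral.integral_const, smul_eq_mul, sub_zero]
    have e : p * (ω^2 * Ψ^2) = 4 * Real.pi^2 * Ψ^2 / (k * S.T) := by rw [hω, ← hp]; field_simp; ring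
    rw [e, div_le_iff₀ (by positivity)]
    rw [div_le_iff₀ (by positivity)] at hkk
    linarith
  have hb2 : K / 4 ≤ ∫ t in (0:ℝ)..p, (χ t)^2 * κ t := by
    obtain ⟨j, hj, hjχ⟩ : ∃ j : ℕ, (j:ℝ) + 1 ≤ k ∧ ∀ t ∈ Icc ((j:ℝ) * S.T) (j * S.T + S.T), 1/4 ≤ (χ t)^2 := by
      have h2k : 2 * Real.pi / k * k = 2 * Real.pi := by field_simp
      have hpk : 2 * Real.pi / k ≤ 2/3 := by rw [div_le_iff₀ hk0]; linarith [Real.pi_lt_d2]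
      have hω0 : 0 ≤ ω := by positivity
      rcases le_total 0 s with h | h
      · refine ⟨0, by rw [Nat.cast_zero]; linarith, fun t ht => ?_⟩
        simp only [Nat.cast_zero, zero_mul, zero_add] at ht
        have h3 := mul_le_mul_of_nonneg_left ht.2 hω0
        have h4 := mul_nonneg hω0 ht.1
        have := cos_ge (x := ω * t - θ) (abs_le.2 ⟨by linarith [hθ.2], by linarith [hθ.1]⟩)
        have : 1/2 ≤ χ t := by simp only [hχd]; linarith
        exact sqq (this.trans (le_abs_self _))
      · have hj1 : 2 * (k / 2) ≤ k := Nat.mul_div_le k 2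
        have hj2 : k ≤ 2 * (k / 2) + 1 := by omega
        generalize k / 2 = j at hj1 hj2
        have hj1' : 2 * (j:ℝ) ≤ k := by exact_mod_cast hj1
        have hj2' : (k:ℝ) ≤ 2 * j + 1 := by exact_mod_cast hj2
        refine ⟨j, by linarith, fun t ht => ?_⟩
        have h3 := mul_le_mul_of_nonneg_left ht.2 hω0
        have h4 := mul_le_mul_of_nonneg_left ht.1 hω0
        have e1 : ω * (j * S.T) = 2 * Real.pi / k * j := by rw [← hωT]; ring
        have e2 : ω * (j * S.T + S.T) = 2 * Real.pi / k * j + 2 * Real.pi / k := by rw [← hωT]; ring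
        rw [e2] at h3; rw [e1] at h4
        have hpk0 : 0 ≤ 2 * Real.pi / k := by positivity
        have h5 := mul_le_mul_of_nonneg_left hj1' hpk0
        have h6 := mul_le_mul_of_nonneg_left hj2' hpk0
        have := cos_ge (x := ω * t - θ - Real.pi) (abs_le.2 ⟨by linarith [hθ.2], by linarith [hθ.1]⟩)
        rw [Real.cos_sub_pi] at this
        have : χ t ≤ -1/2 := by simp only [hχd]; linarith
        exact sqq (le_trans (by linarith) (neg_le_abs _))
    have e : ∫ t in ((j:ℝ) * S.T)..(j * S.T + S.T), κ t = K := by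
      have := pκ.intervalIntegral_add_eq (j * S.T) 0
      rwa [zero_add] at this
    have hpos : 0 ≤ (j:ℝ) * S.T := by positivity
    have hle : (j:ℝ) * S.T + S.T ≤ p := by
      rw [hp]; have := mul_le_mul_of_nonneg_right hj hT.le; linarith
    have cc : Continuous fun t => (χ t)^2 * κ t := by fun_prop
    calc K / 4 = ∫ t in ((j:ℝ) * S.T)..(j * S.T + S.T), 1/4 * κ t := by
          rw [intervalIntegral.integral_const_mul, e]; ring
      _ ≤ ∫ t in ((j:ℝ) * S.T)..(j * S.T + S.T), (χ t)^2 * κ t := by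
          refine intervalIntegral.integral_mono_on (by linarith) ((cκ.const_mul _).intervalIntegrable _ _)
            (cc.intervalIntegrable _ _) fun t ht => mul_le_mul_of_nonneg_right (hjχ t ht) (κ0 t)
      _ ≤ _ := intervalIntegral.integral_mono_interval hpos (by linarith) hle
            (Eventually.of_forall fun t => mul_nonneg (sq_nonneg _) (κ0 t)) (cc.intervalIntegrable _ _)
  have hb3 : Q * (ρ * (ε^2 * (4 * Ψ^2))) ≤ ε^2 * (K / 32) := by
    have e : (Q+1) * (ρ * (ε^2 * (4 * Ψ^2))) = ε^2 * (K / 32) := by rw [hρ]; field_simp; ring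
    rw [← e]; gcongr; linarith
  have hε2' : 0 < ε^2 := by positivity
  have hfin : (∫ t in (0:ℝ)..p, (w' t)^2) - (∫ t in (0:ℝ)..p, S.q t * (f' (u t) * (χ t * f (u t))^2)) ≤ -K/8 := by
    rw [hquad]; linarith
  have := mul_le_mul_of_nonneg_left hfin hε2'.le
  linarith

end Setup
end SH

namespace SH
open Topology
namespace Setup
variable {S : Setup} {f f' : ℝ → ℝ} {R : ℝ}

def Alt (N : ℤ) (x y : ℤ → ℝ) : Prop := ∃ i1 i2 i3 i4 : ℤ, i1 < i2 ∧ i2 < i3 ∧ i3 < i4 ∧ i4 < i1 + N ∧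
  y i1 < x i1 ∧ x i2 < y i2 ∧ y i3 < x i3 ∧ x i4 < y i4

def AltR (p : ℝ) (u v : ℝ → ℝ) : Prop := ∃ t1 t2 t3 t4 : ℝ, t1 < t2 ∧ t2 < t3 ∧ t3 < t4 ∧ t4 < t1 + p ∧
  v t1 < u t1 ∧ u t2 < v t2 ∧ v t3 < u t3 ∧ u t4 < v t4

lemma Alt_closed (N : ℤ) (y : ℤ → ℝ) : IsClosed {x | ¬ Alt N x y} := by
  rw [← compl_setOf, isClosed_compl_iff]
  unfold Alt
  simp only [setOf_exists, setOf_and]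
  refine isOpen_iUnion fun a => isOpen_iUnion fun b => isOpen_iUnion fun c => isOpen_iUnion fun d => ?_
  have h1 : ∀ i : ℤ, IsOpen {x : ℤ → ℝ | y i < x i} := fun i => isOpen_lt continuous_const (continuous_apply i)
  have h2 : ∀ i : ℤ, IsOpen {x : ℤ → ℝ | x i < y i} := fun i => isOpen_lt (continuous_apply i) continuous_const
  exact isOpen_const.inter (isOpen_const.inter (isOpen_const.inter (isOpen_const.inter
    ((h1 a).inter ((h2 b).inter ((h1 c).inter (h2 d)))))))

lemma U_nb (hf : S.Adm f) {p : ℤ} (hp : p = 0 ∨ p = 1) {x y : ℤ → ℝ} {i : ℤ} (h : S.U f p x i < S.U f p y i) :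
    ∃ j, i - 1 ≤ j ∧ j ≤ i + 1 ∧ j % 2 = 1 - p ∧ x j < y j := by
  by_cases hi : i % 2 = p
  · by_contra hc
    push Not at hc
    have h1 := hc (i-1) le_rfl (by omega) (by omega)
    have h2 := hc (i+1) (by omega) le_rfl (by omega)
    have hx := dp_spec hf x i
    have hy := dp_spec hf y i
    have := S.h_pos; have := S.two_h
    unfold U at h
    rw [if_pos hi, if_pos hi] at h
    refine absurd h (not_lt.2 (comp hf hy.1 hx.1 (by linarith) ?_ ?_ _ ⟨by linarith, by linarith⟩))
    · rw [hx.2.1, hy.2.1]; exact h1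
    · rw [hx.2.2, hy.2.2]; exact h2
  · unfold U at h
    rw [if_neg hi, if_neg hi] at h
    exact ⟨i, by omega, by omega, by omega, h⟩

lemma Alt_U (hf : S.Adm f) {p : ℤ} (hp : p = 0 ∨ p = 1) {k : ℕ} {x y : ℤ → ℝ} (hx : S.Per k x) (hy : S.Per k y)
    (h : Alt ((k:ℤ) * S.M) (S.U f p x) (S.U f p y)) : Alt ((k:ℤ) * S.M) x y := by
  obtain ⟨a, b, c, d, h1, h2, h3, h4, ha, hb, hc, hd⟩ := h
  obtain ⟨a', a1, a2, a3, a4⟩ := U_nb hf hp ha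
  obtain ⟨b', b1, b2, b3, b4⟩ := U_nb hf hp hb
  obtain ⟨c', c1, c2, c3, c4⟩ := U_nb hf hp hc
  obtain ⟨d', d1, d2, d3, d4⟩ := U_nb hf hp hd
  have hN : ((k:ℤ) * S.M) % 2 = 0 := by unfold M; rw [mul_left_comm]; simp
  have ne1 : a' ≠ b' := fun e => by rw [e] at a4; linarith
  have ne2 : b' ≠ c' := fun e => by rw [e] at b4; linarith
  have ne3 : c' ≠ d' := fun e => by rw [e] at c4; linarith
  have ne4 : d' ≠ a' + (k:ℤ) * S.M := fun e => by rw [e, hx.apply, hy.apply] at d4; linarith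
  exact ⟨a', b', c', d', by omega, by omega, by omega, by omega, a4, b4, c4, d4⟩

lemma Alt_P (hf : S.Adm f) {k : ℕ} {x : ℤ → ℝ} {u : ℝ → ℝ} (hu : S.GSol f u) (hx : S.Per k x) (hy : S.Per k (S.nd u))
    (h : Alt ((k:ℤ) * S.M) (S.P f x) (S.nd u)) : Alt ((k:ℤ) * S.M) x (S.nd u) := by
  refine Alt_U hf (Or.inr rfl) hx hy ?_
  refine Alt_U hf (Or.inl rfl) (hx.U hf 1) (hy.U hf 1) ?_
  rwa [U_nodes hf hu, U_nodes hf hu]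

/-- node attached to a time -/
def Nb (S : Setup) (u v : ℝ → ℝ) (t : ℝ) (j : ℤ) : Prop := v t < u t ∧ S.nd v j < S.nd u j ∧
  (j = ⌊t / S.h⌋ ∨ (j = ⌊t / S.h⌋ + 1 ∧ S.nd u ⌊t / S.h⌋ ≤ S.nd v ⌊t / S.h⌋))

lemma fl_mem (S : Setup) (t : ℝ) : t ∈ Icc ((⌊t / S.h⌋:ℝ) * S.h) (((⌊t / S.h⌋:ℝ) + 1) * S.h) := by
  have h := S.h_pos
  have h1 := Int.floor_le (t / S.h); have h2 := Int.lt_floor_add_one (t / S.h)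
  rw [le_div_iff₀ h] at h1; rw [div_lt_iff₀ h] at h2
  exact ⟨h1, h2.le⟩

lemma Nb_exists (hf : S.Adm f) {u v : ℝ → ℝ} (hu : S.GSol f u) (hv : S.GSol f v) {t : ℝ} (h : v t < u t) :
    ∃ j, S.Nb u v t j := by
  have ht := fl_mem S t
  set i := ⌊t / S.h⌋ with hi
  by_cases h1 : S.nd v i < S.nd u i
  · exact ⟨i, h, h1, Or.inl hi⟩
  push Not at h1
  refine ⟨i+1, h, ?_, Or.inr ⟨rfl, h1⟩⟩
  by_contra h2
  push Not at h2
  rw [nd_succ, nd_succ] at h2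
  have := S.h_pos; have := S.two_h
  have := comp hf (hu.on ((i:ℝ) * S.h) (((i:ℝ)+1) * S.h)) (hv.on _ _) (by linarith) h1 h2 t ht
  linarith

lemma Nb_lt (hf : S.Adm f) {u v : ℝ → ℝ} (hu : S.GSol f u) (hv : S.GSol f v) {t t' : ℝ} {j j' : ℤ} (h : S.Nb u v t j)
    (h' : S.Nb v u t' j') (htt : t < t') : j < j' := by
  have hh := S.h_pos; have hh2 := S.two_h
  have ne : j ≠ j' := fun e => by
    have h1 := h.2.1; have h2 := h'.2.1; rw [e] at h1; linarith
  have hle : ⌊t / S.h⌋ ≤ ⌊t' / S.h⌋ := Int.floor_mono (div_le_div_of_nonneg_right htt.le hh.le)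
  rcases hle.lt_or_eq with hlt | heq
  · rcases h.2.2 with e | e <;> rcases h'.2.2 with e' | e' <;> omega
  have ht := fl_mem S t; have ht' := fl_mem S t'
  have ha := h.2.2; have ha' := h'.2.2
  rw [← heq] at ha' ht'
  set i := ⌊t / S.h⌋
  have p1 : S.nd v i < S.nd u i := by
    by_contra hc
    push Not at hc
    have := comp hf (hu.on ((i:ℝ) * S.h) t') (hv.on _ _) (by linarith [ht'.2]) hc h'.1.le t ⟨ht.1, htt.le⟩
    linarith [h.1]
  have e1 : j = i := by
    rcases ha with e | e
    · exact e
    · linarith [e.2]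
  rcases ha' with e | e
  · have := h'.2.1; rw [e] at this; linarith
  · omega

lemma Nb_per {u v : ℝ → ℝ} {k : ℕ} (hu : Function.Periodic u (k * S.T)) (hv : Function.Periodic v (k * S.T))
    (pu : S.Per k (S.nd u)) (pv : S.Per k (S.nd v)) {t : ℝ} {j : ℤ} (h : S.Nb u v t j) :
    S.Nb u v (t + k * S.T) (j + (k:ℤ) * S.M) := by
  have hh := S.h_pos
  have e : ⌊(t + k * S.T) / S.h⌋ = ⌊t / S.h⌋ + (k:ℤ) * S.M := by
    rw [← Int.floor_add_intCast]; congr 1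
    push_cast
    rw [← S.M_h]; field_simp
  refine ⟨?_, ?_, ?_⟩
  · rw [hu, hv]; exact h.1
  · rw [pu.apply, pv.apply]; exact h.2.1
  · rw [e, pu.apply, pv.apply]
    rcases h.2.2 with e | e
    · exact Or.inl (by rw [e])
    · exact Or.inr ⟨by rw [e.1]; ring, e.2⟩

lemma Alt_of_AltR (hf : S.Adm f) {u v : ℝ → ℝ} (hu : S.GSol f u) (hv : S.GSol f v) {k : ℕ}
    (qu : Function.Periodic u (k * S.T)) (qv : Function.Periodic v (k * S.T))
    (pu : S.Per k (S.nd u)) (pv : S.Per k (S.nd v)) (h : AltR (k * S.T) u v) :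
    Alt ((k:ℤ) * S.M) (S.nd u) (S.nd v) := by
  obtain ⟨a, b, c, d, h1, h2, h3, h4, ha, hb, hc, hd⟩ := h
  obtain ⟨a', a1⟩ := Nb_exists hf hu hv ha
  obtain ⟨b', b1⟩ := Nb_exists hf hv hu hb
  obtain ⟨c', c1⟩ := Nb_exists hf hu hv hc
  obtain ⟨d', d1⟩ := Nb_exists hf hv hu hd
  exact ⟨a', b', c', d', Nb_lt hf hu hv a1 b1 h1, Nb_lt hf hv hu b1 c1 h2, Nb_lt hf hu hv c1 d1 h3,
    Nb_lt hf hv hu d1 (Nb_per qu qv pu pv a1) h4, a1.2.1, b1.2.1, c1.2.1, d1.2.1⟩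

lemma cos_le_of_abs {x a : ℝ} (h : |x| ≤ a) (ha : a ≤ Real.pi) : Real.cos a ≤ Real.cos x := by
  rw [← Real.cos_abs x]; exact Real.cos_le_cos_of_nonneg_of_le_pi (abs_nonneg x) ha h

lemma cos_alt {c a1 a2 a3 a4 : ℝ} (h1 : a1 < a2) (h2 : a2 < a3) (h3 : a3 < a4) (h4 : a4 < a1 + 2 * Real.pi)
    (c1 : c < Real.cos a1) (c2 : Real.cos a2 < c) (c3 : c < Real.cos a3) (c4 : Real.cos a4 < c) : False := by
  have hπ := Real.pi_pos
  set a := Real.arccos c with ha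
  have ca : Real.cos a = c := Real.cos_arccos (by linarith [Real.neg_one_le_cos a2]) (by linarith [Real.cos_le_one a1])
  have ha0 : 0 ≤ a := Real.arccos_nonneg c
  have haπ : a ≤ Real.pi := Real.arccos_le_pi c
  set m := round (a3 / (2 * Real.pi)) with hm
  have hr := abs_sub_round (a3 / (2 * Real.pi))
  rw [← hm] at hr
  set r := (m:ℝ) * (2 * Real.pi) with hrr
  have hr3 : |a3 - r| ≤ Real.pi := by
    have e : a3 - r = (a3 / (2 * Real.pi) - m) * (2 * Real.pi) := by rw [hrr]; field_simp
    rw [e, abs_mul, abs_of_pos (by positivity : 0 < 2 * Real.pi)]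
    nlinarith
  have cs : ∀ x, Real.cos x = Real.cos (x - r) := fun x => (Real.cos_sub_int_mul_two_pi x m).symm
  rw [cs] at c1 c2 c3 c4
  have k3 : |a3 - r| < a := by
    by_contra hc
    push Not at hc
    have := Real.cos_le_cos_of_nonneg_of_le_pi ha0 hr3 hc
    rw [Real.cos_abs] at this; linarith
  have k3' := abs_lt.1 k3
  have k2 : a2 - r < -a := by
    by_contra hc
    push Not at hc
    have := cos_le_of_abs (x := a2 - r) (abs_le.2 ⟨by linarith, by linarith [k3'.2]⟩) haπ
    linarith
  have k4 : a < a4 - r := by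
    by_contra hc
    push Not at hc
    have := cos_le_of_abs (x := a4 - r) (abs_le.2 ⟨by linarith [k3'.1], by linarith⟩) haπ
    linarith
  have := cos_le_of_abs (x := a1 - r + Real.pi) (a := Real.pi - a) (abs_le.2 ⟨by linarith, by linarith⟩) (by linarith)
  rw [Real.cos_add_pi, Real.cos_pi_sub] at this
  linarith

lemma fam_noalt {u : ℝ → ℝ} (hp : ∀ t, 0 < f (u t)) {k : ℕ} (hk : 0 < k) {ε : ℝ} (hε : 0 < ε) (θ s : ℝ) :
    ¬ Alt ((k:ℤ) * S.M) (S.nd (S.fam f u k ε θ s)) (S.nd u) := by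
  rintro ⟨a, b, c, d, h1, h2, h3, h4, ha, hb, hc, hd⟩
  have hT := S.hT; have hh := S.h_pos; have hπ := Real.pi_pos
  have hk' : (0:ℝ) < k := by exact_mod_cast hk
  set ω := 2 * Real.pi / (k * S.T) with hω
  have hω0 : 0 < ω := by positivity
  have hs1 : ∀ i : ℤ, S.nd u i < S.nd (S.fam f u k ε θ s) i → -s < Real.cos (ω * (i * S.h) - θ) := fun i h => by
    unfold nd fam at h
    have h5 : 0 < ε * ((Real.cos (ω * (i * S.h) - θ) + s) * f (u (i * S.h))) := by linarith
    have := pos_of_mul_pos_left (pos_of_mul_pos_right h5 hε.le) (hp _).le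
    linarith
  have hs2 : ∀ i : ℤ, S.nd (S.fam f u k ε θ s) i < S.nd u i → Real.cos (ω * (i * S.h) - θ) < -s := fun i h => by
    unfold nd fam at h
    have h5 : 0 < ε * (-(Real.cos (ω * (i * S.h) - θ) + s) * f (u (i * S.h))) := by linarith
    have := pos_of_mul_pos_left (pos_of_mul_pos_right h5 hε.le) (hp _).le
    linarith
  have hmono : ∀ i j : ℤ, i < j → ω * (i * S.h) - θ < ω * (j * S.h) - θ := fun i j h => by
    have : (i:ℝ) < j := by exact_mod_cast h
    have := mul_lt_mul_of_pos_left (mul_lt_mul_of_pos_right this hh) hω0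
    linarith
  refine cos_alt (hmono _ _ h1) (hmono _ _ h2) (hmono _ _ h3) ?_ (hs1 a ha) (hs2 b hb) (hs1 c hc) (hs2 d hd)
  have := hmono _ _ h4
  have e : ω * (((a + k * S.M : ℤ) : ℝ) * S.h) = ω * (a * S.h) + 2 * Real.pi := by
    have := node_shift (S := S) a k
    rw [this, hω]; push_cast; field_simp
  rw [e] at this; linarith

end Setup
end SH

namespace SH
open Topology
namespace Setup
variable {S : Setup} {f f' : ℝ → ℝ} {R : ℝ}

def Good (S : Setup) (f : ℝ → ℝ) (R : ℝ) (k : ℕ) (v u : ℝ → ℝ) : Prop :=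
  S.GSol f u ∧ (∀ t, 0 < u t) ∧ (∀ t, u t < R) ∧ Function.Periodic u (k * S.T) ∧ ¬ AltR (k * S.T) u v ∧
    (∃ t, u t < v t) ∧ ∃ t, v t < u t

structure Fam (S : Setup) (f : ℝ → ℝ) (R : ℝ) (k : ℕ) (v : ℝ → ℝ) (K : Set (ℤ → ℝ)) (A c : ℝ)
    (γ : ℝ → ℝ → ℤ → ℝ) : Prop where
  cl : IsClosed K
  sub : K ⊆ S.CC f k A c
  inv : ∀ x ∈ K, S.P f x ∈ K
  shi : ∀ x ∈ K, ∀ l : ℤ, sh (l * S.M) x ∈ K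
  good : ∀ u, S.GSol f u → S.nd u ∈ K → S.Good f R k v u
  cont : Continuous fun p : ℝ × ℝ => γ p.1 p.2
  mono : ∀ θ s s', s ≤ s' → ∀ i, γ θ s i ≤ γ θ s' i
  shg : ∀ s, γ (2 * Real.pi / k) s = sh ((-1) * S.M) (γ 0 s)
  mem : ∀ θ ∈ Icc 0 (2 * Real.pi / k), ∃ s ∈ Icc (-1:ℝ) 1, γ θ s ∈ K

lemma P_iter_sh (hf : S.Adm f) (l : ℤ) (n : ℕ) (x : ℤ → ℝ) :
    (S.P f)^[n] (sh (l * S.M) x) = sh (l * S.M) ((S.P f)^[n] x) := by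
  induction n with
  | zero => rfl
  | succ n ih => rw [Function.iterate_succ_apply', ih, P_sh hf, Function.iterate_succ_apply']

lemma sh_Per {k : ℕ} {x : ℤ → ℝ} (hx : S.Per k x) (m : ℤ) : S.Per k (sh m x) := by
  unfold Per; funext i
  have := hx.apply (i + m)
  simp only [sh]
  rw [← this]; congr 1; ring

lemma nd_Per {v : ℝ → ℝ} (pv : Function.Periodic v S.T) (l : ℤ) : sh (l * S.M) (S.nd v) = S.nd v := by
  rw [← nd_shift]; congr 1; funext t; exact pv.int_mul l t

theorem Ctx.K_exists (H : S.Ctx f f' R) {v : ℝ → ℝ} (hv : S.GSol f v) (hv0 : ∀ t, 0 < v t) (hvR : ∀ t, v t < R)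
    (pv : Function.Periodic v S.T) : ∃ k0 : ℕ, 10 ≤ k0 ∧ ∀ k ≥ k0, ∃ K A c γ, S.Fam f R k v K A c γ := by
  obtain ⟨k0, hk0, hfam⟩ := H.fam_energy hv hv0 hvR pv
  refine ⟨k0, hk0, fun k hkk => ?_⟩
  obtain ⟨ε, hε, c1, hc1, hF⟩ := hfam k hkk
  have hk : 0 < k := by omega
  have hk' : (0:ℝ) < k := by exact_mod_cast hk
  have hT := S.hT; have hπ := Real.pi_pos
  have hkT : 0 < k * S.T := by positivity
  have cf : Continuous f := H.adm.cont
  have cv : Continuous v := hv.1.cont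
  set y := S.nd v with hy
  have hyp : S.Per k y := nd_Per pv k
  have pvk : Function.Periodic v (k * S.T) := pv.nat_mul k
  -- lower bound on the box
  obtain ⟨A, hA⟩ : ∃ A, ∀ x : ℤ → ℝ, (∀ i, 0 ≤ x i) → (∀ i, x i ≤ y i) → -A ≤ S.W f (S.N k) x := by
    obtain ⟨x, -, hm⟩ := (isCompact_univ_pi fun i : ℤ => isCompact_Icc (a := (0:ℝ)) (b := y i)).exists_isMinOn
      ⟨y, fun i _ => ⟨(hv0 _).le, le_rfl⟩⟩ (W_cont H.adm (S.N k)).continuousOn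
    exact ⟨-S.W f (S.N k) x, fun z h1 h2 => by rw [neg_neg]; exact hm fun i _ => ⟨h1 i, h2 i⟩⟩
  let D : Set (ℤ → ℝ) := {x | ∀ j ∈ Finset.range (S.N k), x (j:ℤ) < y j}
  have hDo : IsOpen D := by
    have : D = ⋂ j ∈ Finset.range (S.N k), {x | x (j:ℤ) < y j} := by ext; simp [D]
    rw [this]; exact isOpen_biInter_finset fun j _ => isOpen_lt (continuous_apply _) continuous_const
  have hDall : ∀ x ∈ D, S.Per k x → ∀ i, x i < y i := fun x hx hp i =>
    Per.all hk hp hyp (fun a b => a < b) (fun j hj => hx j (Finset.mem_range.2 hj)) i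
  let Low : Set (ℤ → ℝ) := {x | ∃ n, (S.P f)^[n] x ∈ D}
  let High : Set (ℤ → ℝ) := {x | ∃ n, S.W f (S.N k) ((S.P f)^[n] x) < -A}
  have hLow : IsOpen Low := by
    simp only [Low, setOf_exists]; exact isOpen_iUnion fun n => hDo.preimage ((P_cont H.adm).iterate n)
  have hHigh : IsOpen High := by
    simp only [High, setOf_exists]
    exact isOpen_iUnion fun n => isOpen_lt ((W_cont H.adm _).comp ((P_cont H.adm).iterate n)) continuous_const
  have hle_inv : ∀ x ∈ {x : ℤ → ℝ | ∀ i, x i ≤ y i}, S.P f x ∈ {x : ℤ → ℝ | ∀ i, x i ≤ y i} := fun x hx i => by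
    have := P_mono H.adm hx i; rwa [P_nodes H.adm hv] at this
  have hdis : ∀ x, S.Per k x → (∀ i, 0 ≤ x i) → x ∈ Low → x ∉ High := by
    rintro x hp h0 ⟨n, hn⟩ ⟨l, hl⟩
    have hit := W_iter H.adm hk hp
    have h1 := inv_iter hle_inv (le_max_left n l) (fun i => (hDall _ hn (hit.1 n) i).le)
    have h2 := hit.2 (le_max_right n l)
    have := hA _ (iter_nonneg H.adm h0 _) h1
    simp only at h2; linarith
  have hLinv : ∀ x ∈ Lowᶜ, S.P f x ∈ Lowᶜ := fun x hx ⟨n, hn⟩ => hx ⟨n+1, by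
    rwa [Function.iterate_succ_apply]⟩
  have hne : ∀ u, S.nd u ∈ S.CC f k A c1 → u ≠ v := fun u h e => by
    have := h.2.2.1; rw [e] at this; linarith
  have hCC : ∀ x, S.Per k x → (∀ i, 0 ≤ x i) → S.W f (S.N k) x ≤ c1 → x ∉ High → x ∈ S.CC f k A c1 :=
    fun x h1 h2 h3 h4 => ⟨h1, h2, h3, fun n => by by_contra hc; push Not at hc; exact h4 ⟨n, hc⟩⟩
  have hclL : IsClosed {x : ℤ → ℝ | ∀ i, x i ≤ y i} := by
    rw [setOf_forall]; exact isClosed_iInter fun i => isClosed_le (continuous_apply i) continuous_const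
  have hclU : IsClosed {x : ℤ → ℝ | ∀ i, y i ≤ x i} := by
    rw [setOf_forall]; exact isClosed_iInter fun i => isClosed_le continuous_const (continuous_apply i)
  have hstr : ∀ u, S.GSol f u → S.nd u ∈ S.CC f k A c1 → S.nd u ∉ Low → ∃ t, v t < u t := by
    intro u hu h1 h2
    by_contra hc
    push Not at hc
    exact h2 ⟨0, fun j _ => hu.lt H.adm hv hc (hne u h1) _⟩
  have hupp : ∀ u, S.GSol f u → S.nd u ∈ S.CC f k A c1 → ∃ t, u t < v t := by
    intro u hu h1
    by_contra hc
    push Not at hc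
    obtain ⟨g1, g2, g3⟩ := hu.facts H.adm hk h1.1 h1.2.1
    exact hne u h1 (H.noorder hv hu hv0 (H.ap u hu g2 g3) hkT pvk g1 hc).symm
  have hLowT : ∀ x, S.Per k x → (∀ i, 0 ≤ x i) → S.W f (S.N k) x ≤ c1 → (∀ i, x i ≤ y i) → x ∈ Low := by
    intro x h1 h2 h3 h4
    by_contra hc
    have hxC : x ∈ S.CC f k A c1 := ⟨h1, h2, h3, fun n => hA _ (iter_nonneg H.adm h2 n)
      (inv_iter hle_inv (Nat.zero_le n) h4)⟩
    obtain ⟨u, hu, huK, -⟩ := H.exists_fix hk (K := S.CC f k A c1 ∩ ({x | ∀ i, x i ≤ y i} ∩ Lowᶜ))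
      ((CC_closed H.adm _ _ _).inter (hclL.inter hLow.isClosed_compl)) inter_subset_left ⟨x, hxC, h4, hc⟩
      (fun x hx => ⟨CC_P H.adm hk hx.1, hle_inv _ hx.2.1, hLinv _ hx.2.2⟩)
    obtain ⟨t, ht⟩ := hstr u hu huK.1 huK.2.2
    exact absurd (hu.le H.adm hv huK.2.1 t) (not_le.2 ht)
  have hHighT : ∀ x, S.Per k x → (∀ i, 0 ≤ x i) → S.W f (S.N k) x ≤ c1 → (∀ i, y i ≤ x i) → x ∈ High := by
    intro x h1 h2 h3 h4
    by_contra hc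
    obtain ⟨u, hu, huK, -⟩ := H.exists_fix hk (K := S.CC f k A c1 ∩ {x | ∀ i, y i ≤ x i})
      ((CC_closed H.adm _ _ _).inter hclU) inter_subset_left ⟨x, hCC x h1 h2 h3 hc, h4⟩
      (fun x hx => ⟨CC_P H.adm hk hx.1, fun i => by
        have := P_mono H.adm hx.2 i; rwa [P_nodes H.adm hv] at this⟩)
    obtain ⟨t, ht⟩ := hupp u hu huK.1
    exact absurd (hv.le H.adm hu huK.2 t) (not_le.2 ht)
  let K : Set (ℤ → ℝ) := S.CC f k A c1 ∩ ({x | ¬ Alt ((k:ℤ) * S.M) x y} ∩ Lowᶜ)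
  let γ : ℝ → ℝ → ℤ → ℝ := fun θ s => S.nd (S.fam f v k ε θ s)
  have hγp : ∀ θ s, S.Per k (γ θ s) := by
    intro θ s
    unfold Per
    simp only [γ]
    rw [← nd_shift]; congr 1; funext t
    unfold fam
    have : v (t + ((k:ℤ):ℝ) * S.T) = v t := by simpa using pvk t
    rw [this, show 2 * Real.pi / (k * S.T) * (t + ((k:ℤ):ℝ) * S.T) - θ = 2 * Real.pi / (k * S.T) * t - θ + 2 * Real.pi by
      push_cast; field_simp; ring, Real.cos_add_two_pi]
  have hγm : ∀ θ s s', s ≤ s' → ∀ i, γ θ s i ≤ γ θ s' i := by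
    intro θ s s' h i
    simp only [γ, nd, fam]
    have := H.nn (v (i * S.h))
    gcongr
  refine ⟨K, A, c1, γ, (CC_closed H.adm _ _ _).inter ((Alt_closed _ _).inter hLow.isClosed_compl), inter_subset_left,
    fun x hx => ⟨CC_P H.adm hk hx.1, fun h => hx.2.1 (Alt_P H.adm hv hx.1.1 hyp h), hLinv _ hx.2.2⟩, ?_, ?_, ?_, hγm, ?_, ?_⟩
  · intro x hx l
    have hp := hx.1.1
    have hs := sh_Per hp (l * S.M)
    refine ⟨⟨hs, fun i => hx.1.2.1 _, by rw [W_sh H.adm hp]; exact hx.1.2.2.1, fun n => ?_⟩, ?_, ?_⟩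
    · rw [P_iter_sh H.adm, W_sh H.adm ((W_iter H.adm hk hp).1 n)]; exact hx.1.2.2.2 n
    · rintro ⟨a, b, c, d, h1, h2, h3, h4, ha, hb, hc, hd⟩
      have e : ∀ i, y i = y (i + l * S.M) := fun i => (congrFun (nd_Per pv l) i).symm
      rw [e] at ha hb hc hd
      exact hx.2.1 ⟨a + l * S.M, b + l * S.M, c + l * S.M, d + l * S.M, by linarith, by linarith, by linarith,
        by linarith, ha, hb, hc, hd⟩
    · rintro ⟨n, hn⟩
      rw [P_iter_sh H.adm] at hn
      have h1 := hDall _ hn (sh_Per ((W_iter H.adm hk hp).1 n) _)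
      refine hx.2.2 ⟨n, fun j _ => ?_⟩
      have := h1 (j - l * S.M)
      have e : y j = y (j - l * S.M) := by
        have := congrFun (nd_Per pv l) (j - l * S.M)
        simpa [sh] using this
      rw [e]
      simpa [sh] using this
  · intro u hu huK
    obtain ⟨g1, g2, g3⟩ := hu.facts H.adm hk huK.1.1 huK.1.2.1
    refine ⟨hu, ?_, H.ap u hu g2 g3, g1, fun h => huK.2.1 (Alt_of_AltR H.adm hu hv g1 pvk huK.1.1 hyp h),
      hupp u hu huK.1, hstr u hu huK.1 huK.2.2⟩
    refine (zero_sol H.adm).lt H.adm hu g2 fun he => huK.2.2 ⟨0, fun j _ => ?_⟩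
    rw [← he]; exact hv0 _
  · refine continuous_pi fun i => ?_
    simp only [γ, nd, fam]
    fun_prop
  · intro s
    simp only [γ]
    rw [← nd_shift]; congr 1; funext t
    unfold fam
    have : v (t + ((-1:ℤ):ℝ) * S.T) = v t := pv.int_mul (-1) t
    rw [this]
    congr 5
    push_cast; field_simp; ring
  · intro θ hθ
    have hb : ∀ s ∈ Icc (-1:ℝ) 1, (∀ i, 0 ≤ γ θ s i) ∧ S.W f (S.N k) (γ θ s) ≤ c1 := fun s hs =>
      ⟨fun i => (hF θ hθ s hs).2.1 _, (hF θ hθ s hs).2.2⟩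
    have hm1 : (-1:ℝ) ∈ Icc (-1:ℝ) 1 := by norm_num
    have h1 : (1:ℝ) ∈ Icc (-1:ℝ) 1 := by norm_num
    have e0 : ∀ i : ℤ, 0 ≤ f (v (i * S.h)) := fun i => H.nn _
    obtain ⟨s, hs, hsL, hsH⟩ := exists_mid (γ := γ θ) (a := -1) (b := 1)
      (by refine continuous_pi fun i => ?_
          simp only [γ, nd, fam]
          fun_prop) (by norm_num) hLow hHigh
      (fun s hs => hdis _ (hγp θ s) (hb s hs).1)
      (hLowT _ (hγp _ _) (hb _ hm1).1 (hb _ hm1).2 fun i => by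
        simp only [γ, nd, fam, hy]
        have := mul_nonneg hε.le (mul_nonneg (sub_nonneg.2 (Real.cos_le_one (2 * Real.pi / (k * S.T) * (i * S.h) - θ))) (e0 i))
        linarith)
      (hHighT _ (hγp _ _) (hb _ h1).1 (hb _ h1).2 fun i => by
        simp only [γ, nd, fam, hy]
        have := mul_nonneg hε.le (mul_nonneg (by linarith [Real.neg_one_le_cos (2 * Real.pi / (k * S.T) * (i * S.h) - θ)] :
          0 ≤ Real.cos (2 * Real.pi / (k * S.T) * (i * S.h) - θ) + 1) (e0 i))
        linarith)
    exact ⟨s, hs, hCC _ (hγp _ _) (hb s hs).1 (hb s hs).2 hsH,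
      fam_noalt (fun t => H.pos _ (hv0 t)) hk hε θ s, hsL⟩

end Setup
end SH

namespace SH
open Topology
namespace Setup
variable {S : Setup} {f f' : ℝ → ℝ} {R : ℝ}

lemma alt_of_per {u v : ℝ → ℝ} {p P : ℝ} (hp : 0 < p) (hP : 2 * p ≤ P) (hu : Function.Periodic u p)
    (hv : Function.Periodic v p) (h1 : ∃ t, u t < v t) (h2 : ∃ t, v t < u t) : AltR P u v := by
  obtain ⟨b, hb⟩ := h1
  obtain ⟨a, ha⟩ := h2
  obtain ⟨b', hb', e⟩ := (hv.sub hu).exists_mem_Ico hp b a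
  simp only [Pi.sub_apply] at e
  have hlt : a < b' := lt_of_le_of_ne hb'.1 fun h => by rw [← h] at e; linarith
  have := hb'.2
  have e1 := hu b'; have e2 := hv b'; have e3 := hu a; have e4 := hv a
  exact ⟨a, b', a + p, b' + p, hlt, by linarith, by linarith, by linarith, ha, by linarith, by rw [e3, e4]; exact ha,
    by rw [e1, e2]; linarith⟩

theorem Ctx.two (H : S.Ctx f f' R) {v : ℝ → ℝ} (pv : Function.Periodic v S.T) {k : ℕ} (hk2 : 10 ≤ k)
    {K : Set (ℤ → ℝ)} {A c0 : ℝ} {γ : ℝ → ℝ → ℤ → ℝ} (F : S.Fam f R k v K A c0 γ) :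
    ∃ u₁ u₂, S.Good f R k v u₁ ∧ S.Good f R k v u₂ ∧ ¬ ∃ l : ℤ, ∀ t, u₂ t = u₁ (t + l * S.T) := by
  by_contra hcon
  have hT := S.hT; have hπ := Real.pi_pos
  have hk : 0 < k := by omega
  have hk' : (0:ℝ) < k := by exact_mod_cast hk
  have hkT : 0 < k * S.T := by positivity
  have hI0 : (0:ℝ) ≤ 2 * Real.pi / k := by positivity
  have cW := W_cont H.adm (S.N k)
  have cP := P_cont (S := S) H.adm
  have cPn : ∀ n, Continuous ((S.P f)^[n]) := fun n => cP.iterate n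
  have hall : ∀ u₁ u₂, S.GSol f u₁ → S.nd u₁ ∈ K → S.GSol f u₂ → S.nd u₂ ∈ K → ∃ l : ℤ, ∀ t, u₂ t = u₁ (t + l * S.T) := by
    intro u₁ u₂ a1 a2 b1 b2
    by_contra h
    exact hcon ⟨u₁, u₂, F.good _ a1 a2, F.good _ b1 b2, h⟩
  have hKc : IsCompact K := (H.CC_compact hk A c0).of_isClosed_subset F.cl F.sub
  have hper : ∀ x ∈ K, S.Per k x := fun x hx => (F.sub hx).1
  have hWP : ∀ x ∈ K, S.W f (S.N k) (S.P f x) ≤ S.W f (S.N k) x := fun x hx => W_P H.adm hk (hper x hx)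
  have hsol : ∀ x ∈ K, S.W f (S.N k) x ≤ S.W f (S.N k) (S.P f x) → ∃ u, S.GSol f u ∧ S.nd u = x := fun x hx h =>
    glue H.adm (P_fix H.adm hk (hper x hx) h)
  have hit : ∀ n, ∀ x ∈ K, (S.P f)^[n] x ∈ K := fun n x hx => inv_iter F.inv (Nat.zero_le n) hx
  obtain ⟨s0, hs0, hx0⟩ := F.mem 0 ⟨le_rfl, hI0⟩
  set x0 := γ 0 s0 with hx0d
  obtain ⟨u0, hu0, hu0K, hmin⟩ := H.exists_fix hk F.cl F.sub ⟨x0, hx0⟩ F.inv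
  set c := S.W f (S.N k) (S.nd u0) with hc
  let Fx : Set (ℤ → ℝ) := {x | x ∈ K ∧ S.P f x = x}
  have hFsol : ∀ x ∈ Fx, ∃ u, S.GSol f u ∧ S.nd u = x := fun x hx => hsol x hx.1 (by rw [hx.2])
  have hsolF : ∀ u, S.GSol f u → S.nd u ∈ K → S.nd u ∈ Fx := fun u hu h => ⟨h, P_nodes H.adm hu⟩
  have hFrep : ∀ x ∈ Fx, ∃ l : ℤ, x = sh (l * S.M) (S.nd u0) := by
    intro x hx
    obtain ⟨u, hu, rfl⟩ := hFsol x hx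
    obtain ⟨l, hl⟩ := hall u0 u hu0 hu0K hu hx.1
    refine ⟨l, ?_⟩
    rw [← nd_shift]; congr 1; funext t; exact hl t
  have hFfin : Fx.Finite := by
    refine ((Set.finite_Ico (0:ℤ) k).image fun l => sh (l * S.M) (S.nd u0)).subset fun x hx => ?_
    obtain ⟨l, rfl⟩ := hFrep x hx
    have hk3 : (0:ℤ) < k := by exact_mod_cast hk
    refine ⟨l % k, ⟨Int.emod_nonneg _ hk3.ne', Int.emod_lt_of_pos _ hk3⟩, ?_⟩
    funext i
    simp only [sh]
    rw [← (hper _ hu0K).mul (l / k) (i + l % k * S.M)]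
    congr 1
    have := Int.emod_add_mul_ediv l k
    nth_rewrite 3 [← this]; ring
  have hFW : ∀ x ∈ Fx, S.W f (S.N k) x = c := by
    intro x hx
    obtain ⟨l, rfl⟩ := hFrep x hx
    rw [W_sh H.adm (hper _ hu0K)]
  obtain ⟨Uo, hU, hUd⟩ := hFfin.t2_separation
  let O : (ℤ → ℝ) → Set (ℤ → ℝ) := fun p => Uo p ∩ (S.P f) ⁻¹' (Uo p)
  have hO : ∀ p, IsOpen (O p) := fun p => (hU p).2.inter ((hU p).2.preimage cP)
  have hOF : ∀ p ∈ Fx, p ∈ O p := fun p hp => ⟨(hU p).1, by simp only [mem_preimage]; rw [hp.2]; exact (hU p).1⟩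
  have hUeq : ∀ p ∈ Fx, ∀ p' ∈ Fx, ∀ z, z ∈ Uo p → z ∈ Uo p' → p = p' := by
    intro p hp p' hp' z h1 h2
    by_contra hne
    exact (hUd hp hp' hne).le_bot ⟨h1, h2⟩
  obtain ⟨d, hd, hdW⟩ : ∃ d > c, ∀ x ∈ K, S.W f (S.N k) x < d → ∃ p ∈ Fx, x ∈ O p := by
    have hcl : IsCompact (K \ ⋃ p ∈ Fx, O p) := hKc.diff (isOpen_biUnion fun p _ => hO p)
    rcases (K \ ⋃ p ∈ Fx, O p).eq_empty_or_nonempty with h | h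
    · refine ⟨c + 1, by linarith, fun x hx _ => ?_⟩
      by_contra hn
      have : x ∈ K \ ⋃ p ∈ Fx, O p := ⟨hx, by simpa using hn⟩
      rw [h] at this; exact this
    · obtain ⟨z, hz, hzm⟩ := hcl.exists_isMinOn h cW.continuousOn
      refine ⟨S.W f (S.N k) z, ?_, fun x hx hlt => ?_⟩
      · refine lt_of_le_of_ne (hmin z hz.1) fun he => hz.2 ?_
        obtain ⟨u, hu, rfl⟩ := hsol z hz.1 (by rw [← he]; exact hmin _ (F.inv z hz.1))
        exact mem_biUnion (hsolF u hu hz.1) (hOF _ (hsolF u hu hz.1))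
      · by_contra hn
        have : x ∈ K \ ⋃ p ∈ Fx, O p := ⟨hx, by simpa using hn⟩
        exact absurd (hzm this) (not_le.2 hlt)
  let V : (ℤ → ℝ) → Set (ℤ → ℝ) := fun p => O p ∩ {x | S.W f (S.N k) x < d}
  have hV : ∀ p, IsOpen (V p) := fun p => (hO p).inter (isOpen_lt cW continuous_const)
  have hVinv : ∀ p ∈ Fx, ∀ x ∈ K ∩ V p, S.P f x ∈ K ∩ V p := by
    intro p hp x hx
    have h1 := F.inv x hx.1
    have h2 := (hWP x hx.1).trans_lt hx.2.2
    obtain ⟨p', hp', h3⟩ := hdW _ h1 h2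
    have e := hUeq p hp p' hp' _ hx.2.1.2 h3.1
    exact ⟨h1, e ▸ h3, h2⟩
  let B : (ℤ → ℝ) → Set (ℤ → ℝ) := fun p => {x | ∃ n, (S.P f)^[n] x ∈ V p}
  have hB : ∀ p, IsOpen (B p) := fun p => by
    simp only [B, setOf_exists]; exact isOpen_iUnion fun n => (hV p).preimage (cPn n)
  have hcov : ∀ x ∈ K, ∃ p ∈ Fx, x ∈ B p := by
    intro x hx
    by_contra hn
    have hb : ∀ n, d ≤ S.W f (S.N k) ((S.P f)^[n] x) := fun n => by
      by_contra hlt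
      push Not at hlt
      obtain ⟨p, hp, h⟩ := hdW _ (hit n x hx) hlt
      exact hn ⟨p, hp, n, h, hlt⟩
    obtain ⟨u, hu, huK, -⟩ := H.exists_fix hk (K := K ∩ {x | ∀ n, d ≤ S.W f (S.N k) ((S.P f)^[n] x)})
      (F.cl.inter (by
        rw [setOf_forall]; exact isClosed_iInter fun n => isClosed_le continuous_const (cW.comp (cPn n))))
      (inter_subset_left.trans F.sub) ⟨x, hx, hb⟩ (fun x hx => ⟨F.inv x hx.1, fun n => by
        have := hx.2 (n+1); rwa [Function.iterate_succ_apply] at this⟩)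
    have := huK.2 0
    have := hFW _ (hsolF u hu huK.1)
    simp only [Function.iterate_zero, id] at *
    linarith
  -- closed relations pass to the limits
  have hrel : ∀ E : Set ((ℤ → ℝ) × (ℤ → ℝ)), IsClosed E → (∀ z ∈ E, z.1 ∈ K → z.2 ∈ K → (S.P f z.1, S.P f z.2) ∈ E) →
      ∀ a ∈ K, ∀ b ∈ K, (a, b) ∈ E → ∀ p ∈ Fx, ∀ p' ∈ Fx, a ∈ B p → b ∈ B p' → (p, p') ∈ E := by
    rintro E hE hEP a ha b hb hab p hp p' hp' ⟨n, hn⟩ ⟨m, hm⟩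
    let Cc : (ℤ → ℝ) → Set (ℤ → ℝ) := fun p => {x | ∀ n, (S.P f)^[n] x ∉ ⋃ p' ∈ Fx \ {p}, Uo p'}
    have hCcl : ∀ p, IsClosed (Cc p) := fun p => by
      simp only [Cc, setOf_forall]
      exact isClosed_iInter fun n => ((isOpen_biUnion fun p' _ => (hU p').2).preimage (cPn n)).isClosed_compl
    have hCinv : ∀ p, ∀ x ∈ Cc p, S.P f x ∈ Cc p := fun p x hx n => by
      have := hx (n+1); rwa [Function.iterate_succ_apply] at this
    have hCfix : ∀ p, ∀ x ∈ Cc p, x ∈ Fx → x = p := by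
      intro p x hx hxF
      by_contra hne
      exact hx 0 (mem_biUnion (⟨hxF, hne⟩ : x ∈ Fx \ {p}) (hU x).1)
    have hVC : ∀ p ∈ Fx, ∀ x ∈ K ∩ V p, x ∈ Cc p := by
      intro p hp x hx j hj
      have h1 := inv_iter (hVinv p hp) (Nat.zero_le j) (n := 0) hx
      simp only [mem_iUnion] at hj
      obtain ⟨p', hp', h2⟩ := hj
      exact hp'.2 (hUeq p hp p' hp'.1 _ h1.2.1.1 h2).symm
    have ha' := inv_iter (hVinv p hp) (le_max_left n m) ⟨hit n a ha, hn⟩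
    have hb' := inv_iter (hVinv p' hp') (le_max_right n m) ⟨hit m b hb, hm⟩
    have habN : ∀ N, ((S.P f)^[N] a, (S.P f)^[N] b) ∈ E := fun N => by
      induction N with
      | zero => exact hab
      | succ N ih =>
        rw [Function.iterate_succ_apply', Function.iterate_succ_apply']
        exact hEP _ ih (hit N a ha) (hit N b hb)
    have hcomp : IsCompact ((K ×ˢ K) ∩ (E ∩ (Cc p ×ˢ Cc p'))) :=
      (hKc.prod hKc).inter_right (hE.inter ((hCcl p).prod (hCcl p')))
    obtain ⟨⟨x, y⟩, ⟨⟨hxK, hyK⟩, hxyE, hxC, hyC⟩, hm⟩ := hcomp.exists_isMinOn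
      ⟨((S.P f)^[max n m] a, (S.P f)^[max n m] b), ⟨ha'.1, hb'.1⟩, habN _, hVC p hp _ ha', hVC p' hp' _ hb'⟩
      (f := fun z : (ℤ → ℝ) × (ℤ → ℝ) => S.W f (S.N k) z.1 + S.W f (S.N k) z.2)
      ((cW.comp continuous_fst).add (cW.comp continuous_snd)).continuousOn
    have h1 : S.W f (S.N k) x + S.W f (S.N k) y ≤ S.W f (S.N k) (S.P f x) + S.W f (S.N k) (S.P f y) :=
      hm (a := (S.P f x, S.P f y)) ⟨⟨F.inv x hxK, F.inv y hyK⟩, hEP _ hxyE hxK hyK, hCinv p x hxC, hCinv p' y hyC⟩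
    have h2 := hWP x hxK
    have h3 := hWP y hyK
    obtain ⟨u, hu, rfl⟩ := hsol x hxK (by linarith)
    obtain ⟨w, hw, rfl⟩ := hsol y hyK (by linarith)
    rw [← hCfix p _ hxC (hsolF u hu hxK), ← hCfix p' _ hyC (hsolF w hw hyK)]
    exact hxyE
  have hord : ∀ a ∈ K, ∀ b ∈ K, (∀ i, a i ≤ b i) → ∀ p ∈ Fx, ∀ p' ∈ Fx, a ∈ B p → b ∈ B p' → p = p' := by
    intro a ha b hb hab p hp p' hp' h1 h2
    have h := hrel {z | ∀ i, z.1 i ≤ z.2 i} (by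
      rw [setOf_forall]
      exact isClosed_iInter fun i => isClosed_le ((continuous_apply i).comp continuous_fst)
        ((continuous_apply i).comp continuous_snd)) (fun z hz _ _ => P_mono H.adm hz) a ha b hb hab p hp p' hp' h1 h2
    obtain ⟨u, hu, rfl⟩ := hFsol p hp
    obtain ⟨w, hw, rfl⟩ := hFsol p' hp'
    obtain ⟨-, gu0, -, gup, -⟩ := F.good u hu hp.1
    obtain ⟨-, -, gwR, gwp, -⟩ := F.good w hw hp'.1
    rw [H.noorder hu hw gu0 gwR hkT gup gwp (hu.le H.adm hw h)]
  obtain ⟨p0, hp0, hxB⟩ := hcov x0 hx0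
  let Q : Set (ℝ × ℝ) := (Icc 0 (2 * Real.pi / k) ×ˢ Icc (-1:ℝ) 1) ∩ (fun p : ℝ × ℝ => γ p.1 p.2) ⁻¹' K
  have hQ : IsCompact Q := (isCompact_Icc.prod isCompact_Icc).inter_right (F.cl.preimage F.cont)
  have key : ∀ θ s, (θ, s) ∈ Q → γ θ s ∈ B p0 := by
    by_contra hbad
    push Not at hbad
    obtain ⟨θ1, s1, hq1, hq2⟩ := hbad
    let A1 : Set ℝ := Prod.fst '' (Q ∩ (fun p : ℝ × ℝ => γ p.1 p.2) ⁻¹' (⋃ p ∈ Fx \ {p0}, B p)ᶜ)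
    let A2 : Set ℝ := Prod.fst '' (Q ∩ (fun p : ℝ × ℝ => γ p.1 p.2) ⁻¹' (B p0)ᶜ)
    have c1 : IsClosed A1 := ((hQ.inter_right ((isOpen_biUnion fun p _ => hB p).isClosed_compl.preimage F.cont)).image
      continuous_fst).isClosed
    have c2 : IsClosed A2 := ((hQ.inter_right ((hB p0).isClosed_compl.preimage F.cont)).image
      continuous_fst).isClosed
    have huniq : ∀ a ∈ K, ∀ b ∈ K, (∀ i, a i ≤ b i) → (a ∈ B p0 ↔ b ∈ B p0) := by
      intro a ha b hb hab
      obtain ⟨p, hp, h1⟩ := hcov a ha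
      obtain ⟨p', hp', h2⟩ := hcov b hb
      exact ⟨fun h => hord a ha b hb hab p0 hp0 p' hp' h h2 ▸ h2, fun h => hord a ha b hb hab p hp p0 hp0 h1 h ▸ h1⟩
    have hin : ∀ a ∈ K, a ∉ (⋃ p ∈ Fx \ {p0}, B p) → a ∈ B p0 := by
      intro a ha hn
      obtain ⟨p, hp, h1⟩ := hcov a ha
      by_cases e : p = p0
      · exact e ▸ h1
      · exact (hn (mem_biUnion (show p ∈ Fx \ {p0} from ⟨hp, e⟩) h1)).elim
    have hnin : ∀ a ∈ K, a ∈ B p0 → a ∉ (⋃ p ∈ Fx \ {p0}, B p) := by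
      intro a ha h hn
      simp only [mem_iUnion] at hn
      obtain ⟨p, hp, h1⟩ := hn
      exact hp.2 (hord a ha a ha (fun _ => le_rfl) p hp.1 p0 hp0 h1 h)
    obtain ⟨θ, hθ, ⟨⟨θa, sa⟩, ha, ea⟩, ⟨⟨θb, sb⟩, hb, eb⟩⟩ := isPreconnected_closed_iff.1
      (isPreconnected_Icc (a := (0:ℝ)) (b := 2 * Real.pi / k)) A1 A2 c1 c2
      (fun θ hθ => by
        obtain ⟨s, hs, hm⟩ := F.mem θ hθ
        by_cases h : γ θ s ∈ B p0
        · exact Or.inl ⟨(θ, s), ⟨⟨⟨hθ, hs⟩, hm⟩, hnin _ hm h⟩, rfl⟩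
        · exact Or.inr ⟨(θ, s), ⟨⟨⟨hθ, hs⟩, hm⟩, h⟩, rfl⟩)
      ⟨0, ⟨le_rfl, hI0⟩, (0, s0), ⟨⟨⟨⟨le_rfl, hI0⟩, hs0⟩, hx0⟩, hnin _ hx0 hxB⟩, rfl⟩
      ⟨θ1, hq1.1.1, (θ1, s1), ⟨hq1, hq2⟩, rfl⟩
    simp only at ea eb
    subst ea
    subst eb
    have h1 := hin _ ha.1.2 ha.2
    rcases le_total sa sb with h | h
    · exact hb.2 ((huniq _ ha.1.2 _ hb.1.2 (F.mono _ _ _ h)).1 h1)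
    · exact hb.2 ((huniq _ hb.1.2 _ ha.1.2 (F.mono _ _ _ h)).2 h1)
  have hshK := F.shi x0 hx0 (-1)
  have h1 : sh ((-1) * S.M) x0 ∈ B p0 := by
    rw [hx0d, ← F.shg]
    refine key _ _ ⟨⟨⟨hI0, le_rfl⟩, hs0⟩, ?_⟩
    simp only [mem_preimage]; rw [F.shg]; exact hshK
  have h2 := hrel {z | z.2 = sh ((-1) * S.M) z.1} (isClosed_eq continuous_snd
    (by unfold sh; fun_prop))
    (fun z hz _ _ => by simp only [mem_setOf_eq] at hz ⊢; rw [hz, P_sh H.adm]) x0 hx0 _ hshK rfl p0 hp0 p0 hp0 hxB h1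
  obtain ⟨u, hu, rfl⟩ := hFsol p0 hp0
  obtain ⟨-, -, -, -, g1, g2, g3⟩ := F.good u hu hp0.1
  have hpT : Function.Periodic u S.T := by
    intro t
    have := hu.periodic H.adm (l := -1) (Eq.symm h2) (t + S.T)
    rw [← this]; congr 1; push_cast; ring
  refine g1 (alt_of_per hT ?_ hpT pv g2 g3)
  have : (10:ℝ) ≤ k := by exact_mod_cast hk2
  nlinarith

end Setup
end SH

namespace SH
open Topology
namespace Setup
variable {S : Setup} {f f' : ℝ → ℝ} {R : ℝ}

lemma per_eq {p x y c : ℝ} {m : ℤ} (hp : 0 < p) (hx : x ∈ Ico c (c + p)) (hy : y ∈ Ico c (c + p)) (e : x = y + m * p) :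
    x = y := by
  have h1 : (m:ℝ) * p < 1 * p := by linarith [hx.2, hy.1]
  have h2 : (-1:ℝ) * p < m * p := by linarith [hx.1, hy.2]
  have h3 := lt_of_mul_lt_mul_right h1 hp.le
  have h4 := lt_of_mul_lt_mul_right h2 hp.le
  have h5 : m < 1 := by exact_mod_cast h3
  have h6 : -1 < m := by exact_mod_cast h4
  have : m = 0 := by omega
  rw [e, this]; simp

lemma trans_zero {w : ℝ → ℝ} {y δ : ℝ} (hδ : 0 < δ) (h0 : w y = 0) (hd : deriv w y ≠ 0) :
    ∃ c d, |c - y| < δ ∧ |d - y| < δ ∧ 0 < w c ∧ w d < 0 ∧ (d < y ∧ y < c ∨ c < y ∧ y < d) := by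
  have hn : ∀ᶠ x in 𝓝 y, |x - y| < δ := by
    exact Metric.ball_mem_nhds y hδ
  have hl : 𝓝[<] y ≤ 𝓝 y := nhdsWithin_le_nhds
  have hr : 𝓝[>] y ≤ 𝓝 y := nhdsWithin_le_nhds
  rcases lt_or_gt_of_ne hd with h | h
  · have hs := eventually_nhdsWithin_sign_eq_of_deriv_neg h h0
    obtain ⟨c, ⟨c1, c2⟩, c3⟩ := (((hn.and hs).filter_mono hl).and self_mem_nhdsWithin).exists
    obtain ⟨d, ⟨d1, d2⟩, d3⟩ := (((hn.and hs).filter_mono hr).and self_mem_nhdsWithin).exists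
    rw [sign_pos (sub_pos.2 c3), sign_eq_one_iff] at c2
    rw [sign_neg (sub_neg.2 d3), sign_eq_neg_one_iff] at d2
    exact ⟨c, d, c1, d1, c2, d2, Or.inr ⟨c3, d3⟩⟩
  · have hs := eventually_nhdsWithin_sign_eq_of_deriv_pos h h0
    obtain ⟨d, ⟨d1, d2⟩, d3⟩ := (((hn.and hs).filter_mono hl).and self_mem_nhdsWithin).exists
    obtain ⟨c, ⟨c1, c2⟩, c3⟩ := (((hn.and hs).filter_mono hr).and self_mem_nhdsWithin).exists
    rw [sign_pos (sub_pos.2 c3), sign_eq_one_iff] at c2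
    rw [sign_neg (sub_neg.2 d3), sign_eq_neg_one_iff] at d2
    exact ⟨c, d, c1, d1, c2, d2, Or.inl ⟨d3, c3⟩⟩

theorem Good.count (hf : S.Adm f) {u v : ℝ → ℝ} (hv : S.GSol f v) (pv : Function.Periodic v S.T) {k : ℕ} (hk : 0 < k)
    (hu : S.Good f R k v u) : {t | t ∈ Ico (0:ℝ) (k * S.T) ∧ u t = v t}.ncard = 2 := by
  obtain ⟨gu, -, -, pu, na, ⟨a, ha⟩, hb⟩ := hu
  have hT := S.hT
  have hk' : (0:ℝ) < k := by exact_mod_cast hk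
  have pvk : Function.Periodic v (k * S.T) := pv.nat_mul k
  set p := (k:ℝ) * S.T with hp
  have hp0 : 0 < p := by positivity
  set w : ℝ → ℝ := fun t => u t - v t with hw
  have pw : Function.Periodic w p := fun t => by simp only [hw]; rw [pu, pvk]
  have cw : Continuous w := gu.1.cont.sub hv.1.cont
  have hwa : w a < 0 := by simp only [hw]; linarith
  have hwap : w (a + p) < 0 := by rw [pw]; exact hwa
  obtain ⟨b, hb, hwb⟩ : ∃ b ∈ Ioo a (a + p), 0 < w b := by
    obtain ⟨b, hb⟩ := hb
    obtain ⟨b', hb', e⟩ := pw.exists_mem_Ico hp0 b a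
    have h1 : 0 < w b' := by rw [← e]; simp only [hw]; linarith
    exact ⟨b', ⟨lt_of_le_of_ne hb'.1 fun h => by rw [← h] at h1; linarith, hb'.2⟩, h1⟩
  obtain ⟨z1, hz1, e1⟩ := intermediate_value_Ioo hb.1.le cw.continuousOn ⟨hwa, hwb⟩
  obtain ⟨z2, hz2, e2⟩ := intermediate_value_Ioo' hb.2.le cw.continuousOn ⟨hwap, hwb⟩
  have hnd : ∀ y, w y = 0 → deriv w y ≠ 0 := by
    intro y hy h
    simp only [hw] at hy
    rw [hw, deriv_fun_sub (gu.1.1 y) (hv.1.1 y)] at h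
    have := gu.ivp hf hv (c := y) (by linarith) (by linarith)
    rw [this] at ha; exact lt_irrefl _ ha
  have no3 : ∀ y1 y2 y3, a < y1 → y1 < y2 → y2 < y3 → y3 < a + p → w y1 = 0 → w y2 = 0 → w y3 = 0 → False := by
    intro y1 y2 y3 h1 h2 h3 h4 k1 k2 k3
    obtain ⟨δ, hδ, d1, d2, d3, d4⟩ : ∃ δ > 0, δ ≤ y1 - a ∧ 2 * δ ≤ y2 - y1 ∧ 2 * δ ≤ y3 - y2 ∧ δ ≤ a + p - y3 := by
      refine ⟨min (min (y1 - a) ((y2 - y1)/2)) (min ((y3 - y2)/2) (a + p - y3)), ?_, ?_, ?_, ?_, ?_⟩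
      · refine lt_min (lt_min ?_ ?_) (lt_min ?_ ?_) <;> linarith
      · exact (min_le_left _ _).trans (min_le_left _ _)
      · linarith [(min_le_left (min (y1 - a) ((y2 - y1)/2)) (min ((y3 - y2)/2) (a + p - y3))).trans (min_le_right _ _)]
      · linarith [(min_le_right (min (y1 - a) ((y2 - y1)/2)) (min ((y3 - y2)/2) (a + p - y3))).trans (min_le_left _ _)]
      · exact (min_le_right _ _).trans (min_le_right _ _)
    obtain ⟨c1, -, a1, -, b1, -, -⟩ := trans_zero hδ k1 (hnd _ k1)
    obtain ⟨c2, e2, a2, a2', b2, b2', hor⟩ := trans_zero hδ k2 (hnd _ k2)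
    obtain ⟨c3, -, a3, -, b3, -, -⟩ := trans_zero hδ k3 (hnd _ k3)
    rw [abs_lt] at a1 a2 a2' a3
    simp only [hw] at b1 b2 b2' b3 hwap
    rcases hor with ⟨g1, g2⟩ | ⟨g1, g2⟩
    · exact na ⟨c1, e2, c2, a + p, by linarith, by linarith, by linarith, by linarith, by linarith, by linarith,
        by linarith, by linarith⟩
    · exact na ⟨c2, e2, c3, a + p, by linarith, by linarith, by linarith, by linarith, by linarith, by linarith,
        by linarith, by linarith⟩
  have hz12 : z1 < z2 := hz1.2.trans hz2.1
  have honly : ∀ z ∈ Ico a (a + p), w z = 0 → z = z1 ∨ z = z2 := by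
    intro z hz h0
    have hza : a < z := lt_of_le_of_ne hz.1 fun h => by rw [← h] at h0; linarith
    rcases lt_trichotomy z z1 with h | h | h
    · exact (no3 z z1 z2 hza h hz12 hz2.2 h0 e1 e2).elim
    · exact Or.inl h
    rcases lt_trichotomy z z2 with h' | h' | h'
    · exact (no3 z1 z z2 hz1.1 h h' hz2.2 e1 h0 e2).elim
    · exact Or.inr h'
    · exact (no3 z1 z2 z hz1.1 hz12 h' hz.2 e1 e2 h0).elim
  have hmv : ∀ t c, ∃ m : ℤ, t + m * p ∈ Ico c (c + p) := fun t c => by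
    obtain ⟨m, hm, -⟩ := existsUnique_add_zsmul_mem_Ico hp0 t c
    exact ⟨m, by simpa using hm⟩
  have hwm : ∀ t (m : ℤ), w (t + m * p) = w t := fun t m => pw.int_mul m t
  obtain ⟨m1, hm1⟩ := hmv z1 0
  obtain ⟨m2, hm2⟩ := hmv z2 0
  have hset : {t | t ∈ Ico (0:ℝ) p ∧ u t = v t} = {z1 + m1 * p, z2 + m2 * p} := by
    ext t
    simp only [mem_setOf_eq, mem_insert_iff, mem_singleton_iff]
    constructor
    · rintro ⟨ht, he⟩
      obtain ⟨m, hm⟩ := hmv t a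
      have ht' : t ∈ Ico 0 (0 + p) := by simpa using ht
      rcases honly _ hm (by rw [hwm]; simp only [hw]; linarith) with h | h
      · left; exact per_eq (m := -(m + m1)) hp0 ht' hm1 (by rw [← h]; push_cast; ring)
      · right; exact per_eq (m := -(m + m2)) hp0 ht' hm2 (by rw [← h]; push_cast; ring)
    · rw [zero_add] at hm1 hm2
      rintro (rfl | rfl)
      · have := hwm z1 m1; rw [e1] at this; simp only [hw] at this; exact ⟨hm1, by linarith⟩
      · have := hwm z2 m2; rw [e2] at this; simp only [hw] at this; exact ⟨hm2, by linarith⟩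
  rw [hset, ncard_pair]
  intro h
  have := per_eq (c := a) (m := m2 - m1) hp0 ⟨hz1.1.le, hz1.2.trans hb.2⟩ ⟨(hb.1.trans hz2.1).le, hz2.2⟩
    (show z1 = z2 + ((m2 - m1 : ℤ):ℝ) * p by push_cast; linarith)
  linarith

theorem Good.subh {u v : ℝ → ℝ} (pv : Function.Periodic v S.T) {k : ℕ}
    (hu : S.Good f R k v u) (l : ℕ) (hl : 1 ≤ l) (hlk : l < k) : ¬ Function.Periodic u (l * S.T) := by
  intro hp
  obtain ⟨-, -, -, pu, na, h1, h2⟩ := hu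
  have hT := S.hT
  have hl' : (1:ℝ) ≤ l := by exact_mod_cast hl
  have hlk' : (l:ℝ) + 1 ≤ k := by exact_mod_cast hlk
  rcases le_total (2 * l) k with h | h
  · have : (2:ℝ) * l ≤ k := by exact_mod_cast h
    exact na (alt_of_per (p := l * S.T) (by positivity) (by nlinarith) hp (pv.nat_mul l) h1 h2)
  · have : (k:ℝ) ≤ 2 * l := by exact_mod_cast h
    refine na (alt_of_per (p := k * S.T - l * S.T) (by nlinarith) (by nlinarith) (fun t => ?_)
      (fun t => ?_) h1 h2)
    · rw [← hp, show t + (k * S.T - l * S.T) + l * S.T = t + k * S.T by ring, pu]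
    · have e : v (t + (k * S.T - l * S.T) + l * S.T) = v (t + (k * S.T - l * S.T)) := pv.nat_mul l _
      rw [← e, show t + (k * S.T - l * S.T) + l * S.T = t + k * S.T by ring]; exact pv.nat_mul k t

end Setup
end SH

namespace SH
open Topology

lemma locint {q φ : ℝ → ℝ} (hq : LocallyIntegrable q volume) (hφ : Continuous φ) :
    LocallyIntegrable (fun t => q t * φ t) volume := by
  have h := (locallyIntegrableOn_univ.2 hq).mul_continuousOn hφ.continuousOn isOpen_univ.isLocallyClosed
  exact locallyIntegrableOn_univ.1 h

lemma bump_exists {q : ℝ → ℝ} {T σ : ℝ} (hT : 0 < T) (hq : LocallyIntegrable q volume) (hσ0 : 0 < σ) (hσT : σ < T)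
    (hp : PosOn q (Icc 0 σ)) : ∃ φ, C1 φ ∧ Function.Periodic φ T ∧ (∀ t, 0 ≤ φ t) ∧
      0 < ∫ t in (0:ℝ)..T, q t * φ t ^ 2 := by
  have hπ := Real.pi_pos
  set m : ℝ → ℝ := fun s => max s 0 with hm
  have cm : Continuous m := by fun_prop
  have m0 : ∀ s ≤ 0, prim m s = 0 := fun s hs => by
    unfold prim
    rw [intervalIntegral.integral_congr (g := fun _ => 0) fun x hx => ?_]
    · simp
    · rw [uIcc_of_ge hs] at hx; exact max_eq_right hx.2
  have m1 : ∀ s > 0, 0 < prim m s := fun s hs =>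
    intervalIntegral.intervalIntegral_pos_of_pos_on (cm.intervalIntegrable _ _)
      (fun x hx => lt_max_of_lt_left hx.1) hs
  set ω := 2 * Real.pi / T with hω
  have hω0 : 0 < ω := by positivity
  have hωT : ω * T = 2 * Real.pi := by rw [hω]; field_simp
  set e : ℝ → ℝ := fun t => Real.cos (ω * (t - σ/2)) - Real.cos (ω * (σ/2)) with he
  have ed : ∀ t, HasDerivAt e (-Real.sin (ω * (t - σ/2)) * ω) t := fun t => by
    have := ((((hasDerivAt_id t).sub_const (σ/2)).const_mul ω).cos).sub_const (Real.cos (ω * (σ/2)))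
    simpa [he] using this
  have φd : ∀ t, HasDerivAt (fun t => prim m (e t)) (m (e t) * (-Real.sin (ω * (t - σ/2)) * ω)) t := fun t =>
    (prim_deriv cm (e t)).comp t (ed t)
  have ce : Continuous e := by fun_prop
  have cφ : Continuous fun t => prim m (e t) := (prim_cont cm).comp ce
  have nn : ∀ s, 0 ≤ prim m s := fun s => by
    rcases le_or_gt s 0 with h | h
    · exact (m0 s h).ge
    · exact (m1 s h).le
  have hωσ : ω * σ < 2 * Real.pi := by rw [← hωT]; gcongr
  have epos : ∀ t ∈ Ioo 0 σ, 0 < e t := by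
    intro t ht
    rw [he]; simp only
    rw [sub_pos, ← Real.cos_abs (ω * (t - σ/2))]
    refine Real.cos_lt_cos_of_nonneg_of_le_pi (abs_nonneg _) (by linarith) ?_
    rw [abs_lt]
    constructor <;> nlinarith [ht.1, ht.2]
  have eneg : ∀ t ∈ Icc σ T, e t ≤ 0 := by
    intro t ht
    rw [he]; simp only
    rw [sub_nonpos]
    have h1 : ω * (σ/2) ≤ ω * (t - σ/2) := by gcongr; linarith [ht.1]
    have h2 : ω * t ≤ 2 * Real.pi := by rw [← hωT]; gcongr; exact ht.2
    rcases le_total (ω * (t - σ/2)) Real.pi with h | h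
    · exact Real.cos_le_cos_of_nonneg_of_le_pi (by positivity) h h1
    · rw [← Real.cos_two_pi_sub (ω * (t - σ/2))]
      exact Real.cos_le_cos_of_nonneg_of_le_pi (by positivity) (by linarith) (by linarith)
  refine ⟨fun t => prim m (e t), C1.of φd (by fun_prop), fun t => ?_, fun t => nn _, ?_⟩
  · have : e (t + T) = e t := by
      rw [he]; simp only
      rw [show ω * (t + T - σ/2) = ω * (t - σ/2) + 2 * Real.pi by rw [← hωT]; ring, Real.cos_add_two_pi]
    simp only [this]
  · have hl := locint hq (φ := fun t => prim m (e t) ^ 2) (by fun_prop)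
    have hi : ∀ a b, IntervalIntegrable (fun t => q t * prim m (e t) ^ 2) volume a b := fun a b =>
      (hl.integrableOn_isCompact isCompact_uIcc).intervalIntegrable
    rw [← intervalIntegral.integral_add_adjacent_intervals (hi 0 σ) (hi σ T),
      intervalIntegral.integral_congr (a := σ) (g := fun _ => 0) fun x hx => ?_]
    · simp only [intervalIntegral.integral_zero, add_zero]
      refine pos_int hl hσ0 ⟨?_, fun hz => hp.2 ?_⟩
      · filter_upwards [hp.1] with t ht
        positivity
      · have h1 : ∀ᵐ t ∂(volume.restrict (Icc 0 σ)), t ≠ 0 ∧ t ≠ σ := by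
          refine ae_restrict_of_ae ?_
          filter_upwards [(Measure.ae_ne volume (0:ℝ)), (Measure.ae_ne volume σ)] with t a b
          exact ⟨a, b⟩
        filter_upwards [hz, h1, ae_restrict_mem measurableSet_Icc] with t h2 h3 h4
        have := m1 _ (epos t ⟨lt_of_le_of_ne h4.1 h3.1.symm, lt_of_le_of_ne h4.2 h3.2⟩)
        rcases mul_eq_zero.1 h2 with h | h
        · exact h
        · exact absurd h (by positivity)
    · rw [uIcc_of_le hσT.le] at hx
      simp only
      rw [m0 _ (eneg x hx)]; ring

lemma prim_finf (S : Setup) {s : ℝ} (hs : 0 ≤ s) : prim S.finf s = S.L * s^2 / 2 := by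
  unfold prim Setup.finf
  rw [intervalIntegral.integral_congr (g := fun x => S.L * x) fun x hx => ?_]
  · rw [intervalIntegral.integral_const_mul, integral_id]; ring
  · rw [uIcc_of_le hs] at hx
    simp only; rw [max_eq_left hx.1]

theorem ctx_exists {T : ℝ} (hT : 0 < T) {q : ℝ → ℝ} (hqper : Function.Periodic q T)
    (hqloc : LocallyIntegrable q volume) {m : ℕ} (hm : 1 ≤ m) (hqsign : SignCond q T m)
    (hqmean : (∫ t in (0:ℝ)..T, q t) < 0) {g : ℝ → ℝ} (hgC2 : ContDiffOn ℝ 2 g (Ici 0))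
    (hg0 : g 0 = 0) (hg'0 : derivWithin g (Ici 0) 0 = 0)
    (hgsup : Tendsto (fun s => g s / s) atTop atTop)
    (hgconv : ∀ s : ℝ, 0 < s → 0 < derivWithin (derivWithin g (Ici 0)) (Ici 0) s) :
    ∃ (S : Setup) (f f' : ℝ → ℝ) (R : ℝ), S.q = q ∧ S.T = T ∧ S.Ctx f f' R ∧ ∀ s ∈ Ioo 0 R, f s = g s := by
  obtain ⟨Λ, hΛ, hap⟩ := apriori hqloc hqsign
  obtain ⟨φ, hφ, φper, φ0, φq⟩ : ∃ φ, C1 φ ∧ Function.Periodic φ T ∧ (∀ t, 0 ≤ φ t) ∧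
      0 < ∫ t in (0:ℝ)..T, q t * φ t ^ 2 := by
    obtain ⟨σ, h0, h1, hσ, hp, -⟩ := hqsign
    have hmono : ∀ j, 1 ≤ j → j + 1 ≤ 2 * m → σ 1 < σ (j+1) := by
      intro j hj hjm
      induction j, hj using Nat.le_induction with
      | base => exact hσ 1 (by omega)
      | succ j hj ih => exact (ih (by omega)).trans (hσ (j+1) (by omega))
    have h2 := hmono (2*m - 1) (by omega) (by omega)
    rw [show 2*m - 1 + 1 = 2*m by omega, h1] at h2
    have h3 := hσ 0 (by omega)
    have h4 := hp 0 (by omega)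
    simp only [mul_zero, zero_add, h0] at h3 h4
    exact bump_exists hT hqloc h3 h2 h4
  set κ := ∫ t in (0:ℝ)..T, q t * φ t ^ 2 with hκ
  set E := ∫ t in (0:ℝ)..T, (deriv φ t) ^ 2 with hE
  set d := derivWithin g (Ici 0) with hd
  have hd1 : ContDiffOn ℝ 1 d (Ici 0) := hgC2.derivWithin (uniqueDiffOn_Ici 0) (by norm_num)
  have cd : ContinuousOn d (Ici 0) := hd1.continuousOn
  have cdd : ContinuousOn (derivWithin d (Ici 0)) (Ici 0) := hd1.continuousOn_derivWithin (uniqueDiffOn_Ici 0) le_rfl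
  have gd : ∀ s ∈ Ici (0:ℝ), HasDerivWithinAt g (d s) (Ici 0) s := fun s hs =>
    (hgC2.differentiableOn (by norm_num) s hs).hasDerivWithinAt
  have dd : ∀ s > 0, HasDerivAt d (derivWithin d (Ici 0) s) s := fun s hs =>
    ((hd1.differentiableOn (by norm_num) s hs.le).hasDerivWithinAt).hasDerivAt (Ici_mem_nhds hs)
  have dmono : StrictMonoOn d (Ici 0) := strictMonoOn_of_deriv_pos (convex_Ici 0) cd fun s hs => by
    rw [interior_Ici] at hs
    rw [(dd s hs).deriv]; exact hgconv s hs
  obtain ⟨s1, hs1⟩ := eventually_atTop.1 (hgsup.eventually_ge_atTop (max Λ (E / κ + 1)))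
  set R := max 1 (max s1 (Λ * s1)) with hR
  have hR1 : 1 ≤ R := le_max_left _ _
  have hR0 : 0 < R := by linarith
  have hRs : s1 ≤ R := (le_max_left _ _).trans (le_max_right _ _)
  have hRΛ : Λ * s1 ≤ R := (le_max_right _ _).trans (le_max_right _ _)
  set f' : ℝ → ℝ := fun s => d (max 0 (min s R)) with hf'
  have cf' : Continuous f' := cd.comp_continuous (by fun_prop) fun s => mem_Ici.2 (le_max_left _ _)
  have mf' : Monotone f' := fun s t h => dmono.monotoneOn (mem_Ici.2 (le_max_left _ _)) (mem_Ici.2 (le_max_left _ _))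
    (max_le_max le_rfl (min_le_min h le_rfl))
  have f'0 : ∀ s ≤ 0, f' s = 0 := fun s hs => by
    simp only [hf']; rw [max_eq_left ((min_le_left _ _).trans hs)]; exact hg'0
  have f'i : ∀ s ∈ Icc 0 R, f' s = d s := fun s hs => by
    simp only [hf']; rw [min_eq_left hs.2, max_eq_right hs.1]
  have f'R : ∀ s ≥ R, f' s = d R := fun s hs => by
    simp only [hf']; rw [min_eq_right hs, max_eq_right hR0.le]
  set L := d R with hL
  have hL0 : 0 < L := by
    have := dmono (self_mem_Ici) (mem_Ici.2 hR0.le) hR0; rwa [hg'0] at this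
  have f'nn : ∀ s, 0 ≤ f' s := fun s => by
    rcases le_total s 0 with h | h
    · exact (f'0 s h).ge
    · rw [← f'0 0 le_rfl]; exact mf' h
  have f'le : ∀ s, f' s ≤ L := fun s => by
    rcases le_total s R with h | h
    · rw [← f'R R le_rfl]; exact mf' h
    · exact (f'R s h).le
  set f := prim f' with hf
  have fd : ∀ s, HasDerivAt f (f' s) s := prim_deriv cf'
  have f0 : f 0 = 0 := intervalIntegral.integral_same
  have fg : ∀ s ∈ Icc 0 R, f s = g s := eq_of_has_deriv_right_eq (f' := d)
    (fun x hx => by rw [← f'i x ⟨hx.1, hx.2.le⟩]; exact (fd x).hasDerivWithinAt)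
    (fun x hx => (gd x hx.1).mono (Ici_subset_Ici.2 hx.1)) (prim_cont cf').continuousOn
    (hgC2.continuousOn.mono fun x hx => hx.1) (by rw [f0, hg0])
  have flip : ∀ s t, |f s - f t| ≤ L * |s - t| := fun s t => by
    have := prim_est cf' (s := t) (t := s) (c := 0) (ε := L) fun x _ => by
      rw [sub_zero, abs_of_nonneg (f'nn x)]; exact f'le x
    simpa using this
  have fR : ∀ s ≥ R, f s = f R + L * (s - R) := fun s hs => by
    have := prim_est cf' (s := R) (t := s) (c := L) (ε := 0) fun x hx => by
      rw [uIcc_of_le hs] at hx; rw [f'R x hx.1]; simp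
    simp only [zero_mul, abs_nonpos_iff] at this
    linarith
  have fneg : ∀ s ≤ 0, f s = 0 := fun s hs => by
    have := prim_est cf' (s := 0) (t := s) (c := 0) (ε := 0) fun x hx => by
      rw [uIcc_of_ge hs] at hx; rw [f'0 x hx.2]; simp
    simp only [zero_mul, abs_nonpos_iff] at this
    linarith
  have f'pos : ∀ s > 0, 0 < f' s := fun s hs => by
    have := dmono (self_mem_Ici) (mem_Ici.2 (le_max_left 0 (min s R))) (lt_max_of_lt_right (lt_min hs hR0))
    rwa [hg'0] at this
  have fpos : ∀ s > 0, 0 < f s := fun s hs =>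
    intervalIntegral.intervalIntegral_pos_of_pos_on (cf'.intervalIntegrable _ _) (fun x hx => f'pos x hx.1) hs
  have hfLR : f R ≤ L * R := by
    have := flip R 0; rw [f0, sub_zero, sub_zero, abs_of_pos (fpos R hR0), abs_of_pos hR0] at this; exact this
  have hgs : ∀ s, s1 ≤ s → 0 < s → Λ * s ≤ g s := fun s h h0 => by
    have := (le_max_left _ _).trans (hs1 s h)
    rwa [le_div_iff₀ h0] at this
  have hLE : max Λ (E / κ + 1) ≤ L := by
    have h1 := hs1 R hRs
    rw [le_div_iff₀ hR0, ← fg R ⟨hR0.le, le_rfl⟩] at h1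
    exact le_of_mul_le_mul_right (h1.trans hfLR) hR0
  have hLΛ : Λ ≤ L := (le_max_left _ _).trans hLE
  have qi : ∀ a b, IntervalIntegrable q volume a b := fun a b =>
    (hqloc.integrableOn_isCompact isCompact_uIcc).intervalIntegrable
  set B := ∫ t in (0:ℝ)..T, |q t| with hB
  have hB0 : 0 ≤ B := intervalIntegral.integral_nonneg hT.le fun t _ => abs_nonneg _
  have hBB : ∀ a b, a ≤ b → b ≤ a + T → ∫ t in a..b, |q t| ≤ B := by
    intro a b hab hb
    have h1 : ∫ t in a..(a+T), |q t| = B := by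
      have hp : Function.Periodic (fun t => |q t|) T := fun t => by simp only; rw [hqper]
      have := hp.intervalIntegral_add_eq a 0
      rwa [zero_add] at this
    rw [← h1, ← intervalIntegral.integral_add_adjacent_intervals (qi a b).abs (qi b (a+T)).abs]
    have := intervalIntegral.integral_nonneg (μ := volume) hb fun t _ => abs_nonneg (q t)
    linarith
  obtain ⟨n, hn⟩ := exists_nat_gt (16 * T * L * B)
  have hn0 : 0 < n := by
    have : (0:ℝ) < n := lt_of_le_of_lt (by positivity) hn
    exact_mod_cast this
  let S : Setup := ⟨q, T, hT, hqper, hqloc, L, hL0, B, hB0, hBB, n, hn0, by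
    have : (0:ℝ) < n := by exact_mod_cast hn0
    rw [show T / n * L * B = T * L * B / n by ring, div_le_iff₀ this]; linarith⟩
  refine ⟨S, f, f', R, rfl, rfl, ⟨⟨flip, f0⟩, fd, cf', mf', fneg, fpos, ⟨L * R, fun s => ?_⟩, fun u hu hu0 huc => ?_,
    fun u hu hu0 huc t => ?_, hqmean, ⟨φ, hφ, φper, φ0, ?_⟩, ⟨derivWithin d (Ici 0), fun s hs => ⟨?_, hgconv s hs.1⟩,
      cdd.mono fun s hs => hs.1.le⟩⟩, fun s hs => fg s ⟨hs.1.le, hs.2.le⟩⟩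
  · show |f s - L * max s 0| ≤ L * R
    rcases le_total s 0 with h | h
    · rw [fneg s h, max_eq_right h]; simp; positivity
    rw [max_eq_left h]
    have h1 := flip s 0
    rw [f0, sub_zero, sub_zero, abs_of_nonneg h] at h1
    have h2 : 0 ≤ f s := by
      rcases h.eq_or_lt with h | h
      · rw [← h, f0]
      · exact (fpos s h).le
    rw [abs_of_nonneg h2] at h1
    rcases le_total s R with h' | h'
    · have := mul_le_mul_of_nonneg_left h' hL0.le
      rw [abs_le]; constructor <;> linarith
    · rw [fR s h']
      have := fpos R hR0
      rw [abs_le]; constructor <;> nlinarith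
  · refine hap S rfl rfl f u ⟨flip, f0⟩ hu (fun s hs => ?_) hu0 huc R hR0 fun s hs => ?_
    · rcases hs.eq_or_lt with h | h
      · rw [← h, f0]
      · exact (fpos s h).le
    · have hs0 : 0 < s := lt_of_lt_of_le (by positivity) hs
      have hss : s1 ≤ s := by
        refine le_trans ?_ hs
        rw [le_inv_mul_iff₀ hΛ]; exact hRΛ
      rcases le_total s R with h | h
      · rw [fg s ⟨hs0.le, h⟩]; exact hgs s hss hs0
      · rw [fR s h, fg R ⟨hR0.le, le_rfl⟩]
        have := hgs R hRs hR0
        nlinarith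
  · refine le_antisymm (le_of_forall_pos_lt_add fun ε hε => ?_) (hu0 t)
    rw [zero_add]
    refine hap S rfl rfl S.finf u S.finf_adm hu (fun s hs => ?_) hu0 huc ε hε (fun s hs => ?_) t
    · exact mul_nonneg hL0.le (le_max_right _ _)
    · have hs0 : 0 < s := lt_of_lt_of_le (by positivity) hs
      show Λ * s ≤ L * max s 0
      rw [max_eq_left hs0.le]; gcongr
  · have cφ : Continuous φ := hφ.cont
    have cφ' := hφ.2
    have e : S.J S.finf 0 S.T φ = E / 2 - L / 2 * κ := by
      unfold Setup.J
      rw [hE, hκ, ← intervalIntegral.integral_div, ← intervalIntegral.integral_const_mul,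
        ← intervalIntegral.integral_sub]
      · refine intervalIntegral.integral_congr fun t _ => ?_
        rw [prim_finf S (φ0 t)]
        show _ - q t * (L * _ / 2) = _
        ring
      · exact Continuous.intervalIntegrable (by fun_prop) _ _
      · refine IntervalIntegrable.const_mul ?_ _
        exact (qi 0 T).mul_continuousOn (by fun_prop)
    rw [e]
    have h1 := (le_max_right _ _).trans hLE
    have h2 : E / κ * κ = E := by field_simp
    nlinarith
  · refine (dd s hs.1).congr_of_eventuallyEq ?_
    filter_upwards [Ioo_mem_nhds hs.1 hs.2] with x hx
    exact f'i x ⟨hx.1.le, hx.2.le⟩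

lemma isSol_of {S : Setup} {f g : ℝ → ℝ} {R : ℝ} (hf : S.Adm f) (hfg : ∀ s ∈ Ioo 0 R, f s = g s) {u : ℝ → ℝ}
    (hu : S.GSol f u) (h0 : ∀ t, 0 < u t) (hR : ∀ t, u t < R) : IsSol (fun t s => S.q t * g s) u := by
  have e : (fun t => S.q t * g (u t)) = fun t => S.q t * f (u t) := by
    funext t; rw [hfg _ ⟨h0 t, hR t⟩]
  refine ⟨deriv u, fun t => (hu.1.1 t).hasDerivAt, ?_, fun t => ?_⟩
  · simp only [e]; exact locint S.loc (hf.cont.comp hu.1.cont)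
  · simp only [e]; linarith [hu.2 0 t]

end SH

/-- Theorem 1.1: under `(q#)`, `(q*)`, `(g*)`, `(gs)`, `(g**)` there is a
positive `T`-periodic solution `u*` of `u'' + q(t)g(u) = 0` and, for every large `k`, pairs of
positive subharmonic solutions of order `k` oscillating around `u*`. -/
theorem stmt0 (T : ℝ) (hT : 0 < T) (q : ℝ → ℝ)
    (hqper : Function.Periodic q T)
    (hqloc : MeasureTheory.LocallyIntegrable q MeasureTheory.volume)
    (m : ℕ) (hm : 1 ≤ m) (hqsign : SignCond q T m)
    (hqmean : (∫ t in (0:ℝ)..T, q t) < 0)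
    (g : ℝ → ℝ) (hgC2 : ContDiffOn ℝ 2 g (Set.Ici 0))
    (hg0 : g 0 = 0) (hgpos : ∀ s : ℝ, 0 < s → 0 < g s)
    (hg'0 : derivWithin g (Set.Ici 0) 0 = 0)
    (hgsup : Filter.Tendsto (fun s => g s / s) Filter.atTop Filter.atTop)
    (hgconv : ∀ s : ℝ, 0 < s → 0 < derivWithin (derivWithin g (Set.Ici 0)) (Set.Ici 0) s) :
    ∃ ustar : ℝ → ℝ,
      IsSol (fun t s => q t * g s) ustar ∧ (∀ t, 0 < ustar t) ∧
      Function.Periodic ustar T ∧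
      ∃ kstar : ℕ, 1 ≤ kstar ∧ ∀ k : ℕ, kstar ≤ k →
        ∃ mk : ℕ, 1 ≤ mk ∧ ∀ j : ℕ, Nat.Coprime j k → 1 ≤ j → j ≤ mk →
          ∃ u₁ u₂ : ℝ → ℝ,
            (IsSol (fun t s => q t * g s) u₁ ∧ (∀ t, 0 < u₁ t) ∧ IsSubharmonic u₁ T k ∧
              {t | t ∈ Set.Ico (0:ℝ) ((k:ℝ) * T) ∧ u₁ t = ustar t}.ncard = 2 * j) ∧
            (IsSol (fun t s => q t * g s) u₂ ∧ (∀ t, 0 < u₂ t) ∧ IsSubharmonic u₂ T k ∧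
              {t | t ∈ Set.Ico (0:ℝ) ((k:ℝ) * T) ∧ u₂ t = ustar t}.ncard = 2 * j) ∧
            ¬ SameClass u₁ u₂ T := by
  obtain ⟨S, f, f', R, rfl, rfl, H, hfg⟩ := SH.ctx_exists hT hqper hqloc hm hqsign hqmean hgC2 hg0 hg'0 hgsup hgconv
  obtain ⟨v, hv, hv0, hvR, pv⟩ := H.exists_star
  refine ⟨v, SH.isSol_of H.adm hfg hv hv0 hvR, hv0, pv, ?_⟩
  obtain ⟨k0, hk0, hK⟩ := H.K_exists hv hv0 hvR pv
  refine ⟨k0, by omega, fun k hk => ⟨1, le_rfl, fun j _ hj1 hj2 => ?_⟩⟩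
  obtain ⟨K, A, c, γ, F⟩ := hK k hk
  obtain ⟨u₁, u₂, g1, g2, hne⟩ := H.two pv (by omega) F
  obtain rfl : j = 1 := by omega
  have key : ∀ u, S.Good f R k v u → (IsSol (fun t s => S.q t * g s) u ∧ (∀ t, 0 < u t) ∧ IsSubharmonic u S.T k ∧
      {t | t ∈ Set.Ico (0:ℝ) ((k:ℝ) * S.T) ∧ u t = v t}.ncard = 2 * 1) := fun u hu =>
    ⟨SH.isSol_of H.adm hfg hu.1 hu.2.1 hu.2.2.1, hu.2.1, ⟨hu.2.2.2.1, SH.Setup.Good.subh pv hu⟩,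
      SH.Setup.Good.count H.adm hv pv (by omega) hu⟩
  exact ⟨u₁, u₂, key u₁ g1, key u₂ g2, hne⟩
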